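/- arXiv:1308.1909 — 4 statements merged into one kernel-verified Lean document; each statement's English description precedes it below -/
import Mathlib

section
/- Let d ≥ 1, T > 0, let a_j, ã_j : [0,T] → ℝ be continuous with a_j(t) ≥ 0, let C₀ > 0, and let V₁, V₂ : [0,T]×ℝ^d → ℝ be continuous, smooth in x with all x-derivatives continuous on [0,T]×ℝ^d, satisfying V₁(t,x) ≥ −C₀, |∂^α_x V₁(t,x)| ≤ C_α for |α| ≥ 2, and |∂^α_x V₂(t,x)| ≤ C_α for |α| ≥ 1, for all (t,x). Set ℒ(t)u = −Σ_j a_j(t)∂²u/∂x_j² + Σ_j ã_j(t)∂u/∂x_j + V₁(t,·)u + iV₂(t,·)u. If u and v are two functions on [0,T]×ℝ^d, each Schwartz in x for every t, differentiable in t with Schwartz time-derivative, with t ↦ u(t,·), ∂_t u(t,·), v(t,·), ∂_t v(t,·) continuous into L², satisfying ∂_t u(t,·) + ℒ(t)u(t,·) = 0 and ∂_t v(t,·) + ℒ(t)v(t,·) = 0 on [0,T] and u(0,·) = v(0,·), then u = v on [0,T]×ℝ^d. -/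
open MeasureTheory Complex Filter
open scoped BigOperators RealInnerProductSpace

noncomputable section

/-- Euclidean space `ℝ^d`. -/
abbrev Ed (d : ℕ) : Type := EuclideanSpace ℝ (Fin d)

/-- Partial derivative in the `j`-th coordinate direction. -/
def pd {F : Type*} [NormedAddCommGroup F] [NormedSpace ℝ F]
    (d : ℕ) (j : Fin d) (f : Ed d → F) : Ed d → F :=
  fun x => fderiv ℝ f x (EuclideanSpace.single j 1)

/-- Iterated partial derivative `∂^α` for a multi-index `α : Fin d → ℕ`. -/
def md {F : Type*} [NormedAddCommGroup F] [NormedSpace ℝ F]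
    {d : ℕ} (α : Fin d → ℕ) (f : Ed d → F) : Ed d → F :=
  (List.finRange d).foldr (fun j g => (pd d j)^[α j] g) f

/-- Length `|α| = α₁ + ⋯ + α_d` of a multi-index. -/
def mlen {d : ℕ} (α : Fin d → ℕ) : ℕ := ∑ j, α j

/-- `L²` inner product `⟨f, g⟩ = ∫ f(x) conj(g(x)) dx` (antilinear in the second factor). -/
def ip {d : ℕ} (f g : Ed d → ℂ) : ℂ := ∫ x, f x * (starRingEnd ℂ) (g x)

/-- Square `‖f‖²` of the `L²` norm. -/
def l2sq {d : ℕ} (f : Ed d → ℂ) : ℝ := ∫ x, ‖f x‖ ^ 2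

/-- Time dependent operator `ℒ(t)u = -Σ a_j(t) ∂²u/∂x_j² + Σ aa_j(t) ∂u/∂x_j
    + V₁(t,·) u + i V₂(t,·) u`. -/
def LopT {d : ℕ} (a aa : Fin d → ℝ → ℝ) (V₁ V₂ : ℝ → Ed d → ℝ)
    (t : ℝ) (u : Ed d → ℂ) : Ed d → ℂ :=
  fun x => -∑ j, (a j t : ℂ) * pd d j (pd d j u) x + ∑ j, (aa j t : ℂ) * pd d j u x
    + (V₁ t x : ℂ) * u x + Complex.I * (V₂ t x : ℂ) * u x

open scoped Topology LineDeriv SchwartzMap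

section IntegralOfDerivative

variable {X : Type*} [MeasurableSpace X] {μ : Measure X} {T : ℝ} {F G : ℝ → X → ℝ}

/-- The pointwise time derivative of a family of measurable functions is jointly measurable. -/
lemma aestronglyMeasurable_uncurry_of_hasDerivWithinAt [SFinite μ] (hT : 0 ≤ T)
    (hFm : ∀ s ∈ Set.Icc 0 T, StronglyMeasurable (F s))
    (hF : ∀ s ∈ Set.Icc 0 T, ∀ x,
      HasDerivWithinAt (fun r => F r x) (G s x) (Set.Icc 0 T) s) :
    AEStronglyMeasurable (Function.uncurry G)
      ((volume.restrict (Set.Ioo 0 T)).prod μ) := by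
  let E : ℝ → X → ℝ := fun s x => F (Set.projIcc 0 T hT s) x
  have hE : StronglyMeasurable (Function.uncurry E) := by
    refine stronglyMeasurable_uncurry_of_continuous_of_stronglyMeasurable (fun x => ?_)
      (fun s => hFm _ (Subtype.mem _))
    have hc : ContinuousOn (fun r => F r x) (Set.Icc 0 T) :=
      fun s hs => (hF s hs x).continuousWithinAt
    exact hc.comp_continuous (continuous_subtype_val.comp continuous_projIcc)
      (fun s => Subtype.mem _)
  have hEd : ∀ s ∈ Set.Ioo 0 T, ∀ x, HasDerivAt (fun r => E r x) (G s x) s := by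
    intro s hs x
    have hnhds : Set.Icc 0 T ∈ 𝓝 s := Icc_mem_nhds hs.1 hs.2
    refine ((hF s ⟨hs.1.le, hs.2.le⟩ x).hasDerivAt hnhds).congr_of_eventuallyEq ?_
    filter_upwards [hnhds] with r hr
    simp [E, Set.projIcc_of_mem hT hr]
  have hstep : Tendsto (fun n : ℕ => 1 / ((n : ℝ) + 1)) atTop (𝓝[≠] 0) :=
    tendsto_nhdsWithin_iff.2 ⟨tendsto_one_div_add_atTop_nhds_zero_nat,
      Eventually.of_forall fun n => (Nat.one_div_pos_of_nat (α := ℝ)).ne'⟩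
  refine (aemeasurable_of_tendsto_metrizable_ae'
    (f := fun (n : ℕ) (p : ℝ × X) =>
      (1 / ((n : ℝ) + 1))⁻¹ • (E (p.1 + 1 / ((n : ℝ) + 1)) p.2 - E p.1 p.2))
    (fun n => ?_) ?_).aestronglyMeasurable
  · have h₁ : Measurable fun p : ℝ × X => E (p.1 + 1 / ((n : ℝ) + 1)) p.2 :=
      hE.measurable.comp ((measurable_fst.add_const _).prodMk measurable_snd)
    have h₂ : Measurable fun p : ℝ × X => E p.1 p.2 := hE.measurable
    exact ((h₁.sub h₂).const_smul ((1 / ((n : ℝ) + 1))⁻¹)).aemeasurable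
  · have hIoo : ∀ᵐ p ∂((volume.restrict (Set.Ioo 0 T)).prod μ), p.1 ∈ Set.Ioo 0 T :=
      Measure.quasiMeasurePreserving_fst.ae (ae_restrict_mem measurableSet_Ioo)
    filter_upwards [hIoo] with p hp
    exact (hEd p.1 hp p.2).tendsto_slope_zero.comp hstep

/-- If the pointwise time derivative `G` of `F` is bounded in `L¹` and has nonpositive space
integral at each time, then the space integral of `F` does not exceed that of `F 0 = 0`. -/
lemma integral_nonpos_of_hasDerivWithinAt [SFinite μ] (hT : 0 ≤ T)
    (hFm : ∀ s ∈ Set.Icc 0 T, StronglyMeasurable (F s))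
    (hF : ∀ s ∈ Set.Icc 0 T, ∀ x,
      HasDerivWithinAt (fun r => F r x) (G s x) (Set.Icc 0 T) s)
    (hF0 : ∀ x, F 0 x = 0) (hG : ∀ s ∈ Set.Icc 0 T, Integrable (G s) μ) {C : ℝ}
    (hGC : ∀ s ∈ Set.Icc 0 T, ∫ x, ‖G s x‖ ∂μ ≤ C)
    (hG0 : ∀ s ∈ Set.Icc 0 T, ∫ x, G s x ∂μ ≤ 0) :
    ∫ x, F T x ∂μ ≤ 0 := by
  have hmeas := aestronglyMeasurable_uncurry_of_hasDerivWithinAt (μ := μ) hT hFm hF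
  have hmem : ∀ᵐ s ∂(volume.restrict (Set.Ioo 0 T)), s ∈ Set.Icc 0 T :=
    (ae_restrict_mem measurableSet_Ioo).mono fun s hs => Set.Ioo_subset_Icc_self hs
  have hint : Integrable (Function.uncurry G) ((volume.restrict (Set.Ioo 0 T)).prod μ) := by
    refine (integrable_prod_iff hmeas).2 ⟨hmem.mono fun s hs => hG s hs, ?_⟩
    refine Integrable.of_bound hmeas.norm.integral_prod_right' C (hmem.mono fun s hs => ?_)
    rw [Real.norm_of_nonneg (integral_nonneg fun x => norm_nonneg _)]
    exact hGC s hs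
  have hFTC : ∀ᵐ x ∂μ, ∫ s in Set.Ioo 0 T, G s x = F T x := by
    filter_upwards [hint.prod_left_ae] with x hx
    have h := intervalIntegral.integral_eq_sub_of_hasDerivAt_of_le hT
      (f := fun r => F r x) (f' := fun r => G r x)
      (fun s hs => (hF s hs x).continuousWithinAt)
      (fun s hs => (hF s ⟨hs.1.le, hs.2.le⟩ x).hasDerivAt (Icc_mem_nhds hs.1 hs.2))
      ((intervalIntegrable_iff_integrableOn_Ioo_of_le hT).2 hx)
    rwa [intervalIntegral.integral_of_le hT, integral_Ioc_eq_integral_Ioo, hF0, sub_zero] at h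
  rw [← integral_congr_ae hFTC, ← integral_integral_swap hint]
  exact integral_nonpos_of_ae (hmem.mono fun s hs => hG0 s hs)

end IntegralOfDerivative

section Schwartz

variable {d : ℕ}

lemma integrable_norm_sq (f : 𝓢(Ed d, ℂ)) : Integrable fun x => ‖f x‖ ^ 2 :=
  (memLp_two_iff_integrable_sq_norm f.continuous.aestronglyMeasurable).1 (f.memLp 2)

lemma integrable_inner (f g : 𝓢(Ed d, ℂ)) : Integrable fun x => inner ℝ (f x) (g x) :=
  (SchwartzMap.pairing (innerSL ℝ) f g).integrable

lemma l2sq_sub_le (f g : 𝓢(Ed d, ℂ)) : l2sq ⇑(f - g) ≤ 2 * l2sq f + 2 * l2sq g := by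
  simp only [l2sq, ← integral_const_mul]
  rw [← integral_add ((integrable_norm_sq f).const_mul 2) ((integrable_norm_sq g).const_mul 2)]
  refine integral_mono (integrable_norm_sq _)
    (((integrable_norm_sq f).const_mul 2).add ((integrable_norm_sq g).const_mul 2)) fun x => ?_
  have h := norm_sub_le (f x) (g x)
  simp only [sub_apply]
  nlinarith [sq_nonneg (‖f x‖ - ‖g x‖), norm_nonneg (f x - g x)]

lemma exists_l2sq_le {K : Set ℝ} (hK : IsCompact K) (u : ℝ → 𝓢(Ed d, ℂ))
    (hu : ∀ t₀ ∈ K, Tendsto (fun t => ∫ x, ‖u t x - u t₀ x‖ ^ 2) (𝓝[K] t₀) (𝓝 0)) :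
    ∃ C, ∀ t ∈ K, l2sq (u t) ≤ C := by
  refine hK.induction_on (p := fun s => ∃ C, ∀ t ∈ s, l2sq (u t) ≤ C) ⟨0, by simp⟩
    (fun s t hst ⟨C, hC⟩ => ⟨C, fun r hr => hC r (hst hr)⟩)
    (fun s t ⟨C, hC⟩ ⟨D, hD⟩ => ⟨max C D, fun r hr => hr.elim
      (fun h => (hC r h).trans (le_max_left _ _)) (fun h => (hD r h).trans (le_max_right _ _))⟩)
    (fun t₀ ht₀ => ⟨_, (hu t₀ ht₀).eventually_lt_const one_pos,
      2 * 1 + 2 * l2sq ⇑(-u t₀), fun t ht => ?_⟩)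
  have h := l2sq_sub_le (u t - u t₀) (-u t₀)
  have h₁ : l2sq ⇑(u t - u t₀) < 1 := ht
  rw [sub_neg_eq_add, sub_add_cancel] at h
  linarith

lemma integral_inner_lineDeriv_self (f : 𝓢(Ed d, ℂ)) (m : Ed d) :
    ∫ x, inner ℝ (f x) (∂_{m} f x) = 0 := by
  have h : ∫ x, inner ℝ (f x) (∂_{m} f x) = -∫ x, inner ℝ (∂_{m} f x) (f x) :=
    SchwartzMap.integral_bilinear_lineDerivOp_right_eq_neg_left f f (innerSL ℝ) m
  simp only [real_inner_comm (f _)] at h ⊢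
  linarith

lemma integral_inner_lineDeriv_lineDeriv_nonpos (f : 𝓢(Ed d, ℂ)) (m : Ed d) :
    ∫ x, inner ℝ (f x) (∂_{m} (∂_{m} f) x) ≤ 0 := by
  have h : ∫ x, inner ℝ (f x) (∂_{m} (∂_{m} f) x) = -∫ x, inner ℝ (∂_{m} f x) (∂_{m} f x) :=
    SchwartzMap.integral_bilinear_lineDerivOp_right_eq_neg_left f (∂_{m} f) (innerSL ℝ) m
  rw [h, neg_nonpos]
  exact integral_nonneg fun x => real_inner_self_nonneg

lemma pd_eq_lineDeriv (j : Fin d) (f : 𝓢(Ed d, ℂ)) :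
    pd d j f = ⇑(∂_{(EuclideanSpace.single j 1 : Ed d)} f : 𝓢(Ed d, ℂ)) := rfl

lemma lineDeriv_sub (m : Ed d) (f g : 𝓢(Ed d, ℂ)) :
    (∂_{m} (f - g) : 𝓢(Ed d, ℂ)) = ∂_{m} f - ∂_{m} g :=
  map_sub (LineDeriv.lineDerivOpCLM ℝ 𝓢(Ed d, ℂ) m) f g

lemma LopT_sub (a aa : Fin d → ℝ → ℝ) (V₁ V₂ : ℝ → Ed d → ℝ) (t : ℝ) (f g : 𝓢(Ed d, ℂ))
    (x : Ed d) :
    LopT a aa V₁ V₂ t ⇑(f - g) x = LopT a aa V₁ V₂ t f x - LopT a aa V₁ V₂ t g x := by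
  simp only [LopT, pd_eq_lineDeriv, lineDeriv_sub, sub_apply, mul_sub,
    Finset.sum_sub_distrib]
  ring

/-- Dissipativity of `ℒ(t)`: if `g = -ℒ(t)f` then `Re ⟨g, f⟩ ≤ C₀ ‖f‖²`. -/
lemma integral_inner_le_of_add_LopT_eq_zero {a aa : Fin d → ℝ → ℝ} {V₁ V₂ : ℝ → Ed d → ℝ} {t : ℝ}
    (ha : ∀ j, 0 ≤ a j t) {C₀ : ℝ} (hV₁ : ∀ x, -C₀ ≤ V₁ t x) (f g : 𝓢(Ed d, ℂ))
    (hfg : ∀ x, g x + LopT a aa V₁ V₂ t f x = 0) :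
    ∫ x, inner ℝ (f x) (g x) ≤ C₀ * l2sq f := by
  let D (j : Fin d) (h : 𝓢(Ed d, ℂ)) : 𝓢(Ed d, ℂ) := ∂_{(EuclideanSpace.single j 1 : Ed d)} h
  have hD2 : Integrable fun x => ∑ j, a j t * inner ℝ (f x) (D j (D j f) x) :=
    integrable_finsetSum _ fun j _ => (integrable_inner _ _).const_mul _
  have hD1 : Integrable fun x => ∑ j, aa j t * inner ℝ (f x) (D j f x) :=
    integrable_finsetSum _ fun j _ => (integrable_inner _ _).const_mul _
  have hpt : ∀ x, inner ℝ (f x) (g x) ≤ ∑ j, a j t * inner ℝ (f x) (D j (D j f) x)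
      - ∑ j, aa j t * inner ℝ (f x) (D j f x) + C₀ * ‖f x‖ ^ 2 := by
    intro x
    have hg : g x = ∑ j, a j t • D j (D j f) x - ∑ j, aa j t • D j f x
        - V₁ t x • f x - V₂ t x • (I * f x) := by
      have h := hfg x
      simp only [LopT, pd_eq_lineDeriv] at h
      simp only [real_smul, D]
      linear_combination h
    have hI : inner ℝ (f x) (I * f x) = 0 := by
      simp [Complex.inner]; ring
    rw [hg, inner_sub_right, inner_sub_right, inner_sub_right, inner_sum, inner_sum]
    simp only [real_inner_smul_right, hI, real_inner_self_eq_norm_sq]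
    nlinarith [hV₁ x, sq_nonneg ‖f x‖]
  refine (integral_mono (integrable_inner f g)
    ((hD2.sub hD1).add ((integrable_norm_sq f).const_mul C₀)) hpt).trans ?_
  rw [integral_add' (hD2.sub hD1) ((integrable_norm_sq f).const_mul C₀), integral_sub' hD2 hD1,
    integral_finsetSum _ fun j _ => (integrable_inner _ _).const_mul _,
    integral_finsetSum _ fun j _ => (integrable_inner _ _).const_mul _]
  simp only [integral_const_mul]
  have h2 : ∑ j, a j t * ∫ x, inner ℝ (f x) (D j (D j f) x) ≤ 0 :=
    Finset.sum_nonpos fun j _ =>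
      mul_nonpos_of_nonneg_of_nonpos (ha j) (integral_inner_lineDeriv_lineDeriv_nonpos f _)
  have h1 : ∑ j, aa j t * ∫ x, inner ℝ (f x) (D j f x) = 0 :=
    Finset.sum_eq_zero fun j _ => by rw [integral_inner_lineDeriv_self, mul_zero]
  rw [h1]
  simp only [l2sq]
  linarith

/-- A family of Schwartz functions vanishing at time `0`, with time derivative `w'` bounded in `L²`
and `Re ⟨w', w⟩ ≤ C₀ ‖w‖²`, vanishes identically. -/
lemma eq_zero_of_integral_inner_le {T : ℝ} (hT : 0 ≤ T) {w w' : ℝ → 𝓢(Ed d, ℂ)}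
    (hw : ∀ t ∈ Set.Icc 0 T, ∀ x,
      HasDerivWithinAt (fun s => w s x) (w' t x) (Set.Icc 0 T) t)
    {C C' C₀ : ℝ} (hC₀ : 0 ≤ C₀) (hC : ∀ t ∈ Set.Icc 0 T, l2sq (w t) ≤ C)
    (hC' : ∀ t ∈ Set.Icc 0 T, l2sq (w' t) ≤ C')
    (hle : ∀ t ∈ Set.Icc 0 T, ∫ x, inner ℝ (w t x) (w' t x) ≤ C₀ * l2sq (w t))
    (h0 : w 0 = 0) (x : Ed d) : w T x = 0 := by
  let e : ℝ → ℝ := fun s => Real.exp (-(2 * C₀) * s)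
  let G : ℝ → Ed d → ℝ := fun s x =>
    e s * (2 * inner ℝ (w s x) (w' s x) - 2 * C₀ * ‖w s x‖ ^ 2)
  have hGint : ∀ s, Integrable (G s) := fun s =>
    (((integrable_inner (w s) (w' s)).const_mul 2).sub
      ((integrable_norm_sq (w s)).const_mul (2 * C₀))).const_mul (e s)
  have hneg : ∫ x, e T * ‖w T x‖ ^ 2 ≤ 0 := by
    refine integral_nonpos_of_hasDerivWithinAt (F := fun s x => e s * ‖w s x‖ ^ 2) (G := G)
      (C := (1 + 2 * C₀) * C + C') hT
      (fun s _ => (((w s).continuous.norm.pow 2).const_mul (e s)).stronglyMeasurable)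
      (fun s hs x => ?_) (fun x => by simp [h0]) (fun s _ => hGint s) (fun s hs => ?_)
      (fun s hs => ?_)
    · have he : HasDerivAt e (e s * -(2 * C₀)) s := by
        simpa [e] using ((hasDerivAt_id s).const_mul (-(2 * C₀))).exp
      refine (he.hasDerivWithinAt.mul (hw s hs x).norm_sq).congr_deriv ?_
      simp only [G]
      ring
    · have hi := ((integrable_norm_sq (w s)).const_mul (1 + 2 * C₀)).add
        (integrable_norm_sq (w' s))
      calc ∫ x, ‖G s x‖ ≤ ∫ x, ((1 + 2 * C₀) * ‖w s x‖ ^ 2 + ‖w' s x‖ ^ 2) := by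
            refine integral_mono (hGint s).norm hi fun x => ?_
            have he : |e s| ≤ 1 := by
              rw [abs_of_pos (Real.exp_pos _)]
              exact Real.exp_le_one_iff.2 (by nlinarith [hs.1])
            have hin := abs_real_inner_le_norm (w s x) (w' s x)
            simp only [G, Real.norm_eq_abs, abs_mul (e s)]
            refine (mul_le_of_le_one_left (abs_nonneg _) he).trans ?_
            have hsq := mul_nonneg hC₀ (sq_nonneg ‖w s x‖)
            rw [abs_le] at hin ⊢
            constructor <;> nlinarith [sq_nonneg (‖w s x‖ - ‖w' s x‖)]
        _ = (1 + 2 * C₀) * l2sq (w s) + l2sq (w' s) := by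
            rw [integral_add ((integrable_norm_sq (w s)).const_mul _) (integrable_norm_sq (w' s)),
              integral_const_mul]
            rfl
        _ ≤ _ := add_le_add (mul_le_mul_of_nonneg_left (hC s hs) (by linarith)) (hC' s hs)
    · simp only [G]
      rw [integral_const_mul, integral_sub ((integrable_inner (w s) (w' s)).const_mul 2)
        ((integrable_norm_sq (w s)).const_mul (2 * C₀)), integral_const_mul, integral_const_mul]
      refine mul_nonpos_of_nonneg_of_nonpos (Real.exp_pos _).le ?_
      have := hle s hs
      simp only [l2sq] at this
      linarith
  have hnn : 0 ≤ fun x => e T * ‖w T x‖ ^ 2 := fun x =>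
    mul_nonneg (Real.exp_pos _).le (sq_nonneg _)
  have hae := (integral_eq_zero_iff_of_nonneg hnn ((integrable_norm_sq (w T)).const_mul (e T))).1
    (hneg.antisymm (integral_nonneg hnn))
  have hz := congrFun (Measure.eq_of_ae_eq hae
    (((w T).continuous.norm.pow 2).const_mul (e T)) continuous_zero) x
  simpa [e, Real.exp_ne_zero] using hz

end Schwartz

/-- Uniqueness of Schwartz solutions of `∂ₜu + ℒ(t)u = 0` with the same initial datum. -/
theorem statement3 (d : ℕ) (hd : 1 ≤ d) (T : ℝ) (hT : 0 < T)
    (a aa : Fin d → ℝ → ℝ)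
    (haCont : ∀ j, ContinuousOn (a j) (Set.Icc 0 T))
    (haaCont : ∀ j, ContinuousOn (aa j) (Set.Icc 0 T))
    (haPos : ∀ j, ∀ t ∈ Set.Icc (0:ℝ) T, 0 ≤ a j t)
    (C₀ : ℝ) (hC₀ : 0 < C₀) (V₁ V₂ : ℝ → Ed d → ℝ)
    (hV₁smooth : ∀ t ∈ Set.Icc (0:ℝ) T, ContDiff ℝ (⊤ : ℕ∞) (V₁ t))
    (hV₂smooth : ∀ t ∈ Set.Icc (0:ℝ) T, ContDiff ℝ (⊤ : ℕ∞) (V₂ t))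
    (hV₁cont : ∀ α : Fin d → ℕ, ContinuousOn (fun p : ℝ × Ed d => md α (V₁ p.1) p.2)
      (Set.Icc 0 T ×ˢ Set.univ))
    (hV₂cont : ∀ α : Fin d → ℕ, ContinuousOn (fun p : ℝ × Ed d => md α (V₂ p.1) p.2)
      (Set.Icc 0 T ×ˢ Set.univ))
    (hV₁lower : ∀ t ∈ Set.Icc (0:ℝ) T, ∀ x, -C₀ ≤ V₁ t x)
    (hV₁bd : ∀ α : Fin d → ℕ, 2 ≤ mlen α → ∃ Cα : ℝ, ∀ t ∈ Set.Icc (0:ℝ) T, ∀ x,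
      |md α (V₁ t) x| ≤ Cα)
    (hV₂bd : ∀ α : Fin d → ℕ, 1 ≤ mlen α → ∃ Cα : ℝ, ∀ t ∈ Set.Icc (0:ℝ) T, ∀ x,
      |md α (V₂ t) x| ≤ Cα)
    (u v u' v' : ℝ → SchwartzMap (Ed d) ℂ)
    -- u, v are differentiable in t with (Schwartz) derivatives u', v'
    (hu' : ∀ t ∈ Set.Icc (0:ℝ) T, ∀ x, HasDerivWithinAt (fun s => u s x) (u' t x)
      (Set.Icc 0 T) t)
    (hv' : ∀ t ∈ Set.Icc (0:ℝ) T, ∀ x, HasDerivWithinAt (fun s => v s x) (v' t x)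
      (Set.Icc 0 T) t)
    -- t ↦ u(t,·), ∂ₜu(t,·), v(t,·), ∂ₜv(t,·) are continuous into L²
    (huc : ∀ t₀ ∈ Set.Icc (0:ℝ) T, Tendsto (fun t => ∫ x, ‖u t x - u t₀ x‖ ^ 2)
      (nhdsWithin t₀ (Set.Icc 0 T)) (nhds 0))
    (hu'c : ∀ t₀ ∈ Set.Icc (0:ℝ) T, Tendsto (fun t => ∫ x, ‖u' t x - u' t₀ x‖ ^ 2)
      (nhdsWithin t₀ (Set.Icc 0 T)) (nhds 0))
    (hvc : ∀ t₀ ∈ Set.Icc (0:ℝ) T, Tendsto (fun t => ∫ x, ‖v t x - v t₀ x‖ ^ 2)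
      (nhdsWithin t₀ (Set.Icc 0 T)) (nhds 0))
    (hv'c : ∀ t₀ ∈ Set.Icc (0:ℝ) T, Tendsto (fun t => ∫ x, ‖v' t x - v' t₀ x‖ ^ 2)
      (nhdsWithin t₀ (Set.Icc 0 T)) (nhds 0))
    -- the equations
    (hueq : ∀ t ∈ Set.Icc (0:ℝ) T, ∀ x, u' t x + LopT a aa V₁ V₂ t (⇑(u t)) x = 0)
    (hveq : ∀ t ∈ Set.Icc (0:ℝ) T, ∀ x, v' t x + LopT a aa V₁ V₂ t (⇑(v t)) x = 0)
    -- same initial datum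
    (h0 : u 0 = v 0) :
    ∀ t ∈ Set.Icc (0:ℝ) T, ∀ x, u t x = v t x := by
  intro t ht x
  have hsub : Set.Icc 0 t ⊆ Set.Icc 0 T := Set.Icc_subset_Icc_right ht.2
  obtain ⟨Cu, hCu⟩ := exists_l2sq_le isCompact_Icc u huc
  obtain ⟨Cu', hCu'⟩ := exists_l2sq_le isCompact_Icc u' hu'c
  obtain ⟨Cv, hCv⟩ := exists_l2sq_le isCompact_Icc v hvc
  obtain ⟨Cv', hCv'⟩ := exists_l2sq_le isCompact_Icc v' hv'c
  have h := eq_zero_of_integral_inner_le ht.1 (w := fun s => u s - v s)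
    (w' := fun s => u' s - v' s) (C := 2 * Cu + 2 * Cv) (C' := 2 * Cu' + 2 * Cv')
    (fun s hs y => ((hu' s (hsub hs) y).sub (hv' s (hsub hs) y)).mono hsub) hC₀.le
    (fun s hs => by linarith [l2sq_sub_le (u s) (v s), hCu s (hsub hs), hCv s (hsub hs)])
    (fun s hs => by linarith [l2sq_sub_le (u' s) (v' s), hCu' s (hsub hs), hCv' s (hsub hs)])
    (fun s hs => integral_inner_le_of_add_LopT_eq_zero (fun j => haPos j s (hsub hs))
      (hV₁lower s (hsub hs)) _ _ fun y => by
        rw [LopT_sub, sub_apply]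
        linear_combination hueq s (hsub hs) y - hveq s (hsub hs) y)
    (sub_eq_zero.2 h0) x
  exact sub_eq_zero.1 h
end
end

section
/- Let d ≥ 1, T > 0, let a_j, ã_j : [0,T] → ℝ be continuous with a_j(t) ≥ 0, let C₀ > 0, and let V₁, V₂ : [0,T]×ℝ^d → ℝ be continuous, smooth in x with all x-derivatives continuous on [0,T]×ℝ^d, satisfying V₁(t,x) ≥ −C₀, |∂^α_x V₁(t,x)| ≤ C_α for |α| ≥ 2, and |∂^α_x V₂(t,x)| ≤ C_α for |α| ≥ 1, for all (t,x). Set ℒ(t)u = −Σ_j a_j(t)∂²u/∂x_j² + Σ_j ã_j(t)∂u/∂x_j + V₁(t,·)u + iV₂(t,·)u. Then for every u₀ ∈ 𝒮(ℝ^d) there exists a unique continuously differentiable curve u : [0,T] → 𝒮(ℝ^d) (differentiability and continuity with respect to the topology of 𝒮(ℝ^d)) such that u'(t) + ℒ(t)u(t) = 0 for all t ∈ [0,T] and u(0) = u₀. -/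
open MeasureTheory Complex Filter
open scoped BigOperators RealInnerProductSpace

noncomputable section

/-- `u : [0,T] → 𝒮(ℝ^d)` is a continuously differentiable solution of `u' + ℒ(t)u = 0`:
there is a curve `u'`, continuous on `[0,T]` for the topology of `𝒮(ℝ^d)` (as is `u`),
which is the derivative of `u` in the topology of `𝒮(ℝ^d)`, and the equation holds. -/
def IsC1Solution {d : ℕ} (T : ℝ) (a aa : Fin d → ℝ → ℝ) (V₁ V₂ : ℝ → Ed d → ℝ)
    (u : ℝ → SchwartzMap (Ed d) ℂ) : Prop :=
  ∃ u' : ℝ → SchwartzMap (Ed d) ℂ,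
    ContinuousOn u (Set.Icc 0 T) ∧ ContinuousOn u' (Set.Icc 0 T) ∧
    (∀ t ∈ Set.Icc (0:ℝ) T, Filter.Tendsto (fun s => (s - t)⁻¹ • (u s - u t))
      (nhdsWithin t (Set.Icc 0 T \ {t})) (nhds (u' t))) ∧
    (∀ t ∈ Set.Icc (0:ℝ) T, ∀ x, u' t x + LopT a aa V₁ V₂ t (⇑(u t)) x = 0)

section CauchyProblem

open Set Topology

section Evolution

variable {S : Type*} [AddCommGroup S] [Module ℝ S]

/-- `A s h` is a family of one-step maps which is stable for every seminorm `p k` and consistent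
with the generator `G s`, uniformly in `s ∈ I`. -/
structure IsStep (I : Set ℝ) (h₀ : ℝ) (p : ℕ → Seminorm ℝ S) (A : ℝ → ℝ → S →ₗ[ℝ] S)
    (G : ℝ → S →ₗ[ℝ] S) : Prop where
  stable : ∀ k, ∃ C, 0 ≤ C ∧ ∀ s ∈ I, ∀ h, 0 ≤ h → h ≤ h₀ → ∀ f,
    p k (A s h f) ≤ (1 + C * h) * p k f
  consistent : ∀ k, ∃ l C, 0 ≤ C ∧ ∀ s ∈ I, ∀ h, 0 ≤ h → h ≤ h₀ → ∀ f,
    p k (A s h f - f - h • G s f) ≤ C * (h * √h) * p l f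
  bounded : ∀ k, ∃ l C, 0 ≤ C ∧ ∀ s ∈ I, ∀ f, p k (G s f) ≤ C * p l f

/-- The family of generators `G` admits stable and consistent one-step maps. -/
def HasStep (I : Set ℝ) (p : ℕ → Seminorm ℝ S) (G : ℝ → S →ₗ[ℝ] S) : Prop :=
  ∃ h₀ A, 0 < h₀ ∧ h₀ ≤ 1 ∧ IsStep I h₀ p A G

/-- Continuity in time of a family of generators, uniform on sets bounded for some seminorm. -/
def TimeContinuous (I : Set ℝ) (p : ℕ → Seminorm ℝ S) (G : ℝ → S →ₗ[ℝ] S) : Prop :=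
  ∀ k, ∃ l, ∀ ε > 0, ∃ δ > 0, ∀ s ∈ I, ∀ t ∈ I, |t - s| ≤ δ → ∀ f,
    p k (G t f - G s f) ≤ ε * p l f

variable {I : Set ℝ} {p : ℕ → Seminorm ℝ S}

lemma TimeContinuous.add (hp : Monotone p) {G H : ℝ → S →ₗ[ℝ] S} (hG : TimeContinuous I p G)
    (hH : TimeContinuous I p H) : TimeContinuous I p (fun s => G s + H s) := by
  intro k
  obtain ⟨l, hl⟩ := hG k
  obtain ⟨m, hm⟩ := hH k
  refine ⟨max l m, fun ε hε => ?_⟩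
  obtain ⟨δ, hδ, h1⟩ := hl (ε / 2) (by positivity)
  obtain ⟨δ', hδ', h2⟩ := hm (ε / 2) (by positivity)
  refine ⟨min δ δ', by positivity, fun s hs t ht hst f => ?_⟩
  have e : (G t + H t) f - (G s + H s) f = (G t f - G s f) + (H t f - H s f) := by
    simp only [LinearMap.add_apply]; abel
  rw [e]
  have h3 := h1 s hs t ht (hst.trans (min_le_left _ _)) f
  have h4 := h2 s hs t ht (hst.trans (min_le_right _ _)) f
  have h5 : p l f ≤ p (max l m) f := hp (le_max_left _ _) f
  have h6 : p m f ≤ p (max l m) f := hp (le_max_right _ _) f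
  have h7 := map_add_le_add (p k) (G t f - G s f) (H t f - H s f)
  nlinarith

lemma HasStep.zero : HasStep I p (fun _ => 0) := by
  refine ⟨1, fun _ _ => LinearMap.id, one_pos, le_rfl, fun k => ⟨0, le_rfl, ?_⟩,
    fun k => ⟨k, 0, le_rfl, ?_⟩, fun k => ⟨k, 0, le_rfl, ?_⟩⟩ <;> simp

lemma HasStep.add (hp : Monotone p) {G H : ℝ → S →ₗ[ℝ] S} (hG : HasStep I p G)
    (hH : HasStep I p H) : HasStep I p (fun s => G s + H s) := by
  obtain ⟨h₁, A, h₁0, h₁1, hA⟩ := hG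
  obtain ⟨h₂, B, h₂0, h₂1, hB⟩ := hH
  refine ⟨min h₁ h₂, fun s h => A s h ∘ₗ B s h, by positivity, (min_le_left _ _).trans h₁1,
    fun k => ?_, fun k => ?_, fun k => ?_⟩
  · obtain ⟨C, hC, h1⟩ := hA.stable k
    obtain ⟨D, hD, h2⟩ := hB.stable k
    refine ⟨C + D + C * D, by positivity, fun s hs h hh hh' f => ?_⟩
    have hh1 := hh'.trans (min_le_left _ _)
    have h3 := h1 s hs h hh hh1 (B s h f)
    have h4 := h2 s hs h hh (hh'.trans (min_le_right _ _)) f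
    have h5 : (1 + C * h) * p k (B s h f) ≤ (1 + C * h) * ((1 + D * h) * p k f) := by gcongr
    have h6 : (1 + C * h) * (1 + D * h) ≤ 1 + (C + D + C * D) * h := by
      have : C * D * (h * h) ≤ C * D * (h * 1) := by gcongr; linarith
      nlinarith
    calc _ ≤ _ := h3.trans h5
      _ = ((1 + C * h) * (1 + D * h)) * p k f := by ring
      _ ≤ _ := by gcongr
  · obtain ⟨C₁, hC₁, hs⟩ := hA.stable k
    obtain ⟨l₂, C₂, hC₂, hB2⟩ := hB.consistent k
    obtain ⟨l₃, C₃, hC₃, hA3⟩ := hA.consistent k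
    obtain ⟨l₄, C₄, hC₄, hA4⟩ := hA.bounded k
    obtain ⟨l₅, C₅, hC₅, hB5⟩ := hB.bounded l₃
    obtain ⟨l₆, C₆, hC₆, hB6⟩ := hB.bounded l₄
    set L := l₂ + l₃ + l₅ + l₆ with hL
    have g2 : ∀ f, p l₂ f ≤ p L f := fun f => hp (by omega) f
    have g3 : ∀ f, p l₃ f ≤ p L f := fun f => hp (by omega) f
    have g5 : ∀ f, p l₅ f ≤ p L f := fun f => hp (by omega) f
    have g6 : ∀ f, p l₆ f ≤ p L f := fun f => hp (by omega) f
    refine ⟨L, (1 + C₁) * C₂ + C₃ + (C₃ * C₅ + C₄ * C₆), by positivity, fun s hs' h hh hh' f => ?_⟩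
    have hh1 := hh'.trans (min_le_left _ _)
    have hh2 := hh'.trans (min_le_right _ _)
    have h1 : h ≤ 1 := hh1.trans h₁1
    have hsq : √h ≤ 1 := Real.sqrt_le_one.2 h1
    have hsq' : h ≤ √h := by
      nlinarith [Real.mul_self_sqrt hh, Real.sqrt_nonneg h]
    have e : (A s h ∘ₗ B s h) f - f - h • (G s + H s) f
        = A s h (B s h f - f - h • H s f) + (A s h f - f - h • G s f)
          + h • ((A s h (H s f) - H s f - h • G s (H s f)) + h • G s (H s f)) := by
      simp only [LinearMap.comp_apply, map_sub, map_smul, LinearMap.add_apply]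
      module
    rw [e]
    have b1 : p k (A s h (B s h f - f - h • H s f)) ≤ (1 + C₁) * (C₂ * (h * √h) * p L f) := by
      refine (hs s hs' h hh hh1 _).trans ?_
      have := hB2 s hs' h hh hh2 f
      gcongr
      · nlinarith
      · refine this.trans ?_
        gcongr
        exact g2 f
    have b2 : p k (A s h f - f - h • G s f) ≤ C₃ * (h * √h) * p L f := by
      refine (hA3 s hs' h hh hh1 f).trans ?_
      gcongr
      exact g3 f
    have b3 : p k (A s h (H s f) - H s f - h • G s (H s f)) ≤ √h * (C₃ * C₅ * p L f) := by
      refine (hA3 s hs' h hh hh1 _).trans ?_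
      have := (hB5 s hs' f).trans (mul_le_mul_of_nonneg_left (g5 f) hC₅)
      calc _ ≤ C₃ * (1 * √h) * (C₅ * p L f) := by gcongr
        _ = _ := by ring
    have b4 : p k (h • G s (H s f)) ≤ √h * (C₄ * C₆ * p L f) := by
      rw [map_smul_eq_mul, Real.norm_of_nonneg hh]
      have := (hB6 s hs' f).trans (mul_le_mul_of_nonneg_left (g6 f) hC₆)
      calc _ ≤ √h * (C₄ * (C₆ * p L f)) := by
            gcongr
            exact (hA4 s hs' _).trans (by gcongr)
        _ = _ := by ring
    have b5 : p k (h • ((A s h (H s f) - H s f - h • G s (H s f)) + h • G s (H s f)))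
        ≤ h * (√h * (C₃ * C₅ * p L f) + √h * (C₄ * C₆ * p L f)) := by
      rw [map_smul_eq_mul, Real.norm_of_nonneg hh]
      gcongr
      exact (map_add_le_add (p k) _ _).trans (add_le_add b3 b4)
    calc _ ≤ _ := (map_add_le_add (p k) _ _).trans
          (add_le_add ((map_add_le_add (p k) _ _).trans (add_le_add b1 b2)) b5)
      _ = _ := by ring
  · obtain ⟨l, C, hC, h1⟩ := hA.bounded k
    obtain ⟨m, D, hD, h2⟩ := hB.bounded k
    refine ⟨max l m, C + D, by positivity, fun s hs f => ?_⟩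
    have h3 := h1 s hs f
    have h4 := h2 s hs f
    have h5 : p l f ≤ p (max l m) f := hp (le_max_left _ _) f
    have h6 : p m f ≤ p (max l m) f := hp (le_max_right _ _) f
    have h7 := map_add_le_add (p k) (G s f) (H s f)
    simp only [LinearMap.add_apply]
    nlinarith

lemma TimeContinuous.sum (hp : Monotone p) {ι : Type*} (J : Finset ι) {G : ι → ℝ → S →ₗ[ℝ] S}
    (hG : ∀ i, TimeContinuous I p (G i)) : TimeContinuous I p (fun s => ∑ i ∈ J, G i s) := by
  classical
  induction J using Finset.induction_on with
  | empty =>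
    intro k
    refine ⟨k, fun ε hε => ⟨1, one_pos, fun s _ t _ _ f => ?_⟩⟩
    simp only [Finset.sum_empty, LinearMap.zero_apply, sub_self, map_zero]
    positivity
  | insert i J hi ih =>
    simp only [Finset.sum_insert hi]
    exact (hG i).add hp ih

lemma HasStep.sum (hp : Monotone p) {ι : Type*} (J : Finset ι) {G : ι → ℝ → S →ₗ[ℝ] S}
    (hG : ∀ i, HasStep I p (G i)) : HasStep I p (fun s => ∑ i ∈ J, G i s) := by
  classical
  induction J using Finset.induction_on with
  | empty => simpa using HasStep.zero
  | insert i J hi ih =>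
    simp only [Finset.sum_insert hi]
    exact (hG i).add hp ih

/-- A priori estimate for approximate solutions of `w' = G t w`. -/
lemma IsStep.apriori {T h₀ : ℝ} {A : ℝ → ℝ → S →ₗ[ℝ] S} {G : ℝ → S →ₗ[ℝ] S}
    (hst : IsStep (Icc 0 T) h₀ p A G) (hh₀ : 0 < h₀) (k : ℕ) :
    ∃ C, ∀ (w : ℝ → S) (ε : ℝ), ContinuousOn (fun t => p k (w t)) (Icc 0 T) →
      (∀ t ∈ Ico 0 T, ∀ ε' > ε, ∀ᶠ z in 𝓝[>] t,
        p k (w z - w t - (z - t) • G t (w t)) ≤ ε' * (z - t)) →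
      ∀ t ∈ Icc 0 T, p k (w t) ≤ gronwallBound (p k (w 0)) C ε t := by
  obtain ⟨C, hC, hs⟩ := hst.stable k
  obtain ⟨l, C', hC', hc⟩ := hst.consistent k
  refine ⟨C, fun w ε hw hd => ?_⟩
  have := le_gronwallBound_of_liminf_deriv_right_le (f' := fun t => C * p k (w t) + ε) hw ?_ le_rfl
    (fun _ _ => le_rfl)
  · simpa using this
  intro t ht r hr
  set η := (r - (C * p k (w t) + ε)) / 3 with hη
  have hη0 : 0 < η := by rw [hη]; linarith
  refine Eventually.frequently ?_
  have hlim : Tendsto (fun z => C' * √(z - t) * p l (w t)) (𝓝[>] t) (𝓝 0) := by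
    have : ContinuousAt (fun z => C' * √(z - t) * p l (w t)) t := by fun_prop
    simpa using this.tendsto.mono_left nhdsWithin_le_nhds
  have hlt : ∀ᶠ z in 𝓝[>] t, z < t + h₀ :=
    (eventually_lt_nhds (by linarith)).filter_mono nhdsWithin_le_nhds
  filter_upwards [hd t ht (ε + η) (by linarith), hlim.eventually (gt_mem_nhds hη0), hlt,
    self_mem_nhdsWithin] with z h1 h2 h3 h4
  have hz : 0 < z - t := sub_pos.2 h4
  have htI : t ∈ Icc 0 T := ⟨ht.1, ht.2.le⟩
  have h5 := hc t htI (z - t) hz.le (by linarith) (w t)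
  have h6 := hs t htI (z - t) hz.le (by linarith) (w t)
  have e : w z = (w z - w t - (z - t) • G t (w t))
      - (A t (z - t) (w t) - w t - (z - t) • G t (w t)) + A t (z - t) (w t) := by abel
  have h7 : p k (w z) ≤ p k (w z - w t - (z - t) • G t (w t))
      + p k (A t (z - t) (w t) - w t - (z - t) • G t (w t)) + p k (A t (z - t) (w t)) := by
    conv_lhs => rw [e]
    exact (map_add_le_add _ _ _).trans (add_le_add_left (map_sub_le_add _ _ _) _)
  have h8 : C' * ((z - t) * √(z - t)) * p l (w t) ≤ η * (z - t) := by
    nlinarith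
  rw [inv_mul_lt_iff₀ hz]
  have : r = C * p k (w t) + ε + 3 * η := by rw [hη]; ring
  rw [this]
  nlinarith

/-- The length of the part of `[i h, (i + 1) h]` to the left of `t`. -/
def clampLen (h : ℝ) (i : ℕ) (t : ℝ) : ℝ := max 0 (min (t - i * h) h)

lemma clampLen_sum {h : ℝ} (hh : 0 < h) (n : ℕ) {t : ℝ} (ht : 0 ≤ t) :
    ∑ i ∈ Finset.range n, clampLen h i t = min t (n * h) := by
  induction n with
  | zero => simp [ht]
  | succ n ih =>
    rw [Finset.sum_range_succ, ih, clampLen]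
    have : 0 ≤ n * h := by positivity
    push_cast
    rcases le_total t (n * h) with h1 | h1
    · rw [min_eq_left h1, min_eq_left (by linarith), min_eq_left (by linarith),
        max_eq_left (by linarith)]; ring
    · rcases le_total t ((n + 1) * h) with h2 | h2
      · rw [min_eq_right h1, min_eq_left h2, min_eq_left (by linarith),
          max_eq_right (by linarith)]; ring
      · rw [min_eq_right h1, min_eq_right h2, min_eq_right (by linarith), max_eq_right hh.le]
        ring

lemma clampLen_mono (h : ℝ) (i : ℕ) : Monotone (clampLen h i) := by
  intro s t hst
  unfold clampLen
  gcongr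

lemma clampLen_eq_of_lt {h : ℝ} (hh : 0 < h) {i j : ℕ} (hij : j < i) :
    clampLen h j (i * h) = h := by
  have : (j + 1 : ℝ) ≤ i := by exact_mod_cast hij
  rw [clampLen, min_eq_right (by nlinarith), max_eq_right hh.le]

lemma clampLen_eq_of_le {h : ℝ} (hh : 0 < h) {i j : ℕ} (hij : i ≤ j) :
    clampLen h j (i * h) = 0 := by
  have : (i : ℝ) ≤ j := by exact_mod_cast hij
  rw [clampLen, max_eq_left ((min_le_left _ _).trans (by nlinarith))]

lemma abs_sub_le_of_clampLen_ne {h : ℝ} (hh : 0 < h) {i : ℕ} {s t : ℝ}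
    (hne : clampLen h i t ≠ clampLen h i s) : |i * h - s| ≤ |t - s| + h := by
  by_contra! hlt
  apply hne
  have h1 := abs_nonneg (t - s)
  have h2 := neg_abs_le (t - s)
  have h3 := le_abs_self (t - s)
  unfold clampLen
  rcases lt_abs.1 hlt with h4 | h4
  · rw [max_eq_left ((min_le_left _ _).trans (by linarith)),
      max_eq_left ((min_le_left _ _).trans (by linarith))]
  · rw [min_eq_right (by linarith), min_eq_right (by linarith)]

/-- The polygonal curve with starting point `u₀` and slope `D i` on `[i h, (i + 1) h]`. -/
def polygon (u₀ : S) (h : ℝ) (n : ℕ) (D : ℕ → S) (t : ℝ) : S :=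
  u₀ + ∑ i ∈ Finset.range n, clampLen h i t • D i

lemma polygon_node {h : ℝ} (hh : 0 < h) {n i : ℕ} (hi : i ≤ n) (u : ℕ → S) :
    polygon (u 0) h n (fun j => h⁻¹ • (u (j + 1) - u j)) (i * h) = u i := by
  have : ∑ j ∈ Finset.range n, clampLen h j (i * h) • h⁻¹ • (u (j + 1) - u j)
      = ∑ j ∈ Finset.range i, (u (j + 1) - u j) := by
    rw [← Finset.sum_subset (Finset.range_mono hi)]
    · refine Finset.sum_congr rfl fun j hj => ?_
      rw [clampLen_eq_of_lt hh (Finset.mem_range.1 hj), smul_inv_smul₀ hh.ne']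
    · intro j _ hj
      rw [clampLen_eq_of_le hh (by simpa using hj), zero_smul]
  rw [polygon, this, Finset.sum_range_sub]
  abel

lemma polygon_sub_le (q : Seminorm ℝ S) (u₀ : S) {h : ℝ} (hh : 0 < h) (n : ℕ) (D : ℕ → S)
    {s t : ℝ} (hs : s ∈ Icc 0 (n * h)) (ht : t ∈ Icc 0 (n * h)) (X : S) {M : ℝ}
    (hM : ∀ i < n, |i * h - s| ≤ |t - s| + h → q (D i - X) ≤ M) :
    q (polygon u₀ h n D t - polygon u₀ h n D s - (t - s) • X) ≤ M * |t - s| := by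
  have hsum : ∀ r ∈ Icc 0 (n * h), ∑ i ∈ Finset.range n, clampLen h i r = r := fun r hr => by
    rw [clampLen_sum hh n hr.1, min_eq_left hr.2]
  have e : polygon u₀ h n D t - polygon u₀ h n D s - (t - s) • X
      = ∑ i ∈ Finset.range n, (clampLen h i t - clampLen h i s) • (D i - X) := by
    simp only [smul_sub, Finset.sum_sub_distrib, ← Finset.sum_smul, hsum t ht, hsum s hs,
      polygon, sub_smul]
    abel
  have habs : ∑ i ∈ Finset.range n, |clampLen h i t - clampLen h i s| = |t - s| := by
    rcases le_total s t with hst | hst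
    · rw [abs_of_nonneg (sub_nonneg.2 hst)]
      conv_rhs => rw [← hsum t ht, ← hsum s hs, ← Finset.sum_sub_distrib]
      exact Finset.sum_congr rfl fun i _ => abs_of_nonneg (sub_nonneg.2 (clampLen_mono h i hst))
    · rw [abs_of_nonpos (sub_nonpos.2 hst)]
      conv_rhs => rw [← hsum t ht, ← hsum s hs, ← Finset.sum_sub_distrib, ← Finset.sum_neg_distrib]
      exact Finset.sum_congr rfl fun i _ => abs_of_nonpos (sub_nonpos.2 (clampLen_mono h i hst))
  rw [e]
  refine (Finset.le_sum_of_subadditive q (map_zero q).le (map_add_le_add q) _ _).trans ?_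
  rw [mul_comm, ← habs, Finset.sum_mul]
  refine Finset.sum_le_sum fun i hi => ?_
  rw [map_smul_eq_mul, Real.norm_eq_abs]
  by_cases hne : clampLen h i t = clampLen h i s
  · simp [hne]
  · gcongr
    exact hM i (Finset.mem_range.1 hi) (abs_sub_le_of_clampLen_ne hh hne)

/-- Polygonal approximate solutions, equi-Lipschitz for every seminorm. -/
lemma IsStep.exists_approx {T h₀ : ℝ} {A : ℝ → ℝ → S →ₗ[ℝ] S} {G : ℝ → S →ₗ[ℝ] S}
    (hst : IsStep (Icc 0 T) h₀ p A G) (hT : 0 < T) (hh₀ : 0 < h₀)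
    (hG : TimeContinuous (Icc 0 T) p G) (u₀ : S) :
    ∃ w : ℕ → ℝ → S, (∀ n, w n 0 = u₀) ∧
      (∀ k, ∃ B, 0 ≤ B ∧ ∀ n, ∀ s ∈ Icc 0 T, ∀ t ∈ Icc 0 T,
        p k (w n t - w n s) ≤ B * |t - s|) ∧
      (∀ k, ∀ ε > 0, ∃ δ > 0, ∃ n₀, ∀ n ≥ n₀, ∀ s ∈ Icc 0 T, ∀ t ∈ Icc 0 T, |t - s| ≤ δ →
        p k (w n t - w n s - (t - s) • G s (w n s)) ≤ ε * |t - s|) := by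
  obtain ⟨m, hm⟩ := exists_nat_gt (T / h₀)
  set N : ℕ → ℕ := fun n => n + m + 1 with hN
  set H : ℕ → ℝ := fun n => T / N n with hH
  have hNpos : ∀ n, (0 : ℝ) < N n := fun n => by simp only [hN]; positivity
  have hHpos : ∀ n, 0 < H n := fun n => div_pos hT (hNpos n)
  have hHle : ∀ n, H n ≤ h₀ := fun n => by
    rw [hH, div_le_iff₀ (hNpos n)]
    rw [div_lt_iff₀ hh₀] at hm
    have : (m : ℝ) ≤ N n := by simp only [hN]; push_cast; linarith [(Nat.cast_nonneg n : (0:ℝ) ≤ n)]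
    nlinarith
  have hNH : ∀ n, N n * H n = T := fun n => by
    have := (hNpos n).ne'
    simp only [hH]; field_simp
  have hHlim : Tendsto H atTop (𝓝 0) := by
    refine Tendsto.div_atTop tendsto_const_nhds ?_
    refine tendsto_natCast_atTop_atTop.comp ?_
    exact tendsto_atTop_mono (fun n => by simp only [hN, id]; omega) tendsto_id
  set u : ℕ → ℕ → S := fun n i => Nat.rec u₀ (fun i v => A (i * H n) (H n) v) i with hu
  have hu0 : ∀ n, u n 0 = u₀ := fun n => rfl
  have hus : ∀ n i, u n (i + 1) = A (i * H n) (H n) (u n i) := fun n i => rfl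
  set D : ℕ → ℕ → S := fun n i => (H n)⁻¹ • (u n (i + 1) - u n i) with hD
  have hnode : ∀ n i, i ≤ N n → (i * H n) ∈ Icc 0 T := fun n i hi => by
    have : (i : ℝ) ≤ N n := by exact_mod_cast hi
    have h1 := hHpos n
    refine ⟨by positivity, ?_⟩
    rw [← hNH n]; gcongr
  have hbd : ∀ k, ∃ B, 0 ≤ B ∧ ∀ n, ∀ i ≤ N n, p k (u n i) ≤ B := by
    intro k
    obtain ⟨C, hC, hs⟩ := hst.stable k
    refine ⟨Real.exp (C * T) * p k u₀, by positivity, fun n => ?_⟩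
    have : ∀ i ≤ N n, p k (u n i) ≤ Real.exp (C * (i * H n)) * p k u₀ := by
      intro i
      induction i with
      | zero => intro _; simp [hu0]
      | succ i ih =>
        intro hi
        have h1 := ih (by omega)
        rw [hus]
        refine (hs _ (hnode n i (by omega)) _ (hHpos n).le (hHle n) _).trans ?_
        have h2 : 1 + C * H n ≤ Real.exp (C * H n) := by
          linarith [Real.add_one_le_exp (C * H n)]
        calc _ ≤ Real.exp (C * H n) * (Real.exp (C * (i * H n)) * p k u₀) := by gcongr
          _ = _ := by
            rw [← mul_assoc, ← Real.exp_add]; congr 2; push_cast; ring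
    intro i hi
    refine (this i hi).trans ?_
    gcongr
    exact (hnode n i hi).2
  have hres : ∀ k, ∃ B, 0 ≤ B ∧ ∀ n, ∀ i < N n,
      p k (D n i - G (i * H n) (u n i)) ≤ B * √(H n) := by
    intro k
    obtain ⟨l, C, hC, hc⟩ := hst.consistent k
    obtain ⟨B, hB, hb⟩ := hbd l
    refine ⟨C * B, by positivity, fun n i hi => ?_⟩
    have h1 := hc _ (hnode n i hi.le) (H n) (hHpos n).le (hHle n) (u n i)
    have h2 := hb n i hi.le
    have h0 := hHpos n
    have e : D n i - G (i * H n) (u n i)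
        = (H n)⁻¹ • (A (i * H n) (H n) (u n i) - u n i - H n • G (i * H n) (u n i)) := by
      rw [smul_sub _ _ (H n • _), inv_smul_smul₀ h0.ne', ← hus]
    rw [e, map_smul_eq_mul, Real.norm_of_nonneg (by positivity), inv_mul_le_iff₀ h0]
    calc _ ≤ _ := h1
      _ ≤ C * (H n * √(H n)) * B := by gcongr
      _ = _ := by ring
  have hDb : ∀ k, ∃ B, 0 ≤ B ∧ ∀ n, ∀ i < N n, p k (D n i) ≤ B := by
    intro k
    obtain ⟨B₁, hB₁, h1⟩ := hres k
    obtain ⟨l, C, hC, h2⟩ := hst.bounded k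
    obtain ⟨B₂, hB₂, h3⟩ := hbd l
    refine ⟨B₁ * √h₀ + C * B₂, by positivity, fun n i hi => ?_⟩
    have e : D n i = (D n i - G (i * H n) (u n i)) + G (i * H n) (u n i) := by abel
    rw [e]
    refine (map_add_le_add _ _ _).trans (add_le_add ((h1 n i hi).trans ?_)
      ((h2 _ (hnode n i hi.le) _).trans ?_))
    · gcongr; exact hHle n
    · gcongr; exact h3 n i hi.le
  set w : ℕ → ℝ → S := fun n => polygon u₀ (H n) (N n) (D n) with hw
  have hwnode : ∀ n, ∀ i ≤ N n, w n (i * H n) = u n i := fun n i hi => by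
    have := polygon_node (hHpos n) hi (u n)
    rwa [hu0] at this
  have hlip : ∀ k, ∃ B, 0 ≤ B ∧ ∀ n, ∀ s ∈ Icc 0 T, ∀ t ∈ Icc 0 T,
      p k (w n t - w n s) ≤ B * |t - s| := by
    intro k
    obtain ⟨B, hB, h1⟩ := hDb k
    refine ⟨B, hB, fun n s hs t ht => ?_⟩
    rw [← hNH n] at hs ht
    have := polygon_sub_le (p k) u₀ (hHpos n) (N n) (D n) hs ht 0 (M := B)
      (fun i hi _ => by simpa using h1 n i hi)
    simpa using this
  refine ⟨w, fun n => by simpa [hu0] using hwnode n 0 (Nat.zero_le _), hlip, fun k ε hε => ?_⟩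
  obtain ⟨B₁, hB₁, h1⟩ := hres k
  obtain ⟨l, hl⟩ := hG k
  obtain ⟨B₂, hB₂, h2⟩ := hbd l
  obtain ⟨δ, hδ, h3⟩ := hl (ε / (3 * (B₂ + 1))) (by positivity)
  obtain ⟨l₄, C₄, hC₄, h4⟩ := hst.bounded k
  obtain ⟨B₅, hB₅, h5⟩ := hlip l₄
  have e1 : ∀ᶠ n in atTop, B₁ * √(H n) < ε / 3 := by
    have : Tendsto (fun n => B₁ * √(H n)) atTop (𝓝 0) := by
      simpa using ((Real.continuous_sqrt.tendsto 0).comp hHlim).const_mul B₁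
    exact this.eventually (gt_mem_nhds (by positivity))
  set δ' := min (δ / 2) (ε / (6 * (C₄ * B₅ + 1))) with hδ'
  have hδ'0 : 0 < δ' := by positivity
  obtain ⟨n₀, hn₀⟩ := eventually_atTop.1 (e1.and (hHlim.eventually (gt_mem_nhds hδ'0)))
  refine ⟨δ', hδ'0, n₀, fun n hn s hs t ht hst' => ?_⟩
  obtain ⟨f1, f2⟩ := hn₀ n hn
  have hs' := hs
  have ht' := ht
  rw [← hNH n] at hs' ht'
  refine polygon_sub_le (p k) u₀ (hHpos n) (N n) (D n) hs' ht' (G s (w n s)) ?_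
  intro i hi hdist
  have hd2 : |i * H n - s| ≤ 2 * δ' := by linarith
  have hd3 : |i * H n - s| ≤ δ := by
    have := min_le_left (δ / 2) (ε / (6 * (C₄ * B₅ + 1)))
    linarith
  have hd4 : C₄ * B₅ * |i * H n - s| ≤ ε / 3 := by
    have h6 := min_le_right (δ / 2) (ε / (6 * (C₄ * B₅ + 1)))
    have h7 : |i * H n - s| ≤ 2 * (ε / (6 * (C₄ * B₅ + 1))) := by linarith
    calc _ ≤ (C₄ * B₅ + 1) * (2 * (ε / (6 * (C₄ * B₅ + 1)))) := by gcongr; linarith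
      _ = ε / 3 := by field_simp; norm_num
  have hnI := hnode n i hi.le
  have g1 := h1 n i hi
  have g2 : p k (G (i * H n) (u n i) - G s (u n i)) ≤ ε / 3 := by
    refine (h3 s hs _ hnI hd3 _).trans ?_
    calc _ ≤ ε / (3 * (B₂ + 1)) * (B₂ + 1) := by
          gcongr
          linarith [h2 n i hi.le]
      _ = ε / 3 := by field_simp
  have g3 : p k (G s (u n i - w n s)) ≤ ε / 3 := by
    refine (h4 s hs _).trans ?_
    rw [← hwnode n i hi.le]
    calc _ ≤ C₄ * (B₅ * |i * H n - s|) := by gcongr; exact h5 n s hs _ hnI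
      _ ≤ _ := by rw [← mul_assoc]; exact hd4
  have e : D n i - G s (w n s) = (D n i - G (i * H n) (u n i))
      + (G (i * H n) (u n i) - G s (u n i)) + G s (u n i - w n s) := by
    rw [map_sub]; abel
  rw [e]
  refine (map_add_le_add _ _ _).trans ?_
  have := map_add_le_add (p k) (D n i - G (i * H n) (u n i))
    (G (i * H n) (u n i) - G s (u n i))
  linarith

lemma continuousOn_seminorm_of_lipschitz (q : Seminorm ℝ S) {w : ℝ → S} {B : ℝ}
    (h : ∀ s ∈ I, ∀ t ∈ I, q (w t - w s) ≤ B * |t - s|) :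
    ContinuousOn (fun t => q (w t)) I := by
  intro s hs
  refine tendsto_iff_norm_sub_tendsto_zero.2 ?_
  have hlim : Tendsto (fun t => B * |t - s|) (𝓝[I] s) (𝓝 0) := by
    have : ContinuousAt (fun t => B * |t - s|) s := by fun_prop
    simpa using this.tendsto.mono_left nhdsWithin_le_nhds
  refine squeeze_zero' (Eventually.of_forall fun _ => norm_nonneg _) ?_ hlim
  filter_upwards [self_mem_nhdsWithin] with t ht
  refine le_trans ?_ (h s hs t ht)
  rw [Real.norm_eq_abs]
  exact abs_sub_map_le_sub q _ _

/-- Existence for the abstract linear Cauchy problem `u' = G t u`. -/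
theorem HasStep.exists_solution {T : ℝ} {G : ℝ → S →ₗ[ℝ] S} (hstep : HasStep (Icc 0 T) p G)
    (hT : 0 < T) (hG : TimeContinuous (Icc 0 T) p G)
    (hcomp : ∀ w : ℕ → S, (∀ k, ∀ ε > 0, ∃ n₀, ∀ m ≥ n₀, ∀ n ≥ n₀, p k (w m - w n) ≤ ε) →
      ∃ v, ∀ k, Tendsto (fun n => p k (w n - v)) atTop (𝓝 0)) (u₀ : S)
    (hsep : ∀ v, (∀ k, p k v = 0) → v = 0) :
    ∃ u : ℝ → S, u 0 = u₀ ∧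
      (∀ k, ∃ B, 0 ≤ B ∧ ∀ s ∈ Icc 0 T, ∀ t ∈ Icc 0 T, p k (u t - u s) ≤ B * |t - s|) ∧
      (∀ k, ∀ ε > 0, ∃ δ > 0, ∀ s ∈ Icc 0 T, ∀ t ∈ Icc 0 T, |t - s| ≤ δ →
        p k (u t - u s - (t - s) • G s (u s)) ≤ ε * |t - s|) := by
  obtain ⟨h₀, A, hh₀, -, hst⟩ := hstep
  obtain ⟨w, hw0, hlip, hint⟩ := hst.exists_approx hT hh₀ hG u₀
  have hcauchy : ∀ t ∈ Icc 0 T, ∀ k, ∀ ε > 0, ∃ n₀, ∀ m ≥ n₀, ∀ n ≥ n₀,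
      p k (w m t - w n t) ≤ ε := by
    intro t ht k ε hε
    obtain ⟨C, hC⟩ := hst.apriori hh₀ k
    have hcont : ContinuousAt (fun e => gronwallBound 0 C e t) 0 :=
      (gronwallBound_continuous_ε 0 C t).continuousAt
    have h1 : ∀ᶠ e in 𝓝[>] (0 : ℝ), gronwallBound 0 C e t < ε := by
      refine (hcont.eventually (gt_mem_nhds ?_)).filter_mono nhdsWithin_le_nhds
      simpa [gronwallBound_ε0_δ0] using hε
    obtain ⟨e, he, he0⟩ := (h1.and self_mem_nhdsWithin).exists
    have he0 : 0 < e := he0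
    obtain ⟨δ, hδ, n₀, hn⟩ := hint k (e / 2) (by positivity)
    refine ⟨n₀, fun m hm n hn' => ?_⟩
    have hcw : ContinuousOn (fun t => p k (w m t - w n t)) (Icc 0 T) := by
      obtain ⟨B, hB, hb⟩ := hlip k
      refine continuousOn_seminorm_of_lipschitz (B := 2 * B) (p k) fun s hs t ht => ?_
      have e : w m t - w n t - (w m s - w n s) = (w m t - w m s) - (w n t - w n s) := by abel
      rw [e]
      have := map_sub_le_add (p k) (w m t - w m s) (w n t - w n s)
      linarith [hb m s hs t ht, hb n s hs t ht]
    refine (hC (fun t => w m t - w n t) e hcw ?_ t ht).trans ?_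
    · intro r hr ε' hε'
      have hrI : r ∈ Icc 0 T := ⟨hr.1, hr.2.le⟩
      have l1 : ∀ᶠ z in 𝓝[>] r, z < min T (r + δ) :=
        (eventually_lt_nhds (lt_min hr.2 (by linarith))).filter_mono nhdsWithin_le_nhds
      filter_upwards [l1, self_mem_nhdsWithin] with z hz1 hz2
      have hz2 : r < z := hz2
      have hzT := hz1.trans_le (min_le_left _ _)
      have hzδ := hz1.trans_le (min_le_right _ _)
      have hzI : z ∈ Icc 0 T := ⟨hr.1.trans hz2.le, hzT.le⟩
      have habs : |z - r| = z - r := abs_of_pos (sub_pos.2 hz2)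
      have q1 := hn m hm r hrI z hzI (by rw [habs]; linarith)
      have q2 := hn n hn' r hrI z hzI (by rw [habs]; linarith)
      have e3 : w m z - w n z - (w m r - w n r) - (z - r) • G r (w m r - w n r)
          = (w m z - w m r - (z - r) • G r (w m r))
            - (w n z - w n r - (z - r) • G r (w n r)) := by
        rw [map_sub, smul_sub]; abel
      rw [e3]
      rw [habs] at q1 q2
      have := map_sub_le_add (p k) (w m z - w m r - (z - r) • G r (w m r))
        (w n z - w n r - (z - r) • G r (w n r))
      have : 0 < z - r := sub_pos.2 hz2
      nlinarith
    · simp only [hw0, sub_self, map_zero]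
      exact he.le
  have hex : ∀ t, ∃ v, t ∈ Icc 0 T → ∀ k, Tendsto (fun n => p k (w n t - v)) atTop (𝓝 0) := by
    intro t
    by_cases ht : t ∈ Icc 0 T
    · obtain ⟨v, hv⟩ := hcomp (fun n => w n t) (hcauchy t ht)
      exact ⟨v, fun _ => hv⟩
    · exact ⟨0, fun h => absurd h ht⟩
  choose u hu using hex
  refine ⟨u, ?_, fun k => ?_, fun k ε hε => ?_⟩
  · have h0 : (0 : ℝ) ∈ Icc 0 T := ⟨le_rfl, hT.le⟩
    have : u₀ - u 0 = 0 := hsep _ fun k => by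
      have := hu 0 h0 k
      simp only [hw0] at this
      exact tendsto_nhds_unique tendsto_const_nhds this
    exact (sub_eq_zero.1 this).symm
  · obtain ⟨B, hB, hb⟩ := hlip k
    refine ⟨B, hB, fun s hs t ht => ?_⟩
    have hlim : Tendsto (fun n => p k (w n s - u s) + p k (w n t - u t) + B * |t - s|) atTop
        (𝓝 (0 + 0 + B * |t - s|)) := ((hu s hs k).add (hu t ht k)).add_const _
    simp only [zero_add] at hlim
    refine ge_of_tendsto' hlim fun n => ?_
    have e : u t - u s = (w n s - u s) - (w n t - u t) + (w n t - w n s) := by abel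
    rw [e]
    have h1 := map_add_le_add (p k) ((w n s - u s) - (w n t - u t)) (w n t - w n s)
    have h2 := map_sub_le_add (p k) (w n s - u s) (w n t - u t)
    linarith [hb n s hs t ht]
  · obtain ⟨δ, hδ, n₀, hn⟩ := hint k ε hε
    obtain ⟨l, C, hC, hbd⟩ := hst.bounded k
    refine ⟨δ, hδ, fun s hs t ht hst' => ?_⟩
    have hlim : Tendsto (fun n => p k (w n s - u s) + p k (w n t - u t)
        + |t - s| * (C * p l (w n s - u s)) + ε * |t - s|) atTop
        (𝓝 (0 + 0 + |t - s| * (C * 0) + ε * |t - s|)) :=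
      (((hu s hs k).add (hu t ht k)).add (((hu s hs l).const_mul C).const_mul _)).add_const _
    simp only [zero_add, mul_zero] at hlim
    refine ge_of_tendsto hlim ?_
    filter_upwards [eventually_ge_atTop n₀] with n hn'
    have e : u t - u s - (t - s) • G s (u s) = (w n s - u s) - (w n t - u t)
        + (t - s) • G s (w n s - u s) + (w n t - w n s - (t - s) • G s (w n s)) := by
      rw [map_sub, smul_sub]; abel
    rw [e]
    have h1 := map_add_le_add (p k) ((w n s - u s) - (w n t - u t) + (t - s) • G s (w n s - u s))
      (w n t - w n s - (t - s) • G s (w n s))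
    have h2 := map_add_le_add (p k) ((w n s - u s) - (w n t - u t)) ((t - s) • G s (w n s - u s))
    have h3 := map_sub_le_add (p k) (w n s - u s) (w n t - u t)
    have h4 : p k ((t - s) • G s (w n s - u s)) ≤ |t - s| * (C * p l (w n s - u s)) := by
      rw [map_smul_eq_mul, Real.norm_eq_abs]
      gcongr
      exact hbd s hs _
    linarith [hn n hn' s hs t ht hst']

/-- Uniqueness for the abstract linear Cauchy problem `u' = G t u`. -/
theorem HasStep.eq_of_deriv {T : ℝ} {G : ℝ → S →ₗ[ℝ] S} (hstep : HasStep (Icc 0 T) p G)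
    (hsep : ∀ v, (∀ k, p k v = 0) → v = 0) {w : ℝ → S} (hw0 : w 0 = 0)
    (hcont : ∀ k, ContinuousOn (fun t => p k (w t)) (Icc 0 T))
    (hd : ∀ k, ∀ t ∈ Ico 0 T, ∀ ε > 0, ∀ᶠ z in 𝓝[>] t,
        p k (w z - w t - (z - t) • G t (w t)) ≤ ε * (z - t)) :
    ∀ t ∈ Icc 0 T, w t = 0 := by
  obtain ⟨h₀, A, hh₀, -, hst⟩ := hstep
  intro t ht
  refine hsep _ fun k => ?_
  obtain ⟨C, hC⟩ := hst.apriori hh₀ k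
  have := hC w 0 (hcont k) (hd k) t ht
  simp only [hw0, map_zero, gronwallBound_ε0_δ0] at this
  exact le_antisymm this (apply_nonneg _ _)

end Evolution

section WeightedNorm

open SchwartzMap

section Weight

variable {E : Type*} [NormedAddCommGroup E]

/-- The weight `1 + ‖x‖²`. -/
def wt (x : E) : ℝ := 1 + ‖x‖ ^ 2

lemma one_le_wt (x : E) : 1 ≤ wt x := by unfold wt; nlinarith [sq_nonneg ‖x‖]

lemma wt_pos (x : E) : 0 < wt x := one_pos.trans_le (one_le_wt x)

lemma norm_le_wt (x : E) : ‖x‖ ≤ wt x := by unfold wt; nlinarith [sq_nonneg (‖x‖ - 1)]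

lemma wt_le_sq (x : E) : wt x ≤ (1 + ‖x‖) ^ 2 := by unfold wt; nlinarith [norm_nonneg x]

lemma wt_sub_le (x v : E) (hv : ‖v‖ ≤ 1) : wt (x - v) ≤ wt x * (1 + 2 * ‖v‖) := by
  have h1 : ‖x - v‖ ^ 2 ≤ (‖x‖ + ‖v‖) ^ 2 := by gcongr; exact norm_sub_le x v
  unfold wt
  nlinarith [norm_nonneg v, norm_nonneg x, sq_nonneg (‖x‖ - 1),
    mul_nonneg (norm_nonneg v) (sub_nonneg.2 hv), mul_nonneg (norm_nonneg v) (sq_nonneg (‖x‖ - 1)),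
    mul_nonneg (norm_nonneg v) (sq_nonneg ‖x‖)]

end Weight

variable {E F : Type*} [NormedAddCommGroup E] [NormedSpace ℝ E] [NormedAddCommGroup F]
  [NormedSpace ℝ F]

lemma iteratedFDeriv_schwartz_add (f g : 𝓢(E, F)) (j : ℕ) (x : E) :
    iteratedFDeriv ℝ j (f + g : 𝓢(E, F)) x = iteratedFDeriv ℝ j f x + iteratedFDeriv ℝ j g x := by
  rw [FunLike.coe_add]
  exact iteratedFDeriv_add_apply (f.smooth _).contDiffAt (g.smooth _).contDiffAt

lemma iteratedFDeriv_schwartz_smul (c : ℝ) (f : 𝓢(E, F)) (j : ℕ) (x : E) :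
    iteratedFDeriv ℝ j (c • f : 𝓢(E, F)) x = c • iteratedFDeriv ℝ j f x := by
  rw [FunLike.coe_smul]
  exact iteratedFDeriv_const_smul_apply (f.smooth _).contDiffAt

lemma iteratedFDeriv_schwartz_sub (f g : 𝓢(E, F)) (j : ℕ) (x : E) :
    iteratedFDeriv ℝ j (f - g : 𝓢(E, F)) x = iteratedFDeriv ℝ j f x - iteratedFDeriv ℝ j g x := by
  have := iteratedFDeriv_schwartz_add (f - g) g j x
  rw [sub_add_cancel] at this
  rw [this, add_sub_cancel_right]

lemma wt_mul_le_sup (N j : ℕ) (hj : j ≤ N) (f : 𝓢(E, F)) (x : E) :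
    wt x ^ (N - j) * ‖iteratedFDeriv ℝ j f x‖ ≤
      2 ^ (2 * N) * (Finset.Iic (2 * N, N)).sup (schwartzSeminormFamily ℝ E F) f := by
  have h := one_add_le_sup_seminorm_apply (𝕜 := ℝ) (m := (2 * N, N)) (k := 2 * (N - j)) (n := j)
    (by simp only; omega) hj f x
  refine le_trans ?_ h
  rw [pow_mul]
  gcongr
  · exact (wt_pos x).le
  · exact wt_le_sq x

/-- The family of norms `max_{j ≤ N} sup_x (1 + ‖x‖²) ^ (N - j) ‖D^j f x‖`. -/
def wSup (N : ℕ) (f : 𝓢(E, F)) : ℝ :=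
  ⨆ q : Fin (N + 1) × E, wt q.2 ^ (N - q.1) * ‖iteratedFDeriv ℝ q.1 f q.2‖

lemma wSup_bddAbove (N : ℕ) (f : 𝓢(E, F)) : BddAbove (range fun q : Fin (N + 1) × E =>
    wt q.2 ^ (N - q.1) * ‖iteratedFDeriv ℝ q.1 f q.2‖) :=
  ⟨_, by rintro _ ⟨q, rfl⟩; exact wt_mul_le_sup N q.1 (by omega) f q.2⟩

lemma le_wSup {N j : ℕ} (hj : j ≤ N) (f : 𝓢(E, F)) (x : E) :
    wt x ^ (N - j) * ‖iteratedFDeriv ℝ j f x‖ ≤ wSup N f :=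
  le_ciSup (wSup_bddAbove N f) (⟨j, by omega⟩, x)

lemma wSup_nonneg (N : ℕ) (f : 𝓢(E, F)) : 0 ≤ wSup N f :=
  Real.iSup_nonneg fun _ => mul_nonneg (pow_nonneg (wt_pos _).le _) (norm_nonneg _)

lemma wSup_le {N : ℕ} {f : 𝓢(E, F)} {M : ℝ}
    (h : ∀ j ≤ N, ∀ x, wt x ^ (N - j) * ‖iteratedFDeriv ℝ j f x‖ ≤ M) : wSup N f ≤ M :=
  ciSup_le fun q => h q.1 (by omega) q.2

variable (E F) in
/-- `wSup` as a family of seminorms on the Schwartz space. -/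
def wSeminorm (N : ℕ) : Seminorm ℝ 𝓢(E, F) :=
  Seminorm.ofSMulLE (wSup N)
    (le_antisymm (wSup_le fun j _ x => by
      have h := iteratedFDeriv_schwartz_smul 0 (0 : 𝓢(E, F)) j x
      rw [zero_smul, zero_smul] at h
      rw [h, norm_zero, mul_zero]) (wSup_nonneg _ _))
    (fun f g => wSup_le fun j hj x => by
      rw [iteratedFDeriv_schwartz_add]
      have h0 : 0 ≤ wt x ^ (N - j) := pow_nonneg (wt_pos _).le _
      calc _ ≤ wt x ^ (N - j) * (‖iteratedFDeriv ℝ j f x‖ + ‖iteratedFDeriv ℝ j g x‖) := by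
            gcongr; exact norm_add_le _ _
        _ ≤ _ := by rw [mul_add]; exact add_le_add (le_wSup hj f x) (le_wSup hj g x))
    (fun c f => wSup_le fun j hj x => by
      rw [iteratedFDeriv_schwartz_smul, norm_smul, mul_left_comm]
      gcongr
      exact le_wSup hj f x)

lemma wSeminorm_apply (N : ℕ) (f : 𝓢(E, F)) : wSeminorm E F N f = wSup N f := rfl

lemma wSeminorm_monotone : Monotone (wSeminorm E F) := by
  refine monotone_nat_of_le_succ fun N f => ?_
  refine wSup_le fun j hj x => ?_
  refine le_trans ?_ (le_wSup (N := N + 1) (j := j) (by omega) f x)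
  gcongr
  · exact one_le_wt x
  · omega

lemma withSeminorms_wSeminorm : WithSeminorms (wSeminorm E F) := by
  refine (schwartz_withSeminorms ℝ E F).congr
    (Seminorm.IsBounded.of_real fun N => ⟨Finset.Iic (2 * N, N), 2 ^ (2 * N), fun f => ?_⟩)
    (Seminorm.IsBounded.of_real fun kn => ⟨{kn.1 + kn.2}, 1, fun f => ?_⟩)
  · exact wSup_le fun j hj x => wt_mul_le_sup N j hj f x
  · rw [Finset.sup_singleton, one_mul]
    refine SchwartzMap.seminorm_le_bound ℝ kn.1 kn.2 _ (wSup_nonneg _ _) fun x => ?_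
    have h := le_wSup (N := kn.1 + kn.2) (j := kn.2) (by omega) f x
    rw [Nat.add_sub_cancel] at h
    exact (mul_le_mul_of_nonneg_right (pow_le_pow_left₀ (norm_nonneg x) (norm_le_wt x) _)
      (norm_nonneg _)).trans h

lemma wSeminorm_separating (f : 𝓢(E, F)) (h : ∀ k, wSeminorm E F k f = 0) : f = 0 := by
  ext x
  have h1 := le_wSup (N := 0) le_rfl f x
  have h0 := h 0
  rw [wSeminorm_apply] at h0
  simpa [h0] using h1

set_option maxHeartbeats 800000 in
lemma wSeminorm_complete [CompleteSpace F] (w : ℕ → 𝓢(E, F))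
    (hw : ∀ k, ∀ ε > 0, ∃ n₀, ∀ m ≥ n₀, ∀ n ≥ n₀, wSeminorm E F k (w m - w n) ≤ ε) :
    ∃ v, ∀ k, Tendsto (fun n => wSeminorm E F k (w n - v)) atTop (𝓝 0) := by
  have hpt : ∀ N, ∀ j ≤ N, ∀ x m n, wt x ^ (N - j) *
      ‖iteratedFDeriv ℝ j (w m) x - iteratedFDeriv ℝ j (w n) x‖ ≤ wSeminorm E F N (w m - w n) := by
    intro N j hj x m n
    rw [← iteratedFDeriv_schwartz_sub]
    exact le_wSup hj _ x
  have hpt' : ∀ j x m n, 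
      ‖iteratedFDeriv ℝ j (w m) x - iteratedFDeriv ℝ j (w n) x‖ ≤ wSeminorm E F j (w m - w n) := by
    intro j x m n
    simpa using hpt j j le_rfl x m n
  have hc : ∀ j x, CauchySeq fun n => iteratedFDeriv ℝ j (w n) x := by
    intro j x
    refine Metric.cauchySeq_iff.2 fun ε hε => ?_
    obtain ⟨n₀, h⟩ := hw j (ε / 2) (by positivity)
    refine ⟨n₀, fun m hm n hn => ?_⟩
    rw [dist_eq_norm]
    linarith [h m hm n hn, hpt' j x m n]
  choose G hG using fun j x => cauchySeq_tendsto_of_complete (hc j x)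
  have hlim : ∀ N, ∀ ε > 0, ∃ n₀, ∀ n ≥ n₀, ∀ j ≤ N, ∀ x,
      wt x ^ (N - j) * ‖iteratedFDeriv ℝ j (w n) x - G j x‖ ≤ ε := by
    intro N ε hε
    obtain ⟨n₀, h⟩ := hw N ε hε
    refine ⟨n₀, fun n hn j hj x => ?_⟩
    have h1 : Tendsto (fun m => wt x ^ (N - j) *
        ‖iteratedFDeriv ℝ j (w n) x - iteratedFDeriv ℝ j (w m) x‖) atTop
        (𝓝 (wt x ^ (N - j) * ‖iteratedFDeriv ℝ j (w n) x - G j x‖)) :=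
      ((hG j x).const_sub _).norm.const_mul _
    refine le_of_tendsto h1 ?_
    filter_upwards [eventually_ge_atTop n₀] with m hm
    exact (hpt N j hj x n m).trans (h n hn m hm)
  have hunif : ∀ j, TendstoUniformly (fun n x => iteratedFDeriv ℝ j (w n) x) (G j) atTop := by
    intro j
    refine Metric.tendstoUniformly_iff.2 fun ε hε => ?_
    obtain ⟨n₀, h⟩ := hlim j (ε / 2) (by positivity)
    filter_upwards [eventually_ge_atTop n₀] with n hn x
    have := h n hn j le_rfl x
    rw [dist_comm, dist_eq_norm]
    simp only [Nat.sub_self, pow_zero, one_mul] at this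
    linarith
  have hder : ∀ j x, HasFDerivAt (G j) (G (j + 1) x).curryLeft x := by
    intro j x
    refine hasFDerivAt_of_tendstoUniformly (f := fun n x => iteratedFDeriv ℝ j (w n) x)
      (f' := fun n x => (iteratedFDeriv ℝ (j + 1) (w n) x).curryLeft) 
      (g' := fun x => (G (j + 1) x).curryLeft) (l := atTop) ?_ ?_ (hG j) x
    · refine Metric.tendstoUniformly_iff.2 fun ε hε => ?_
      filter_upwards [Metric.tendstoUniformly_iff.1 (hunif (j + 1)) ε hε] with n hn x
      have := hn x
      rw [dist_eq_norm] at this ⊢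
      have e : (G (j + 1) x).curryLeft - (iteratedFDeriv ℝ (j + 1) (w n) x).curryLeft
        = (G (j + 1) x - iteratedFDeriv ℝ (j + 1) (w n) x).curryLeft := rfl
      rwa [e, ContinuousMultilinearMap.curryLeft_norm]
    · intro n x
      exact (((w n).smooth ⊤).ftaylorSeries).fderiv j (by exact_mod_cast ENat.natCast_lt_top j) x
  have hcont : ∀ j, Continuous (G j) := fun j =>
    continuous_iff_continuousAt.2 fun x => (hder j x).continuousAt
  obtain ⟨g, hg⟩ : ∃ g : E → F, ∀ x, (G 0 x).curry0 = g x := ⟨_, fun x => rfl⟩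
  have hT : HasFTaylorSeriesUpTo ((⊤ : ℕ∞) : WithTop ℕ∞) g (fun x j => G j x) :=
    ⟨hg, fun j _ x => hder j x, fun j _ => hcont j⟩
  have hDg : ∀ j x, iteratedFDeriv ℝ j g x = G j x := fun j x =>
    (hT.eq_iteratedFDeriv (by exact_mod_cast le_top) x).symm
  have hsmooth : ContDiff ℝ ((⊤ : ℕ∞) : WithTop ℕ∞) g := hT.contDiff
  have hdecay : ∀ k j, ∃ C, ∀ x, ‖x‖ ^ k * ‖iteratedFDeriv ℝ j g x‖ ≤ C := by
    intro k j
    obtain ⟨n₀, h⟩ := hlim (k + j) 1 one_pos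
    refine ⟨1 + wSup (k + j) (w n₀), fun x => ?_⟩
    have h1 := h n₀ le_rfl j (by omega) x
    have h2 := le_wSup (N := k + j) (j := j) (by omega) (w n₀) x
    rw [Nat.add_sub_cancel] at h1 h2
    rw [hDg]
    have h3 : ‖G j x‖ ≤ ‖iteratedFDeriv ℝ j (w n₀) x - G j x‖ + ‖iteratedFDeriv ℝ j (w n₀) x‖ := by
      rw [add_comm]; exact norm_le_insert _ _
    calc ‖x‖ ^ k * ‖G j x‖ ≤ wt x ^ k *
          (‖iteratedFDeriv ℝ j (w n₀) x - G j x‖ + ‖iteratedFDeriv ℝ j (w n₀) x‖) :=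
          mul_le_mul (pow_le_pow_left₀ (norm_nonneg x) (norm_le_wt x) k) h3 (norm_nonneg _)
            (pow_nonneg (wt_pos _).le _)
      _ ≤ _ := by rw [mul_add]; exact add_le_add h1 h2
  obtain ⟨v, hv⟩ : ∃ v : 𝓢(E, F), ∀ j x, iteratedFDeriv ℝ j v x = G j x :=
    ⟨⟨g, hsmooth, hdecay⟩, hDg⟩
  refine ⟨v, fun k => Metric.tendsto_atTop.2 fun ε hε => ?_⟩
  obtain ⟨n₀, h⟩ := hlim k (ε / 2) (by positivity)
  refine ⟨n₀, fun n hn => ?_⟩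
  rw [Real.dist_0_eq_abs, abs_of_nonneg (apply_nonneg _ _)]
  refine lt_of_le_of_lt (wSup_le fun j hj x => ?_) (half_lt_self hε)
  rw [iteratedFDeriv_schwartz_sub, hv]
  exact h n hn j hj x

end WeightedNorm

section ParameterDerivative

variable {E F : Type*} [NormedAddCommGroup E] [NormedSpace ℝ E] [NormedAddCommGroup F]
  [NormedSpace ℝ F]

lemma ContDiff.smooth_iteratedFDeriv {f : E → F} (hf : ContDiff ℝ (⊤ : ℕ∞) f) (j : ℕ) :
    ContDiff ℝ (⊤ : ℕ∞) (iteratedFDeriv ℝ j f) :=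
  contDiff_infty.2 fun n => hf.iteratedFDeriv_right (by exact_mod_cast le_top)

lemma ContDiff.smooth_fderiv {f : E → F} (hf : ContDiff ℝ (⊤ : ℕ∞) f) :
    ContDiff ℝ (⊤ : ℕ∞) (fderiv ℝ f) :=
  hf.fderiv_right (by exact_mod_cast le_top)

/-- A directional derivative commutes with iterated derivatives. -/
lemma iteratedFDeriv_fderiv_apply {f : E → F} (hf : ContDiff ℝ (⊤ : ℕ∞) f) (v : E) (j : ℕ)
    (x : E) : iteratedFDeriv ℝ j (fun y => fderiv ℝ f y v) x =
      fderiv ℝ (iteratedFDeriv ℝ j f) x v := by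
  induction j generalizing x with
  | zero =>
    ext m
    rw [iteratedFDeriv_zero_apply, iteratedFDeriv_zero_eq_comp,
      LinearIsometryEquiv.comp_fderiv]
    rfl
  | succ j ih =>
    ext m
    have hg := hf.smooth_iteratedFDeriv j
    have hg' := hg.smooth_fderiv
    have h2 : IsSymmSndFDerivAt ℝ (iteratedFDeriv ℝ j f) x :=
      hg.contDiffAt.isSymmSndFDerivAt (by
        rw [minSmoothness_of_isRCLikeNormedField]
        exact WithTop.coe_le_coe.2 (le_top : (2 : ℕ∞) ≤ ⊤))
    rw [iteratedFDeriv_succ_apply_left, show iteratedFDeriv ℝ j (fun y => fderiv ℝ f y v) =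
      fun x => fderiv ℝ (iteratedFDeriv ℝ j f) x v from funext ih]
    have hd : DifferentiableAt ℝ (fderiv ℝ (iteratedFDeriv ℝ j f)) x :=
      (hg'.differentiable (by simp)) x
    rw [fderiv_clm_apply hd (differentiableAt_const v)]
    simp only [fderiv_fun_const, Pi.zero_apply, ContinuousLinearMap.comp_zero, zero_add,
      ContinuousLinearMap.flip_apply]
    rw [h2.eq]
    have h3 : HasFDerivAt (iteratedFDeriv ℝ (j + 1) f) (fderiv ℝ (iteratedFDeriv ℝ (j + 1) f) x) x :=
      (((hf.smooth_iteratedFDeriv (j + 1)).differentiable (by simp)) x).hasFDerivAt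
    have h4 := (ContinuousMultilinearMap.apply ℝ (fun _ : Fin (j + 1) => E) F m).hasFDerivAt.comp
      x h3
    have h5 := (ContinuousMultilinearMap.apply ℝ (fun _ : Fin j => E) F (Fin.tail m)).hasFDerivAt.comp
      x (hd.hasFDerivAt.clm_apply (hasFDerivAt_const (m 0) x))
    have h6 := congrArg (fun L : E →L[ℝ] F => L v) (h5.unique h4)
    simpa using h6

lemma hasDerivAt_iteratedFDeriv_param {Φ : ℝ → E → F} {Φ' : ℝ → E → F}
    (hΦ : ContDiff ℝ (⊤ : ℕ∞) (fun q : ℝ × E => Φ q.1 q.2))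
    (hd : ∀ t x, HasDerivAt (fun s => Φ s x) (Φ' t x) t) (j : ℕ) (t : ℝ) (x : E) :
    HasDerivAt (fun s => iteratedFDeriv ℝ j (Φ s) x) (iteratedFDeriv ℝ j (Φ' t) x) t := by
  set Ψ : ℝ × E → F := fun q => Φ q.1 q.2 with hΨ
  have key : ∀ χ : ℝ × E → F, ContDiff ℝ (⊤ : ℕ∞) χ → ∀ s, 
      iteratedFDeriv ℝ j (fun y => χ (s, y)) x = ContinuousMultilinearMap.compContinuousLinearMapL
        (fun _ : Fin j => ContinuousLinearMap.inr ℝ ℝ E) (iteratedFDeriv ℝ j χ (s, x)) := by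
    intro χ hχ s
    have e : (fun y => χ (s, y)) =
        (fun z => χ ((s, 0) + z)) ∘ (ContinuousLinearMap.inr ℝ ℝ E) := by
      ext y; simp
    have hs : ContDiff ℝ (⊤ : ℕ∞) (fun z => χ ((s, 0) + z)) :=
      hχ.comp (contDiff_const.add contDiff_id)
    rw [e, ContinuousLinearMap.iteratedFDeriv_comp_right _ hs _ (by exact_mod_cast le_top),
      iteratedFDeriv_comp_add_left]
    simp
  have hdΨ : Φ' t = fun y => fderiv ℝ Ψ (t, y) (1, 0) := by
    ext y
    refine (hd t y).unique ?_
    have h1 : HasFDerivAt Ψ (fderiv ℝ Ψ (t, y)) (t, y) :=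
      ((hΦ.differentiable (by simp)) _).hasFDerivAt
    have h2 : HasDerivAt (fun s : ℝ => (s, y)) ((1 : ℝ), (0 : E)) t :=
      (hasDerivAt_id t).prodMk (hasDerivAt_const t y)
    exact h1.comp_hasDerivAt t h2
  rw [hdΨ, key (fun q => fderiv ℝ Ψ q (1, 0)) (hΦ.smooth_fderiv.clm_apply contDiff_const),
    iteratedFDeriv_fderiv_apply hΦ]
  have h1 : HasFDerivAt (iteratedFDeriv ℝ j Ψ) (fderiv ℝ (iteratedFDeriv ℝ j Ψ) (t, x)) (t, x) :=
    (((hΦ.smooth_iteratedFDeriv j).differentiable (by simp)) _).hasFDerivAt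
  have h2 : HasDerivAt (fun s : ℝ => (s, x)) ((1 : ℝ), (0 : E)) t :=
    (hasDerivAt_id t).prodMk (hasDerivAt_const t x)
  have h3 := (ContinuousMultilinearMap.compContinuousLinearMapL (F := F)
    (fun _ : Fin j => ContinuousLinearMap.inr ℝ ℝ E)).hasFDerivAt.comp_hasDerivAt t
      (h1.comp_hasDerivAt t h2)
  refine h3.congr_of_eventuallyEq (Eventually.of_forall fun s => ?_)
  exact key Ψ hΦ s

open SchwartzMap

/-- `Q` is the derivative of the curve `P` in Schwartz space, pointwise for all derivatives. -/
def PtDeriv (P Q : ℝ → 𝓢(E, F)) : Prop :=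
  ∀ j x t, HasDerivAt (fun s => iteratedFDeriv ℝ j (P s) x) (iteratedFDeriv ℝ j (Q t) x) t

lemma PtDeriv.const (f : 𝓢(E, F)) : PtDeriv (fun _ => f) (fun _ => 0) := by
  intro j x t
  have h0 := iteratedFDeriv_schwartz_sub f f j x
  rw [sub_self, sub_self] at h0
  rw [h0]
  exact hasDerivAt_const t _

lemma PtDeriv.add {P Q P' Q' : ℝ → 𝓢(E, F)} (h : PtDeriv P Q) (h' : PtDeriv P' Q') :
    PtDeriv (fun t => P t + P' t) (fun t => Q t + Q' t) := by
  intro j x t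
  simp only [iteratedFDeriv_schwartz_add]
  exact (h j x t).add (h' j x t)

lemma PtDeriv.sub {P Q P' Q' : ℝ → 𝓢(E, F)} (h : PtDeriv P Q) (h' : PtDeriv P' Q') :
    PtDeriv (fun t => P t - P' t) (fun t => Q t - Q' t) := by
  intro j x t
  simp only [iteratedFDeriv_schwartz_sub]
  exact (h j x t).sub (h' j x t)

lemma PtDeriv.smul_const {c : ℝ → ℝ} {c' : ℝ → ℝ} (hc : ∀ t, HasDerivAt c (c' t) t)
    (f : 𝓢(E, F)) : PtDeriv (fun t => c t • f) (fun t => c' t • f) := by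
  intro j x t
  simp only [iteratedFDeriv_schwartz_smul]
  exact (hc t).smul_const (iteratedFDeriv ℝ j f x)

lemma PtDeriv.of_smooth {P Q : ℝ → 𝓢(E, F)}
    (hP : ContDiff ℝ (⊤ : ℕ∞) (fun q : ℝ × E => P q.1 q.2))
    (hd : ∀ t x, HasDerivAt (fun s => P s x) (Q t x) t) : PtDeriv P Q :=
  fun j x t => hasDerivAt_iteratedFDeriv_param (Φ := fun t => P t) (Φ' := fun t => Q t) hP hd j t x

/-- Mean value inequality for the weighted norms. -/
lemma PtDeriv.wSeminorm_le {P Q : ℝ → 𝓢(E, F)} (h : PtDeriv P Q) (h0 : P 0 = 0) {k : ℕ} {M : ℝ}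
    (hM : ∀ t ∈ Icc (0 : ℝ) 1, wSeminorm E F k (Q t) ≤ M) :
    ∀ t ∈ Icc (0 : ℝ) 1, wSeminorm E F k (P t) ≤ M := by
  intro t ht
  refine wSup_le fun j hj x => ?_
  have hw := pow_pos (wt_pos x) (k - j)
  have hM' : ∀ s ∈ Icc (0 : ℝ) 1, ‖iteratedFDeriv ℝ j (Q s) x‖ ≤ (wt x ^ (k - j))⁻¹ * M := by
    intro s hs
    rw [le_inv_mul_iff₀ hw]
    exact (le_wSup hj (Q s) x).trans (hM s hs)
  have h1 := (convex_Icc (0 : ℝ) 1).norm_image_sub_le_of_norm_hasDerivWithin_le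
    (fun s _ => (h j x s).hasDerivWithinAt) hM' (left_mem_Icc.2 zero_le_one) ht
  have hz : iteratedFDeriv ℝ j (P 0) x = 0 := by
    have h2 := iteratedFDeriv_schwartz_sub (P 0) (P 0) j x
    rwa [sub_self, sub_self, ← h0] at h2
  rw [hz, sub_zero, sub_zero, Real.norm_eq_abs, abs_of_nonneg ht.1] at h1
  have hM0 : 0 ≤ M := (apply_nonneg _ _).trans (hM t ht)
  rw [← le_inv_mul_iff₀ hw]
  exact h1.trans (mul_le_of_le_one_right (by positivity) ht.2)

end ParameterDerivative

section Translation

open SchwartzMap LineDeriv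

variable {E F : Type*} [NormedAddCommGroup E] [NormedSpace ℝ E] [NormedAddCommGroup F]
  [NormedSpace ℝ F]

/-- Translation `f ↦ f (· + v)`. -/
def shift (v : E) : 𝓢(E, F) →ₗ[ℝ] 𝓢(E, F) := (compSubConstCLM ℝ (-v)).toLinearMap

lemma shift_apply (v : E) (f : 𝓢(E, F)) (x : E) : shift v f x = f (x + v) := by
  change f (x - -v) = _
  rw [sub_neg_eq_add]

lemma shift_zero (f : 𝓢(E, F)) : shift (0 : E) f = f := by
  ext x; rw [shift_apply, add_zero]

lemma iteratedFDeriv_shift (v : E) (f : 𝓢(E, F)) (j : ℕ) (x : E) :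
    iteratedFDeriv ℝ j (shift v f) x = iteratedFDeriv ℝ j f (x + v) := by
  rw [← iteratedFDeriv_comp_add_right]
  congr 1
  ext y
  exact shift_apply v f y

/-- Directional derivative on Schwartz space, as a linear map. -/
def dirD (v : E) : 𝓢(E, F) →ₗ[ℝ] 𝓢(E, F) := (lineDerivOpCLM ℝ 𝓢(E, F) v).toLinearMap

lemma dirD_apply (v : E) (f : 𝓢(E, F)) (x : E) : dirD v f x = fderiv ℝ f x v :=
  lineDerivOp_apply_eq_fderiv v f x

lemma dirD_smul (c : ℝ) (v : E) (f : 𝓢(E, F)) : dirD (c • v) f = c • dirD v f := by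
  ext x; simp [dirD_apply]

lemma wSeminorm_dirD_le (k : ℕ) (v : E) (f : 𝓢(E, F)) :
    wSeminorm E F k (dirD v f) ≤ ‖v‖ * wSeminorm E F (k + 1) f := by
  refine wSup_le fun j hj x => ?_
  have e : (dirD v f : E → F) = fun y => fderiv ℝ f y v := funext fun y => dirD_apply v f y
  have h1 := norm_iteratedFDeriv_clm_apply_const (c := v) (x := x) (n := j)
    ((f.smooth ⊤).smooth_fderiv.contDiffAt) (by exact_mod_cast le_top)
  rw [norm_iteratedFDeriv_fderiv] at h1
  have h2 := le_wSup (N := k + 1) (j := j + 1) (by omega) f x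
  rw [Nat.add_sub_add_right] at h2
  have hw : 0 ≤ wt x ^ (k - j) := pow_nonneg (wt_pos x).le _
  rw [e]
  calc _ ≤ wt x ^ (k - j) * (‖v‖ * ‖iteratedFDeriv ℝ (j + 1) f x‖) := by gcongr
    _ = ‖v‖ * (wt x ^ (k - j) * ‖iteratedFDeriv ℝ (j + 1) f x‖) := by ring
    _ ≤ _ := by gcongr; exact h2

lemma ptDeriv_shift (v : E) (f : 𝓢(E, F)) :
    PtDeriv (fun t => shift (t • v) f) (fun t => shift (t • v) (dirD v f)) := by
  refine PtDeriv.of_smooth ?_ fun t x => ?_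
  · simp only [shift_apply]
    exact (f.smooth ⊤).comp (contDiff_snd.add (contDiff_fst.smul contDiff_const))
  · simp only [shift_apply, dirD_apply]
    have h1 : HasDerivAt (fun s : ℝ => x + s • v) v t := by
      simpa using ((hasDerivAt_id t).smul_const v).const_add x
    exact ((f.differentiableAt (x := x + t • v)).hasFDerivAt).comp_hasDerivAt t h1

lemma exists_one_add_pow_le (m : ℕ) :
    ∃ C : ℝ, 0 ≤ C ∧ ∀ s : ℝ, 0 ≤ s → s ≤ 2 → (1 + s) ^ m ≤ 1 + C * s := by
  induction m with
  | zero => exact ⟨0, le_rfl, fun s _ _ => by simp⟩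
  | succ m ih =>
    obtain ⟨C, hC, h⟩ := ih
    refine ⟨1 + 3 * C, by positivity, fun s h0 h2 => ?_⟩
    rw [pow_succ]
    have h3 := mul_le_mul_of_nonneg_right (h s h0 h2) (by linarith : 0 ≤ 1 + s)
    nlinarith [mul_nonneg (mul_nonneg hC h0) (by linarith : 0 ≤ 2 - s)]

lemma exists_wSeminorm_shift_le (k : ℕ) : ∃ C : ℝ, 0 ≤ C ∧ ∀ v : E, ‖v‖ ≤ 1 → ∀ f : 𝓢(E, F),
    wSeminorm E F k (shift v f) ≤ (1 + C * ‖v‖) * wSeminorm E F k f := by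
  obtain ⟨C, hC, h⟩ := exists_one_add_pow_le k
  refine ⟨2 * C, by positivity, fun v hv f => wSup_le fun j hj x => ?_⟩
  rw [iteratedFDeriv_shift]
  have hn := norm_nonneg v
  have h1 : wt x ≤ wt (x + v) * (1 + 2 * ‖v‖) := by
    simpa using wt_sub_le (x + v) v hv
  have h2 : wt x ^ (k - j) ≤ wt (x + v) ^ (k - j) * (1 + 2 * C * ‖v‖) := by
    calc wt x ^ (k - j) ≤ (wt (x + v) * (1 + 2 * ‖v‖)) ^ (k - j) :=
          pow_le_pow_left₀ (wt_pos x).le h1 _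
      _ ≤ wt (x + v) ^ (k - j) * (1 + 2 * ‖v‖) ^ k := by
          rw [mul_pow]
          have := (wt_pos (x + v)).le
          gcongr
          · linarith
          · omega
      _ ≤ _ := by
          have := (wt_pos (x + v)).le
          gcongr
          linarith [h (2 * ‖v‖) (by positivity) (by linarith)]
  have h3 := le_wSup hj f (x + v)
  calc _ ≤ wt (x + v) ^ (k - j) * (1 + 2 * C * ‖v‖) * ‖iteratedFDeriv ℝ j f (x + v)‖ := by
        gcongr
    _ = (1 + 2 * C * ‖v‖) * (wt (x + v) ^ (k - j) * ‖iteratedFDeriv ℝ j f (x + v)‖) := by ring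
    _ ≤ _ := by gcongr; exact h3

lemma exists_wSeminorm_shift_sub_le (k : ℕ) : ∃ C : ℝ, 0 ≤ C ∧ ∀ v : E, ‖v‖ ≤ 1 →
    ∀ f : 𝓢(E, F), ∀ t ∈ Icc (0 : ℝ) 1,
      wSeminorm E F k (shift (t • v) f - f) ≤ C * ‖v‖ * wSeminorm E F (k + 1) f := by
  obtain ⟨C, hC, h⟩ := exists_wSeminorm_shift_le (E := E) (F := F) k
  refine ⟨1 + C, by positivity, fun v hv f => ?_⟩
  refine ((ptDeriv_shift v f).sub (PtDeriv.const f)).wSeminorm_le (by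
    rw [zero_smul, shift_zero, sub_self]) fun t ht => ?_
  rw [sub_zero]
  have ht1 : ‖t • v‖ ≤ 1 := by
    rw [norm_smul, Real.norm_eq_abs, abs_of_nonneg ht.1]
    exact mul_le_one₀ ht.2 (norm_nonneg v) hv
  calc _ ≤ (1 + C * ‖t • v‖) * wSeminorm E F k (dirD v f) := h _ ht1 _
    _ ≤ (1 + C * 1) * (‖v‖ * wSeminorm E F (k + 1) f) := by
        gcongr
        exact wSeminorm_dirD_le k v f
    _ = _ := by ring

lemma exists_wSeminorm_shift_sub_sub_le (k : ℕ) : ∃ C : ℝ, 0 ≤ C ∧ ∀ v : E, ‖v‖ ≤ 1 →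
    ∀ f : 𝓢(E, F), wSeminorm E F k (shift v f - f - dirD v f) ≤
      C * ‖v‖ ^ 2 * wSeminorm E F (k + 2) f := by
  obtain ⟨C, hC, h⟩ := exists_wSeminorm_shift_sub_le (E := E) (F := F) k
  refine ⟨C, hC, fun v hv f => ?_⟩
  have h1 := (((ptDeriv_shift v f).sub (PtDeriv.const f)).sub
    (PtDeriv.smul_const (c := fun t => t) (c' := fun _ => 1) hasDerivAt_id (dirD v f))).wSeminorm_le
    (k := k) (M := C * ‖v‖ ^ 2 * wSeminorm E F (k + 2) f)
    (by rw [zero_smul, zero_smul, shift_zero, sub_self, sub_zero]) (fun t ht => ?_) 1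
    (right_mem_Icc.2 zero_le_one)
  · simpa only [one_smul] using h1
  · rw [sub_zero, one_smul]
    calc _ ≤ C * ‖v‖ * wSeminorm E F (k + 1) (dirD v f) := h v hv _ t ht
      _ ≤ C * ‖v‖ * (‖v‖ * wSeminorm E F (k + 1 + 1) f) := by
          gcongr
          exact wSeminorm_dirD_le (k + 1) v f
      _ = _ := by ring

lemma exists_wSeminorm_second_difference_le (k : ℕ) : ∃ C : ℝ, 0 ≤ C ∧ ∀ v : E, ‖v‖ ≤ 1 →
    ∀ f : 𝓢(E, F), wSeminorm E F k (shift v f + shift (-v) f - (2 : ℝ) • f - dirD v (dirD v f)) ≤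
      C * ‖v‖ ^ 3 * wSeminorm E F (k + 3) f := by
  obtain ⟨C, hC, h⟩ := exists_wSeminorm_shift_sub_le (E := E) (F := F) k
  refine ⟨2 * C, by positivity, fun v hv f => ?_⟩
  set g := dirD v (dirD v f) with hg
  have hgk : wSeminorm E F (k + 1) g ≤ ‖v‖ ^ 2 * wSeminorm E F (k + 3) f :=
    calc _ ≤ ‖v‖ * wSeminorm E F (k + 1 + 1) (dirD v f) := wSeminorm_dirD_le _ _ _
      _ ≤ ‖v‖ * (‖v‖ * wSeminorm E F (k + 1 + 1 + 1) f) := by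
          gcongr; exact wSeminorm_dirD_le _ _ _
      _ = _ := by ring
  have hneg : ∀ f : 𝓢(E, F), PtDeriv (fun t => shift (t • -v) f)
      (fun t => (-1 : ℝ) • shift (t • -v) (dirD v f)) := fun f => by
    have h1 := ptDeriv_shift (-v) f
    have e : dirD (-v) f = (-1 : ℝ) • dirD v f := by rw [← dirD_smul, neg_one_smul]
    simpa only [e, map_smul] using h1
  have hfst : PtDeriv
      (fun t => shift (t • v) f + shift (t • -v) f - (2 : ℝ) • f - (t ^ 2) • g)
      (fun t => shift (t • v) (dirD v f) + (-1 : ℝ) • shift (t • -v) (dirD v f) - 0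
        - (2 * t) • g) :=
    (((ptDeriv_shift v f).add (hneg f)).sub (PtDeriv.const _)).sub
      (PtDeriv.smul_const (fun t => by simpa using hasDerivAt_pow 2 t) g)
  have hsnd : PtDeriv
      (fun t => shift (t • v) (dirD v f) - shift (t • -v) (dirD v f) - (2 * t) • g)
      (fun t => shift (t • v) g - (-1 : ℝ) • shift (t • -v) g - (2 : ℝ) • g) :=
    ((ptDeriv_shift v _).sub (hneg _)).sub
      (PtDeriv.smul_const (fun t => by simpa using (hasDerivAt_id t).const_mul 2) g)
  have hM : ∀ t ∈ Icc (0 : ℝ) 1,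
      wSeminorm E F k (shift (t • v) g - (-1 : ℝ) • shift (t • -v) g - (2 : ℝ) • g) ≤
        2 * C * ‖v‖ ^ 3 * wSeminorm E F (k + 3) f := by
    intro t ht
    have e : shift (t • v) g - (-1 : ℝ) • shift (t • -v) g - (2 : ℝ) • g =
        (shift (t • v) g - g) + (shift (t • -v) g - g) := by
      rw [neg_one_smul, two_smul]; abel
    rw [e]
    calc _ ≤ C * ‖v‖ * wSeminorm E F (k + 1) g + C * ‖-v‖ * wSeminorm E F (k + 1) g :=
          (map_add_le_add _ _ _).trans
            (add_le_add (h v hv g t ht) (h (-v) (by rwa [norm_neg]) g t ht))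
      _ = 2 * C * ‖v‖ * wSeminorm E F (k + 1) g := by rw [norm_neg]; ring
      _ ≤ 2 * C * ‖v‖ * (‖v‖ ^ 2 * wSeminorm E F (k + 3) f) := by gcongr
      _ = _ := by ring
  have h2 := hsnd.wSeminorm_le (by
    rw [zero_smul, zero_smul, mul_zero, zero_smul, shift_zero, sub_self, sub_zero]) hM
  have h1 := hfst.wSeminorm_le (k := k) (by
    rw [zero_smul, zero_smul, shift_zero, two_smul]; simp)
    (fun t ht => le_of_eq_of_le (by rw [sub_zero, neg_one_smul, ← sub_eq_add_neg]) (h2 t ht)) 1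
    (right_mem_Icc.2 zero_le_one)
  simpa only [one_smul, one_pow] using h1

end Translation

section TranslationSteps

open SchwartzMap

variable {E F : Type*} [NormedAddCommGroup E] [NormedAddCommGroup F] [NormedSpace ℝ F]

lemma le_sqrt_of_le_one {h : ℝ} (h0 : 0 ≤ h) (h1 : h ≤ 1) : h ≤ √h :=
  Real.le_sqrt_of_sq_le (by nlinarith)

lemma TimeContinuous.smul_const {S : Type*} [AddCommGroup S] [Module ℝ S] {p : ℕ → Seminorm ℝ S}
    {a b : ℝ} {c : ℝ → ℝ} (hc : ContinuousOn c (Icc a b)) {D : S →ₗ[ℝ] S}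
    (hD : ∀ k, ∃ l C, 0 ≤ C ∧ ∀ f, p k (D f) ≤ C * p l f) :
    TimeContinuous (Icc a b) p (fun s => c s • D) := by
  intro k
  obtain ⟨l, C, hC, h⟩ := hD k
  refine ⟨l, fun ε hε => ?_⟩
  obtain ⟨δ, hδ, hu⟩ := Metric.uniformContinuousOn_iff.1
    (isCompact_Icc.uniformContinuousOn_of_continuous hc) (ε / (C + 1)) (by positivity)
  refine ⟨δ / 2, by positivity, fun s hs t ht hst f => ?_⟩
  have h1 := hu t ht s hs (by rw [Real.dist_eq]; linarith)
  rw [Real.dist_eq] at h1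
  rw [LinearMap.smul_apply, LinearMap.smul_apply, ← sub_smul, map_smul_eq_mul, Real.norm_eq_abs]
  calc _ ≤ ε / (C + 1) * (C * p l f) := by
        gcongr
        exact h f
    _ = ε * p l f * (C / (C + 1)) := by ring
    _ ≤ _ := mul_le_of_le_one_right (mul_nonneg hε.le (apply_nonneg _ _))
        ((div_le_one (by positivity)).2 (by linarith))

theorem hasStep_drift [NormedSpace ℝ E] {I : Set ℝ} {b : ℝ → ℝ} {B : ℝ} (hb : ∀ s ∈ I, |b s| ≤ B)
    {e : E} (he : ‖e‖ ≤ 1) : HasStep I (wSeminorm E F) (fun s => b s • dirD e) := by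
  rcases I.eq_empty_or_nonempty with rfl | ⟨s₀, hs₀⟩
  · exact ⟨1, fun _ _ => 0, one_pos, le_rfl, fun _ => ⟨0, le_rfl, by simp⟩,
      fun _ => ⟨0, 0, le_rfl, by simp⟩, fun _ => ⟨0, 0, le_rfl, by simp⟩⟩
  have hB : 0 ≤ B := (abs_nonneg _).trans (hb s₀ hs₀)
  have hv : ∀ s ∈ I, ∀ h, 0 ≤ h → ‖(h * b s) • e‖ ≤ h * B := by
    intro s hs h h0
    rw [norm_smul, norm_mul, Real.norm_eq_abs, Real.norm_eq_abs, abs_of_nonneg h0]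
    exact (mul_le_of_le_one_right (by positivity) he).trans (by gcongr; exact hb s hs)
  have hv1 : ∀ s ∈ I, ∀ h, 0 ≤ h → h ≤ 1 / (1 + B) → ‖(h * b s) • e‖ ≤ 1 := by
    intro s hs h h0 h1
    refine (hv s hs h h0).trans ?_
    rw [le_div_iff₀ (by positivity)] at h1
    nlinarith
  refine ⟨1 / (1 + B), fun s h => shift ((h * b s) • e), by positivity,
    (div_le_one (by positivity)).2 (by linarith), fun k => ?_, fun k => ?_, fun k => ?_⟩
  · obtain ⟨C, hC, h⟩ := exists_wSeminorm_shift_le (E := E) (F := F) k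
    refine ⟨C * B, by positivity, fun s hs t h0 h1 f => (h _ (hv1 s hs t h0 h1) f).trans ?_⟩
    gcongr (1 + ?_) * _
    calc _ ≤ C * (t * B) := by gcongr; exact hv s hs t h0
      _ = _ := by ring
  · obtain ⟨C, hC, h⟩ := exists_wSeminorm_shift_sub_sub_le (E := E) (F := F) k
    refine ⟨k + 2, C * B ^ 2, by positivity, fun s hs t h0 h1 f => ?_⟩
    have ht1 : t ≤ 1 := h1.trans ((div_le_one (by positivity)).2 (by linarith))
    have e1 := h _ (hv1 s hs t h0 h1) f
    rw [LinearMap.smul_apply, smul_smul, ← dirD_smul]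
    refine e1.trans ?_
    gcongr ?_ * _
    calc C * ‖(t * b s) • e‖ ^ 2 ≤ C * (t * B) ^ 2 := by gcongr; exact hv s hs t h0
      _ = C * B ^ 2 * (t * t) := by ring
      _ ≤ _ := by gcongr; exact le_sqrt_of_le_one h0 ht1
  · refine ⟨k + 1, B, hB, fun s hs f => ?_⟩
    rw [LinearMap.smul_apply, map_smul_eq_mul, Real.norm_eq_abs]
    refine mul_le_mul (hb s hs) ?_ (apply_nonneg _ _) hB
    exact (wSeminorm_dirD_le k e f).trans (mul_le_of_le_one_left (apply_nonneg _ _) he)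

lemma exists_inv_one_add_pow_le (m : ℕ) : ∃ C : ℝ, 0 ≤ C ∧ ∀ s : ℝ, |s| ≤ 1 / 2 →
    ((1 + s)⁻¹) ^ m ≤ 1 - m * s + C * s ^ 2 := by
  induction m with
  | zero => exact ⟨0, le_rfl, fun s _ => by simp⟩
  | succ m ih =>
    obtain ⟨C, hC, h⟩ := ih
    refine ⟨2 * m + 2 + 2 * C, by positivity, fun s hs => ?_⟩
    obtain ⟨h1, h2⟩ := abs_le.1 hs
    have hp : 0 < 1 + s := by linarith
    have hinv : (1 + s)⁻¹ ≤ 1 - s + 2 * s ^ 2 := by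
      rw [inv_le_iff_one_le_mul₀ hp]
      nlinarith [mul_nonneg (sq_nonneg s) (by linarith : 0 ≤ 1 + 2 * s)]
    have hq : 0 ≤ 1 - s + 2 * s ^ 2 := (inv_pos.2 hp).le.trans hinv
    rw [pow_succ]
    have h3 := mul_le_mul (h s hs) hinv (inv_pos.2 hp).le
      ((pow_nonneg (inv_pos.2 hp).le m).trans (h s hs))
    refine h3.trans ?_
    have hm : (0 : ℝ) ≤ m := m.cast_nonneg
    have hs2 := sq_nonneg s
    push_cast
    have e : (1 - m * s + C * s ^ 2) * (1 - s + 2 * s ^ 2) = 1 - (m + 1) * s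
        + s ^ 2 * (m + 2 + C - s * (2 * m + C) + 2 * C * s ^ 2) := by ring
    rw [e]
    have e2 : m + 2 + C - s * (2 * m + C) + 2 * C * s ^ 2 ≤ 2 * m + 2 + 2 * C := by
      have h4 : s ^ 2 ≤ 1 / 4 := by nlinarith
      nlinarith [mul_nonneg hC (by linarith : 0 ≤ 1 / 4 - s ^ 2),
        mul_nonneg (by positivity : 0 ≤ 2 * m + C) (by linarith : 0 ≤ s + 1 / 2)]
    nlinarith [mul_le_mul_of_nonneg_left e2 hs2]

section Diffusion

variable [InnerProductSpace ℝ E]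

/-- One step of a symmetric random walk. -/
def walk (v : E) : 𝓢(E, F) →ₗ[ℝ] 𝓢(E, F) := (1 / 2 : ℝ) • (shift v + shift (-v))

lemma wt_add_ge (x v : E) : wt x * (1 + 2 * inner ℝ x v / wt x) ≤ wt (x + v) := by
  have h := (wt_pos x).ne'
  have e : wt x * (1 + 2 * inner ℝ x v / wt x) = wt x + 2 * inner ℝ x v := by field_simp
  rw [e]
  unfold wt
  rw [norm_add_sq_real]
  nlinarith [sq_nonneg ‖v‖]

lemma exists_wSeminorm_walk_le (k : ℕ) : ∃ C : ℝ, 0 ≤ C ∧ ∀ v : E, ‖v‖ ≤ 1 / 2 → ∀ f : 𝓢(E, F),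
    wSeminorm E F k (walk v f) ≤ (1 + C * ‖v‖ ^ 2) * wSeminorm E F k f := by
  choose C hC h using exists_inv_one_add_pow_le
  have hCk : ∀ m ≤ k, C m ≤ ∑ i ∈ Finset.range (k + 1), C i := fun m hm =>
    Finset.single_le_sum (f := C) (fun i _ => hC i) (by simp; omega)
  refine ⟨∑ i ∈ Finset.range (k + 1), C i, Finset.sum_nonneg fun i _ => hC i,
    fun v hv f => wSup_le fun j hj x => ?_⟩
  have hw := wt_pos x
  set m := k - j with hm
  set M := wSeminorm E F k f with hM
  have hM0 : 0 ≤ M := apply_nonneg _ _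
  set s := 2 * inner ℝ x v / wt x with hs
  have hsv : |s| ≤ ‖v‖ := by
    rw [hs, abs_div, abs_of_pos hw, div_le_iff₀ hw, abs_mul, abs_two]
    have h1 := abs_real_inner_le_norm x v
    have h2 : 2 * ‖x‖ ≤ wt x := by unfold wt; nlinarith [sq_nonneg (‖x‖ - 1)]
    nlinarith [norm_nonneg v]
  have hs1 : |s| ≤ 1 / 2 := hsv.trans hv
  have key : ∀ (σ : ℝ) (w : E), |σ| ≤ 1 / 2 → wt x * (1 + σ) ≤ wt (x + w) →
      wt x ^ m * ‖iteratedFDeriv ℝ j (shift w f) x‖ ≤ (1 - m * σ + C m * σ ^ 2) * M := by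
    intro σ w hσ hle
    have hp : 0 < 1 + σ := by linarith [(abs_le.1 hσ).1]
    have h1 := le_wSup hj f (x + w)
    have h2 : wt x ^ m ≤ ((1 + σ)⁻¹) ^ m * wt (x + w) ^ m := by
      rw [← mul_pow]
      refine pow_le_pow_left₀ hw.le ?_ m
      rwa [le_inv_mul_iff₀ hp, mul_comm]
    rw [iteratedFDeriv_shift]
    calc _ ≤ ((1 + σ)⁻¹) ^ m * wt (x + w) ^ m * ‖iteratedFDeriv ℝ j f (x + w)‖ := by gcongr
      _ = ((1 + σ)⁻¹) ^ m * (wt (x + w) ^ m * ‖iteratedFDeriv ℝ j f (x + w)‖) := by ring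
      _ ≤ ((1 + σ)⁻¹) ^ m * M := by gcongr; exact h1
      _ ≤ _ := by gcongr; exact h m σ hσ
  have k1 := key s v hs1 (wt_add_ge x v)
  have k2 := key (-s) (-v) (by rwa [abs_neg]) (by
    have := wt_add_ge x (-v)
    rwa [inner_neg_right, mul_neg, neg_div] at this)
  have e : iteratedFDeriv ℝ j (walk v f) x = (1 / 2 : ℝ) •
      (iteratedFDeriv ℝ j (shift v f) x + iteratedFDeriv ℝ j (shift (-v) f) x) := by
    rw [← iteratedFDeriv_schwartz_add, ← iteratedFDeriv_schwartz_smul]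
    rfl
  have hn := norm_add_le (iteratedFDeriv ℝ j (shift v f) x) (iteratedFDeriv ℝ j (shift (-v) f) x)
  rw [e, norm_smul, Real.norm_eq_abs, abs_of_pos (by norm_num : (0 : ℝ) < 1 / 2)]
  have hs2 : s ^ 2 ≤ ‖v‖ ^ 2 := by
    rw [← sq_abs]; gcongr
  calc _ ≤ wt x ^ m * (1 / 2 * (‖iteratedFDeriv ℝ j (shift v f) x‖
        + ‖iteratedFDeriv ℝ j (shift (-v) f) x‖)) := by gcongr
    _ ≤ 1 / 2 * ((1 - m * s + C m * s ^ 2) * M + (1 - m * -s + C m * (-s) ^ 2) * M) := by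
        linarith
    _ = (1 + C m * s ^ 2) * M := by ring
    _ ≤ _ := by
        have h1 := hCk m (by omega)
        have h2 := (hC m).trans h1
        gcongr

theorem hasStep_diffusion {I : Set ℝ} {a : ℝ → ℝ} {B : ℝ} (ha0 : ∀ s ∈ I, 0 ≤ a s)
    (ha : ∀ s ∈ I, a s ≤ B) {e : E} (he : ‖e‖ ≤ 1) :
    HasStep I (wSeminorm E F) (fun s => a s • (dirD e ∘ₗ dirD e)) := by
  rcases I.eq_empty_or_nonempty with rfl | ⟨s₀, hs₀⟩
  · exact ⟨1, fun _ _ => 0, one_pos, le_rfl, fun _ => ⟨0, le_rfl, by simp⟩,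
      fun _ => ⟨0, 0, le_rfl, by simp⟩, fun _ => ⟨0, 0, le_rfl, by simp⟩⟩
  have hB : 0 ≤ B := (ha0 s₀ hs₀).trans (ha s₀ hs₀)
  have hv : ∀ s ∈ I, ∀ h, 0 ≤ h → ‖√(2 * a s * h) • e‖ ≤ √(2 * B) * √h := by
    intro s hs h h0
    rw [norm_smul, Real.norm_eq_abs, abs_of_nonneg (Real.sqrt_nonneg _),
      ← Real.sqrt_mul (by positivity)]
    refine (mul_le_of_le_one_right (Real.sqrt_nonneg _) he).trans (Real.sqrt_le_sqrt ?_)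
    gcongr
    exact ha s hs
  have hv1 : ∀ s ∈ I, ∀ h, 0 ≤ h → h ≤ 1 / (1 + 8 * B) → ‖√(2 * a s * h) • e‖ ≤ 1 / 2 := by
    intro s hs h h0 h1
    refine (hv s hs h h0).trans ?_
    rw [le_div_iff₀ (by positivity)] at h1
    rw [← Real.sqrt_mul (by positivity)]
    exact Real.sqrt_le_iff.2 ⟨by norm_num, by nlinarith⟩
  refine ⟨1 / (1 + 8 * B), fun s h => walk (√(2 * a s * h) • e), by positivity,
    (div_le_one (by positivity)).2 (by linarith), fun k => ?_, fun k => ?_, fun k => ?_⟩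
  · obtain ⟨C, hC, h⟩ := exists_wSeminorm_walk_le (E := E) (F := F) k
    refine ⟨C * (2 * B), by positivity, fun s hs t h0 h1 f => (h _ (hv1 s hs t h0 h1) f).trans ?_⟩
    gcongr (1 + ?_) * _
    calc _ ≤ C * (√(2 * B) * √t) ^ 2 := by gcongr; exact hv s hs t h0
      _ = _ := by rw [mul_pow, Real.sq_sqrt (by positivity), Real.sq_sqrt h0]; ring
  · obtain ⟨C, hC, h⟩ := exists_wSeminorm_second_difference_le (E := E) (F := F) k
    refine ⟨k + 3, C * √(2 * B) ^ 3, by positivity, fun s hs t h0 h1 f => ?_⟩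
    have e1 := h _ ((hv1 s hs t h0 h1).trans (by norm_num)) f
    set v := √(2 * a s * t) • e with hvdef
    have e2 : walk v f - f - t • (a s • (dirD e ∘ₗ dirD e)) f =
        (1 / 2 : ℝ) • (shift v f + shift (-v) f - (2 : ℝ) • f - dirD v (dirD v f)) := by
      have e3 : dirD v (dirD v f) = (2 * a s * t) • dirD e (dirD e f) := by
        rw [hvdef, dirD_smul, dirD_smul, map_smul, smul_smul,
          Real.mul_self_sqrt (mul_nonneg (mul_nonneg zero_le_two (ha0 s hs)) h0)]
      rw [e3]
      simp only [walk, LinearMap.smul_apply, LinearMap.add_apply, LinearMap.comp_apply]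
      module
    rw [e2, map_smul_eq_mul, Real.norm_eq_abs, abs_of_pos (by norm_num : (0 : ℝ) < 1 / 2)]
    refine (mul_le_of_le_one_left (apply_nonneg _ _) (by norm_num)).trans (e1.trans ?_)
    gcongr ?_ * _
    calc C * ‖v‖ ^ 3 ≤ C * (√(2 * B) * √t) ^ 3 := by gcongr; exact hv s hs t h0
      _ = C * √(2 * B) ^ 3 * (√t ^ 2 * √t) := by ring
      _ = _ := by rw [Real.sq_sqrt h0]
  · refine ⟨k + 1 + 1, B, hB, fun s hs f => ?_⟩
    rw [LinearMap.smul_apply, map_smul_eq_mul, Real.norm_eq_abs, abs_of_nonneg (ha0 s hs)]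
    refine mul_le_mul (ha s hs) ?_ (apply_nonneg _ _) hB
    have hle : ∀ k (g : 𝓢(E, F)), wSeminorm E F k (dirD e g) ≤ wSeminorm E F (k + 1) g := 
      fun k g => (wSeminorm_dirD_le k e g).trans (mul_le_of_le_one_left (apply_nonneg _ _) he)
    exact (hle k _).trans (hle _ f)

end Diffusion

end TranslationSteps

section Multiplication

open SchwartzMap

variable {E : Type*} [NormedAddCommGroup E] [NormedSpace ℝ E]

/-- Multiplication by a function of temperate growth. -/
def mulOp (g : E → ℂ) : 𝓢(E, ℂ) →ₗ[ℝ] 𝓢(E, ℂ) :=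
  (smulLeftCLM ℂ g).toLinearMap.restrictScalars ℝ

lemma mulOp_apply {g : E → ℂ} (hg : g.HasTemperateGrowth) (f : 𝓢(E, ℂ)) (x : E) :
    mulOp g f x = g x * f x :=
  smulLeftCLM_apply_apply hg f x

lemma hasTemperateGrowth_of_wt {g : E → ℂ} (hg : ContDiff ℝ (⊤ : ℕ∞) g)
    (h : ∀ n, ∃ k : ℕ, ∃ C, 0 ≤ C ∧ ∀ x, ‖iteratedFDeriv ℝ n g x‖ ≤ C * wt x ^ k) :
    g.HasTemperateGrowth := by
  refine ⟨hg, fun n => ?_⟩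
  obtain ⟨k, C, hC, h⟩ := h n
  refine ⟨2 * k, C, fun x => (h x).trans ?_⟩
  rw [pow_mul]
  gcongr
  · exact (wt_pos x).le
  · exact wt_le_sq x

lemma wSeminorm_mul_le {g : E → ℂ} (hg : ContDiff ℝ (⊤ : ℕ∞) g) {f u : 𝓢(E, ℂ)}
    (hu : ∀ x, u x = g x * f x) {k r : ℕ} {b₀ b₁ : ℝ} (hb₀ : 0 ≤ b₀) (hb₁ : 0 ≤ b₁)
    (h0 : ∀ x, ‖g x‖ ≤ b₀ * wt x ^ r)
    (h1 : ∀ i, 1 ≤ i → i ≤ k → ∀ x, ‖iteratedFDeriv ℝ i g x‖ ≤ b₁ * wt x ^ (i + r)) :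
    wSeminorm E ℂ k u ≤ (b₀ + 2 ^ k * b₁) * wSeminorm E ℂ (k + r) f := by
  refine wSup_le fun j hj x => ?_
  set M := wSeminorm E ℂ (k + r) f with hM
  have hM0 : 0 ≤ M := apply_nonneg _ _
  have hw := wt_pos x
  have e : (u : E → ℂ) = fun y => g y * f y := funext hu
  have hle := norm_iteratedFDeriv_mul_le (n := j) hg (f.smooth ⊤) x (by exact_mod_cast le_top)
  have hterm : ∀ i ≤ j, wt x ^ (k - j) * (wt x ^ (i + r) * ‖iteratedFDeriv ℝ (j - i) f x‖) ≤ M := by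
    intro i hi
    have h2 := le_wSup (N := k + r) (j := j - i) (by omega) f x
    refine le_of_eq_of_le ?_ h2
    rw [← mul_assoc, ← pow_add]
    congr 2
    omega
  have hi0 : wt x ^ (k - j) * (‖iteratedFDeriv ℝ 0 g x‖ * ‖iteratedFDeriv ℝ (j - 0) f x‖) ≤
      b₀ * M := by
    rw [norm_iteratedFDeriv_zero]
    calc _ ≤ wt x ^ (k - j) * (b₀ * wt x ^ (0 + r) * ‖iteratedFDeriv ℝ (j - 0) f x‖) := by
          rw [zero_add]; gcongr; exact h0 x
      _ = b₀ * (wt x ^ (k - j) * (wt x ^ (0 + r) * ‖iteratedFDeriv ℝ (j - 0) f x‖)) := by ring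
      _ ≤ _ := by gcongr; exact hterm 0 (by omega)
  have hi1 : ∀ i < j, wt x ^ (k - j) * (‖iteratedFDeriv ℝ (i + 1) g x‖ *
      ‖iteratedFDeriv ℝ (j - (i + 1)) f x‖) ≤ b₁ * M := by
    intro i hi
    calc _ ≤ wt x ^ (k - j) * (b₁ * wt x ^ (i + 1 + r) *
          ‖iteratedFDeriv ℝ (j - (i + 1)) f x‖) := by
          gcongr; exact h1 (i + 1) (by omega) (by omega) x
      _ = b₁ * (wt x ^ (k - j) * (wt x ^ (i + 1 + r) *
          ‖iteratedFDeriv ℝ (j - (i + 1)) f x‖)) := by ring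
      _ ≤ _ := by gcongr; exact hterm (i + 1) (by omega)
  have hchoose : (∑ i ∈ Finset.range j, (j.choose (i + 1) : ℝ)) ≤ 2 ^ k := by
    have h2 : (∑ i ∈ Finset.range (j + 1), (j.choose i : ℝ)) = 2 ^ j := by
      exact_mod_cast Nat.sum_range_choose j
    rw [Finset.sum_range_succ'] at h2
    have h3 : (2 : ℝ) ^ j ≤ 2 ^ k := pow_le_pow_right₀ one_le_two hj
    have h4 : (0 : ℝ) ≤ (j.choose 0 : ℝ) := Nat.cast_nonneg _
    linarith
  rw [e]
  calc _ ≤ wt x ^ (k - j) * ∑ i ∈ Finset.range (j + 1), (j.choose i : ℝ) *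
        ‖iteratedFDeriv ℝ i g x‖ * ‖iteratedFDeriv ℝ (j - i) f x‖ := by gcongr
    _ = ∑ i ∈ Finset.range j, (j.choose (i + 1) : ℝ) * (wt x ^ (k - j) *
          (‖iteratedFDeriv ℝ (i + 1) g x‖ * ‖iteratedFDeriv ℝ (j - (i + 1)) f x‖))
        + wt x ^ (k - j) * (‖iteratedFDeriv ℝ 0 g x‖ * ‖iteratedFDeriv ℝ (j - 0) f x‖) := by
        rw [Finset.sum_range_succ', mul_add, Finset.mul_sum]
        congr 1
        · exact Finset.sum_congr rfl fun i _ => by ring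
        · rw [Nat.choose_zero_right, Nat.cast_one, one_mul]
    _ ≤ ∑ i ∈ Finset.range j, (j.choose (i + 1) : ℝ) * (b₁ * M) + b₀ * M := by
        refine add_le_add (Finset.sum_le_sum fun i hi => ?_) hi0
        exact mul_le_mul_of_nonneg_left (hi1 i (Finset.mem_range.1 hi)) (Nat.cast_nonneg _)
    _ ≤ 2 ^ k * (b₁ * M) + b₀ * M := by
        rw [← Finset.sum_mul]
        gcongr
    _ = _ := by ring

/-- Uniform bounds on a potential: quadratic growth of all derivatives and real part bounded
below. -/
structure PotentialBound (C₀ : ℝ) (K : ℕ → ℝ) (W : E → ℂ) : Prop where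
  smooth : ContDiff ℝ (⊤ : ℕ∞) W
  le : ∀ n x, ‖iteratedFDeriv ℝ n W x‖ ≤ K n * wt x
  lower : ∀ x, -C₀ ≤ (W x).re

variable {C₀ : ℝ} {K : ℕ → ℝ}

lemma PotentialBound.nonneg {W : E → ℂ} (hW : PotentialBound C₀ K W) (n : ℕ) : 0 ≤ K n :=
  nonneg_of_mul_nonneg_left ((norm_nonneg _).trans (hW.le n 0)) (wt_pos _)

lemma PotentialBound.hasTemperateGrowth {W : E → ℂ} (hW : PotentialBound C₀ K W) :
    W.HasTemperateGrowth :=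
  hasTemperateGrowth_of_wt hW.smooth fun n => ⟨1, K n, hW.nonneg n, by simpa using hW.le n⟩

lemma PotentialBound.smooth_exp {W : E → ℂ} (hW : PotentialBound C₀ K W) (h : ℝ) :
    ContDiff ℝ (⊤ : ℕ∞) (fun y => cexp (-(h : ℂ) * W y)) :=
  (contDiff_const.mul hW.smooth).cexp

lemma PotentialBound.norm_exp_le {W : E → ℂ} (hW : PotentialBound C₀ K W) {h : ℝ} (h0 : 0 ≤ h)
    (x : E) : ‖cexp (-(h : ℂ) * W x)‖ ≤ Real.exp (C₀ * h) := by
  rw [Complex.norm_exp, Real.exp_le_exp]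
  have e : (-(h : ℂ) * W x).re = -h * (W x).re := by simp
  rw [e]
  nlinarith [hW.lower x]

variable (E) in
lemma exists_potentialBound_exp_le (hK : ∀ n, 0 ≤ K n) (hC₀ : 0 ≤ C₀) (i : ℕ) :
    ∃ C, 0 ≤ C ∧ ∀ W : E → ℂ, PotentialBound C₀ K W → ∀ h : ℝ, 0 ≤ h → h ≤ 1 → ∀ x,
      ‖iteratedFDeriv ℝ i (fun y => cexp (-(h : ℂ) * W y)) x‖ ≤ C * wt x ^ i ∧
      (1 ≤ i → ‖iteratedFDeriv ℝ i (fun y => cexp (-(h : ℂ) * W y)) x‖ ≤ C * h * wt x ^ i) := by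
  induction i using Nat.strong_induction_on with
  | _ i ih =>
    rcases i with _ | i
    · refine ⟨Real.exp C₀, (Real.exp_pos _).le, fun W hW h h0 h1 x => ⟨?_, by simp⟩⟩
      rw [norm_iteratedFDeriv_zero, pow_zero, mul_one]
      refine (hW.norm_exp_le h0 x).trans (Real.exp_le_exp.2 ?_)
      exact mul_le_of_le_one_right hC₀ h1
    · choose! C hC hle using ih
      set D := ∑ l ∈ Finset.range (i + 1), (i.choose l : ℝ) * C l * K (i - l + 1) with hD
      have hD0 : 0 ≤ D := Finset.sum_nonneg fun l hl =>
        mul_nonneg (mul_nonneg (Nat.cast_nonneg _) (hC l (Finset.mem_range.1 hl))) (hK _)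
      have key : ∀ W : E → ℂ, PotentialBound C₀ K W → ∀ h : ℝ, 0 ≤ h → h ≤ 1 → ∀ x,
          ‖iteratedFDeriv ℝ (i + 1) (fun y => cexp (-(h : ℂ) * W y)) x‖ ≤
            D * h * wt x ^ (i + 1) := by
        intro W hW h h0 h1 x
        have hm := hW.smooth_exp h
        have hDW := hW.smooth.smooth_fderiv
        have e : fderiv ℝ (fun y => cexp (-(h : ℂ) * W y)) =
            (-h) • fun y => cexp (-(h : ℂ) * W y) • fderiv ℝ W y := by
          ext y v
          have h2 : HasFDerivAt W (fderiv ℝ W y) y :=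
            ((hW.smooth.differentiable (by simp)) y).hasFDerivAt
          rw [(h2.const_mul (-(h : ℂ))).cexp.fderiv]
          simp
          ring
        have h3 := norm_iteratedFDeriv_smul_le (n := i) hm hDW x (by exact_mod_cast le_top)
        have hsm : ContDiffAt ℝ i (fun y => cexp (-(h : ℂ) * W y) • fderiv ℝ W y) x :=
          (hm.smul hDW).contDiffAt.of_le (by exact_mod_cast le_top)
        rw [← norm_iteratedFDeriv_fderiv, e, iteratedFDeriv_const_smul_apply hsm, norm_smul, norm_neg,
          Real.norm_eq_abs, abs_of_nonneg h0, mul_right_comm, mul_comm]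
        gcongr
        refine h3.trans ?_
        rw [hD, Finset.sum_mul]
        refine Finset.sum_le_sum fun l hl => ?_
        have hl' : l < i + 1 := Finset.mem_range.1 hl
        rw [norm_iteratedFDeriv_fderiv]
        have hCl := hC l hl'
        have hwx := wt_pos x
        calc _ ≤ (i.choose l : ℝ) * (C l * wt x ^ l) * (K (i - l + 1) * wt x) := by
              gcongr
              · exact (hle l hl' W hW h h0 h1 x).1
              · exact hW.le _ x
          _ = (i.choose l : ℝ) * C l * K (i - l + 1) * wt x ^ (l + 1) := by ring
          _ ≤ _ := by
              have := hK (i - l + 1)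
              gcongr
              · exact one_le_wt x
              · omega
      refine ⟨D, hD0, fun W hW h h0 h1 x => ⟨(key W hW h h0 h1 x).trans ?_,
        fun _ => key W hW h h0 h1 x⟩⟩
      have := wt_pos x
      gcongr
      exact mul_le_of_le_one_right hD0 h1

lemma PotentialBound.hasTemperateGrowth_exp {W : E → ℂ} (hW : PotentialBound C₀ K W) (hC₀ : 0 ≤ C₀)
    {h : ℝ} (h0 : 0 ≤ h) : (fun y => cexp (-(h : ℂ) * W y)).HasTemperateGrowth := by
  have hW' : PotentialBound (h * C₀) (fun n => h * K n) (fun y => (h : ℂ) * W y) := by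
    have e : (fun y => (h : ℂ) * W y) = h • W := by ext y; simp
    refine ⟨contDiff_const.mul hW.smooth, fun n x => ?_, fun x => ?_⟩
    · rw [e, iteratedFDeriv_const_smul_apply (hW.smooth.contDiffAt.of_le
        (by exact_mod_cast le_top)), norm_smul, Real.norm_eq_abs, abs_of_nonneg h0, mul_assoc]
      gcongr
      exact hW.le n x
    · have e2 : ((h : ℂ) * W x).re = h * (W x).re := by simp
      rw [e2]
      nlinarith [hW.lower x]
  have e : (fun y => cexp (-(h : ℂ) * W y)) = fun y => cexp (-((1 : ℝ) : ℂ) * ((h : ℂ) * W y)) := by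
    ext y; simp
  refine hasTemperateGrowth_of_wt (hW.smooth_exp h) fun n => ?_
  obtain ⟨C, hC, hle⟩ := exists_potentialBound_exp_le E hW'.nonneg (mul_nonneg h0 hC₀) n
  rw [e]
  exact ⟨n, C, hC, fun x => (hle _ hW' 1 zero_le_one le_rfl x).1⟩

variable (E) in
lemma exists_wSeminorm_mulOp_le (hK : ∀ n, 0 ≤ K n) (k : ℕ) :
    ∃ C, 0 ≤ C ∧ ∀ W : E → ℂ, PotentialBound C₀ K W → ∀ f,
      wSeminorm E ℂ k (mulOp W f) ≤ C * wSeminorm E ℂ (k + 1) f := by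
  refine ⟨K 0 + 2 ^ k * ∑ i ∈ Finset.range (k + 1), K i, add_nonneg (hK 0) (mul_nonneg (by positivity)
    (Finset.sum_nonneg fun i _ => hK i)), fun W hW f => ?_⟩
  refine wSeminorm_mul_le hW.smooth (fun x => mulOp_apply hW.hasTemperateGrowth f x) (hK 0)
    (Finset.sum_nonneg fun i _ => hK i) (fun x => by simpa using hW.le 0 x) fun i _ hik x => ?_
  refine (hW.le i x).trans (mul_le_mul ?_ ?_ (wt_pos x).le (Finset.sum_nonneg fun i _ => hK i))
  · exact Finset.single_le_sum (f := K) (fun i _ => hK i) (by simp; omega)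
  · exact le_self_pow₀ (one_le_wt x) (by omega)

variable (E) in
lemma exists_wSeminorm_mulOp_exp_le (hK : ∀ n, 0 ≤ K n) (hC₀ : 0 ≤ C₀) (k : ℕ) :
    ∃ C, 0 ≤ C ∧ ∀ W : E → ℂ, PotentialBound C₀ K W → ∀ h : ℝ, 0 ≤ h → h ≤ 1 → ∀ f,
      wSeminorm E ℂ k (mulOp (fun y => cexp (-(h : ℂ) * W y)) f) ≤
        (1 + C * h) * wSeminorm E ℂ k f := by
  choose C hC hle using exists_potentialBound_exp_le E hK hC₀
  have hS : 0 ≤ ∑ i ∈ Finset.range (k + 1), C i := Finset.sum_nonneg fun i _ => hC i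
  refine ⟨C₀ * Real.exp C₀ + 2 ^ k * ∑ i ∈ Finset.range (k + 1), C i, by positivity,
    fun W hW h h0 h1 f => ?_⟩
  have h2 := wSeminorm_mul_le (k := k) (r := 0) (b₀ := Real.exp (C₀ * h))
    (b₁ := (∑ i ∈ Finset.range (k + 1), C i) * h) (hW.smooth_exp h)
    (fun x => mulOp_apply (hW.hasTemperateGrowth_exp hC₀ h0) f x) (Real.exp_pos _).le
    (by positivity) (fun x => by simpa using hW.norm_exp_le h0 x) (fun i hi hik x => by
      refine ((hle i W hW h h0 h1 x).2 hi).trans ?_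
      have := wt_pos x
      rw [add_zero]
      gcongr
      exact Finset.single_le_sum (f := C) (fun i _ => hC i) (by simp; omega))
  refine h2.trans ?_
  rw [add_zero]
  gcongr ?_ * _
  have h3 : Real.exp (C₀ * h) ≤ 1 + C₀ * Real.exp C₀ * h := by
    have h4 : Real.exp (C₀ * h) * (1 - C₀ * h) ≤ 1 := by
      have h5 : 1 - C₀ * h ≤ Real.exp (-(C₀ * h)) := by
        linarith [Real.add_one_le_exp (-(C₀ * h))]
      calc _ ≤ Real.exp (C₀ * h) * Real.exp (-(C₀ * h)) := by gcongr
        _ = 1 := by rw [← Real.exp_add, add_neg_cancel, Real.exp_zero]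
    have h6 : Real.exp (C₀ * h) ≤ Real.exp C₀ :=
      Real.exp_le_exp.2 (mul_le_of_le_one_right hC₀ h1)
    nlinarith [mul_le_mul_of_nonneg_left h6 (mul_nonneg hC₀ h0)]
  linarith

lemma PotentialBound.ptDeriv_exp {W : E → ℂ} (hW : PotentialBound C₀ K W) (hC₀ : 0 ≤ C₀) {h : ℝ}
    (h0 : 0 ≤ h) (f : 𝓢(E, ℂ)) :
    PtDeriv (fun τ => mulOp (fun y => cexp (-((h * τ ^ 2 : ℝ) : ℂ) * W y)) f)
      (fun τ => (-(2 * h * τ)) • mulOp W (mulOp (fun y => cexp (-((h * τ ^ 2 : ℝ) : ℂ) * W y)) f)) := by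
  have hT : ∀ τ : ℝ, (fun y => cexp (-((h * τ ^ 2 : ℝ) : ℂ) * W y)).HasTemperateGrowth :=
    fun τ => hW.hasTemperateGrowth_exp hC₀ (by positivity)
  refine PtDeriv.of_smooth ?_ fun t x => ?_
  · simp only [mulOp_apply (hT _)]
    have h1 : ContDiff ℝ (⊤ : ℕ∞) (fun q : ℝ × E => ((h * q.1 ^ 2 : ℝ) : ℂ)) :=
      Complex.ofRealCLM.contDiff.comp (contDiff_const.mul (contDiff_fst.pow 2))
    exact (h1.neg.mul (hW.smooth.comp contDiff_snd)).cexp.mul ((f.smooth ⊤).comp contDiff_snd)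
  · simp only [mulOp_apply (hT _), smul_apply, mulOp_apply hW.hasTemperateGrowth]
    have h1 : HasDerivAt (fun s : ℝ => h * s ^ 2) (2 * h * t) t := by
      have := (hasDerivAt_pow 2 t).const_mul h
      refine this.congr_deriv ?_
      simp; ring
    have h1' : HasDerivAt (fun s : ℝ => -((h * s ^ 2 : ℝ) : ℂ)) (-((2 * h * t : ℝ) : ℂ)) t :=
      h1.ofReal_comp.neg
    have h2 := ((h1'.mul_const (W x)).cexp).mul_const (f x)
    refine h2.congr_deriv ?_
    rw [Complex.real_smul]
    push_cast
    ring

variable (E) in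
lemma exists_wSeminorm_mulOp_exp_sub_le (hK : ∀ n, 0 ≤ K n) (hC₀ : 0 ≤ C₀) (k : ℕ) :
    ∃ C, 0 ≤ C ∧ ∀ W : E → ℂ, PotentialBound C₀ K W → ∀ h : ℝ, 0 ≤ h → h ≤ 1 → ∀ f,
      ∀ τ ∈ Icc (0 : ℝ) 1,
      wSeminorm E ℂ k (mulOp (fun y => cexp (-((h * τ ^ 2 : ℝ) : ℂ) * W y)) f - f) ≤
        C * h * wSeminorm E ℂ (k + 1) f := by
  obtain ⟨C, hC, hle⟩ := exists_wSeminorm_mulOp_le E (C₀ := C₀) hK k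
  obtain ⟨C', hC', hle'⟩ := exists_wSeminorm_mulOp_exp_le E hK hC₀ (k + 1)
  refine ⟨2 * C * (1 + C'), by positivity, fun W hW h h0 h1 f => ?_⟩
  refine ((hW.ptDeriv_exp hC₀ h0 f).sub (PtDeriv.const f)).wSeminorm_le ?_ fun τ hτ => ?_
  · rw [sub_eq_zero]
    ext x
    rw [mulOp_apply (hW.hasTemperateGrowth_exp hC₀ (by simp))]
    simp
  · have hτ2 : h * τ ^ 2 ≤ h := mul_le_of_le_one_right h0 (pow_le_one₀ hτ.1 hτ.2)
    have hh : 0 ≤ h * τ ^ 2 := by positivity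
    rw [sub_zero, map_smul_eq_mul, norm_neg, Real.norm_eq_abs,
      abs_of_nonneg (mul_nonneg (by positivity) hτ.1)]
    calc _ ≤ 2 * h * 1 * (C * ((1 + C' * 1) * wSeminorm E ℂ (k + 1) f)) := by
          gcongr
          · exact hτ.2
          · refine (hle W hW _).trans ?_
            gcongr
            refine (hle' W hW _ hh (hτ2.trans h1) f).trans ?_
            gcongr
            exact hτ2.trans h1
      _ = _ := by ring

variable (E) in
lemma exists_wSeminorm_mulOp_exp_sub_sub_le (hK : ∀ n, 0 ≤ K n) (hC₀ : 0 ≤ C₀) (k : ℕ) :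
    ∃ C, 0 ≤ C ∧ ∀ W : E → ℂ, PotentialBound C₀ K W → ∀ h : ℝ, 0 ≤ h → h ≤ 1 → ∀ f,
      wSeminorm E ℂ k (mulOp (fun y => cexp (-(h : ℂ) * W y)) f - f - h • (-mulOp W) f) ≤
        C * h ^ 2 * wSeminorm E ℂ (k + 2) f := by
  obtain ⟨C, hC, hle⟩ := exists_wSeminorm_mulOp_le E (C₀ := C₀) hK k
  obtain ⟨C', hC', hle'⟩ := exists_wSeminorm_mulOp_exp_sub_le E hK hC₀ (k + 1)
  refine ⟨2 * C * C', by positivity, fun W hW h h0 h1 f => ?_⟩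
  have hder : PtDeriv
      (fun τ => mulOp (fun y => cexp (-((h * τ ^ 2 : ℝ) : ℂ) * W y)) f - f
        - (-(h * τ ^ 2)) • mulOp W f)
      (fun τ => (-(2 * h * τ)) • mulOp W (mulOp (fun y => cexp (-((h * τ ^ 2 : ℝ) : ℂ) * W y)) f)
        - 0 - (-(2 * h * τ)) • mulOp W f) :=
    ((hW.ptDeriv_exp hC₀ h0 f).sub (PtDeriv.const f)).sub (PtDeriv.smul_const (fun t => by
      have := ((hasDerivAt_pow 2 t).const_mul h).neg
      refine this.congr_deriv ?_
      simp; ring) _)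
  have h2 := hder.wSeminorm_le (k := k) (M := 2 * C * C' * h ^ 2 * wSeminorm E ℂ (k + 2) f) ?_ ?_ 1
    (right_mem_Icc.2 zero_le_one)
  · simpa using h2
  · ext x
    rw [sub_apply, sub_apply, mulOp_apply (hW.hasTemperateGrowth_exp hC₀ (by simp))]
    simp
  · intro τ hτ
    have e : (-(2 * h * τ)) • mulOp W (mulOp (fun y => cexp (-((h * τ ^ 2 : ℝ) : ℂ) * W y)) f)
        - 0 - (-(2 * h * τ)) • mulOp W f = (-(2 * h * τ)) •
          mulOp W (mulOp (fun y => cexp (-((h * τ ^ 2 : ℝ) : ℂ) * W y)) f - f) := by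
      rw [sub_zero, map_sub, smul_sub]
    rw [e, map_smul_eq_mul, norm_neg, Real.norm_eq_abs,
      abs_of_nonneg (mul_nonneg (by positivity) hτ.1)]
    calc _ ≤ 2 * h * 1 * (C * (C' * h * wSeminorm E ℂ (k + 1 + 1) f)) := by
          gcongr
          · exact hτ.2
          · refine (hle W hW _).trans ?_
            gcongr
            exact hle' W hW h h0 h1 f τ hτ
      _ = _ := by ring

theorem hasStep_potential {I : Set ℝ} {V : ℝ → E → ℂ} (hK : ∀ n, 0 ≤ K n) (hC₀ : 0 ≤ C₀)
    (hV : ∀ t ∈ I, PotentialBound C₀ K (V t)) :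
    HasStep I (wSeminorm E ℂ) (fun t => -mulOp (V t)) := by
  refine ⟨1, fun s h => mulOp (fun y => cexp (-(h : ℂ) * V s y)), one_pos, le_rfl, fun k => ?_,
    fun k => ?_, fun k => ?_⟩
  · obtain ⟨C, hC, hle⟩ := exists_wSeminorm_mulOp_exp_le E hK hC₀ k
    exact ⟨C, hC, fun s hs h h0 h1 f => hle _ (hV s hs) h h0 h1 f⟩
  · obtain ⟨C, hC, hle⟩ := exists_wSeminorm_mulOp_exp_sub_sub_le E hK hC₀ k
    refine ⟨k + 2, C, hC, fun s hs h h0 h1 f => (hle _ (hV s hs) h h0 h1 f).trans ?_⟩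
    rw [pow_two]
    gcongr
    exact le_sqrt_of_le_one h0 h1
  · obtain ⟨C, hC, hle⟩ := exists_wSeminorm_mulOp_le E (C₀ := C₀) hK k
    refine ⟨k + 1, C, hC, fun s hs f => ?_⟩
    rw [LinearMap.neg_apply, map_neg_eq_map]
    exact hle _ (hV s hs) f

lemma timeContinuous_potential {I : Set ℝ} {V : ℝ → E → ℂ}
    (hV : ∀ t ∈ I, PotentialBound C₀ K (V t))
    (hc : ∀ n, ∀ ε > 0, ∃ δ > 0, ∀ s ∈ I, ∀ t ∈ I, |t - s| ≤ δ → ∀ x,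
      ‖iteratedFDeriv ℝ n (V t) x - iteratedFDeriv ℝ n (V s) x‖ ≤ ε * wt x ^ 2) :
    TimeContinuous I (wSeminorm E ℂ) (fun t => -mulOp (V t)) := by
  intro k
  refine ⟨k + 2, fun ε hε => ?_⟩
  choose δ hδ h using fun n => hc n (ε / (1 + 2 ^ k)) (by positivity)
  obtain ⟨η, hη, hle⟩ : ∃ η > 0, ∀ n ≤ k, η ≤ δ n := by
    refine ⟨(Finset.range (k + 1)).inf' ⟨0, by simp⟩ δ, ?_, fun n hn => ?_⟩
    · exact (Finset.lt_inf'_iff _).2 fun n _ => hδ n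
    · exact Finset.inf'_le _ (by simp; omega)
  refine ⟨η, hη, fun s hs t ht hst f => ?_⟩
  have hVt := (hV t ht).smooth
  have hVs := (hV s hs).smooth
  have hD : ∀ i x, iteratedFDeriv ℝ i (fun y => V s y - V t y) x =
      iteratedFDeriv ℝ i (V s) x - iteratedFDeriv ℝ i (V t) x := fun i x =>
    iteratedFDeriv_sub_apply (hVs.contDiffAt.of_le (by exact_mod_cast le_top))
      (hVt.contDiffAt.of_le (by exact_mod_cast le_top))
  have hb : ∀ i ≤ k, ∀ x, ‖iteratedFDeriv ℝ i (fun y => V s y - V t y) x‖ ≤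
      ε / (1 + 2 ^ k) * wt x ^ 2 := by
    intro i hi x
    rw [hD, norm_sub_rev]
    exact h i s hs t ht (hst.trans (hle i hi)) x
  have h1 := wSeminorm_mul_le (k := k) (r := 2) (b₀ := ε / (1 + 2 ^ k)) (b₁ := ε / (1 + 2 ^ k))
    (g := fun y => V s y - V t y) (f := f) (u := (-mulOp (V t)) f - (-mulOp (V s)) f)
    (hVs.sub hVt) (fun x => ?_) (by positivity) (by positivity)
    (fun x => by simpa using hb 0 (by omega) x) (fun i _ hik x => (hb i hik x).trans ?_)
  · refine h1.trans (le_of_eq ?_)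
    field_simp
  · rw [LinearMap.neg_apply, LinearMap.neg_apply, sub_apply, neg_apply, neg_apply,
      mulOp_apply (hV t ht).hasTemperateGrowth, mulOp_apply (hV s hs).hasTemperateGrowth]
    ring
  · gcongr
    · exact one_le_wt x
    · omega

end Multiplication

section WordDerivatives

variable {d : ℕ}

/-- Iterated partial derivative along a word in the coordinate directions. -/
def wd (w : List (Fin d)) (f : Ed d → ℝ) : Ed d → ℝ := w.foldr (pd d) f

@[simp] lemma wd_nil (f : Ed d → ℝ) : wd [] f = f := rfl

@[simp] lemma wd_cons (j : Fin d) (w : List (Fin d)) (f : Ed d → ℝ) :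
    wd (j :: w) f = pd d j (wd w f) := rfl

lemma ContDiff.smooth_pd {f : Ed d → ℝ} (hf : ContDiff ℝ (⊤ : ℕ∞) f) (j : Fin d) :
    ContDiff ℝ (⊤ : ℕ∞) (pd d j f) :=
  hf.smooth_fderiv.clm_apply contDiff_const

lemma ContDiff.smooth_wd {f : Ed d → ℝ} (hf : ContDiff ℝ (⊤ : ℕ∞) f) (w : List (Fin d)) :
    ContDiff ℝ (⊤ : ℕ∞) (wd w f) := by
  induction w with
  | nil => exact hf
  | cons j w ih => exact ih.smooth_pd j

lemma pd_comm {f : Ed d → ℝ} (hf : ContDiff ℝ (⊤ : ℕ∞) f) (i j : Fin d) :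
    pd d i (pd d j f) = pd d j (pd d i f) := by
  ext x
  have h : IsSymmSndFDerivAt ℝ f x := hf.contDiffAt.isSymmSndFDerivAt (by
    rw [minSmoothness_of_isRCLikeNormedField]
    exact WithTop.coe_le_coe.2 (le_top : (2 : ℕ∞) ≤ ⊤))
  have hd : DifferentiableAt ℝ (fderiv ℝ f) x := hf.smooth_fderiv.differentiable (by simp) x
  have key : ∀ v w : Ed d, fderiv ℝ (fun y => fderiv ℝ f y v) x w =
      fderiv ℝ (fderiv ℝ f) x w v := fun v w => by
    rw [fderiv_clm_apply hd (differentiableAt_const v)]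
    simp
  unfold pd
  rw [key, key]
  exact h _ _

lemma wd_perm {f : Ed d → ℝ} (hf : ContDiff ℝ (⊤ : ℕ∞) f) {w w' : List (Fin d)}
    (h : w.Perm w') : wd w f = wd w' f := by
  induction h with
  | nil => rfl
  | cons j _ ih => rw [wd_cons, wd_cons, ih]
  | swap i j l => exact pd_comm (hf.smooth_wd l) j i
  | trans _ _ h1 h2 => exact h1.trans h2

lemma md_eq_wd (α : Fin d → ℕ) (f : Ed d → ℝ) :
    md α f = wd ((List.finRange d).flatMap fun j => List.replicate (α j) j) f := by
  unfold md wd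
  rw [List.foldr_flatMap]
  congr 1
  ext j g : 2
  induction α j with
  | zero => rfl
  | succ n ih => rw [Function.iterate_succ_apply', List.replicate_succ, List.foldr_cons, ih]

lemma wd_eq_md {f : Ed d → ℝ} (hf : ContDiff ℝ (⊤ : ℕ∞) f) (w : List (Fin d)) :
    wd w f = md (fun j => w.count j) f := by
  rw [md_eq_wd]
  refine wd_perm hf (List.perm_iff_count.2 fun j => ?_)
  rw [List.count_flatMap, ← Fin.sum_univ_def]
  simp [List.count_replicate]

lemma mlen_count (w : List (Fin d)) : mlen (fun j => w.count j) = w.length := by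
  have h := Multiset.sum_count_eq_card (s := Finset.univ) (m := (w : Multiset (Fin d))) (by simp)
  simpa [mlen] using h

lemma iteratedFDeriv_single {f : Ed d → ℝ} (hf : ContDiff ℝ (⊤ : ℕ∞) f) {n : ℕ} (m : Fin n → Fin d)
    (x : Ed d) :
    iteratedFDeriv ℝ n f x (fun i => EuclideanSpace.single (m i) 1) = wd (List.ofFn m) f x := by
  induction n generalizing x with
  | zero => simp
  | succ n ih =>
    rw [iteratedFDeriv_succ_apply_left, List.ofFn_succ, wd_cons, pd,
      ← fderiv_continuousMultilinear_apply_const_apply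
        ((hf.smooth_iteratedFDeriv n).differentiable (by simp) x)]
    congr 2
    ext y
    exact ih (fun i => m i.succ) y

lemma norm_multilinear_le_sum_single {n : ℕ}
    (A : ContinuousMultilinearMap ℝ (fun _ : Fin n => Ed d) ℝ) :
    ‖A‖ ≤ ∑ m : Fin n → Fin d, ‖A fun i => EuclideanSpace.single (m i) 1‖ := by
  refine A.opNorm_le_bound (by positivity) fun v => ?_
  have hv : v = fun i => ∑ j : Fin d, v i j • EuclideanSpace.single j (1 : ℝ) := by
    ext i j
    simp [Finset.sum_apply, Pi.single_apply]
  conv_lhs => rw [hv, A.map_sum]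
  refine (norm_sum_le _ _).trans ?_
  rw [Finset.sum_mul]
  refine Finset.sum_le_sum fun m _ => ?_
  rw [A.map_smul_univ, norm_smul, mul_comm, norm_prod]
  gcongr with i
  exact PiLp.norm_apply_le (v i) (m i)

lemma norm_iteratedFDeriv_le_sum_wd {f : Ed d → ℝ} (hf : ContDiff ℝ (⊤ : ℕ∞) f) (n : ℕ)
    (x : Ed d) : ‖iteratedFDeriv ℝ n f x‖ ≤ ∑ m : Fin n → Fin d, |wd (List.ofFn m) f x| := by
  refine (norm_multilinear_le_sum_single _).trans (le_of_eq ?_)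
  simp only [iteratedFDeriv_single hf, Real.norm_eq_abs]

lemma abs_le_of_abs_pd_le {g : Ed d → ℝ} (hg : ContDiff ℝ (⊤ : ℕ∞) g) {C : ℝ} {r : ℕ}
    (hC : 0 ≤ C) (h : ∀ j x, |pd d j g x| ≤ C * (1 + ‖x‖) ^ r) (x : Ed d) :
    |g x| ≤ (|g 0| + d * C) * (1 + ‖x‖) ^ (r + 1) := by
  have hd : ∀ y, ‖fderiv ℝ g y‖ ≤ d * C * (1 + ‖y‖) ^ r := fun y => by
    rw [← norm_iteratedFDeriv_one]
    refine (norm_iteratedFDeriv_le_sum_wd hg 1 y).trans ?_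
    refine (Finset.sum_le_sum fun m _ => (?_ : _ ≤ C * (1 + ‖y‖) ^ r)).trans (le_of_eq ?_)
    · simpa using h (m 0) y
    · simp [mul_assoc]
  have h1 := (convex_closedBall (0 : Ed d) ‖x‖).norm_image_sub_le_of_norm_fderiv_le
    (𝕜 := ℝ) (f := g) (C := d * C * (1 + ‖x‖) ^ r) (x := 0) (y := x)
    (fun y _ => hg.differentiable (by simp) y) (fun y hy => (hd y).trans (by
      have := mem_closedBall_zero_iff.1 hy
      gcongr)) (by simp) (by simp)
  rw [sub_zero, Real.norm_eq_abs] at h1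
  have h2 : |g x| ≤ |g 0| + |g x - g 0| := by
    have := abs_add_le (g 0) (g x - g 0)
    rwa [add_sub_cancel] at this
  have h3 : 1 ≤ (1 + ‖x‖) ^ (r + 1) := one_le_pow₀ (by linarith [norm_nonneg x])
  calc _ ≤ |g 0| * 1 + d * C * (1 + ‖x‖) ^ r * ‖x‖ := by linarith
    _ ≤ |g 0| * (1 + ‖x‖) ^ (r + 1) + d * C * (1 + ‖x‖) ^ r * (1 + ‖x‖) := by
        gcongr
        linarith
    _ = _ := by ring

end WordDerivatives

section Families

variable {d : ℕ} {I : Set ℝ} {V : ℝ → Ed d → ℝ}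

lemma exists_wd_bound (hI : IsCompact I) (hs : ∀ t ∈ I, ContDiff ℝ (⊤ : ℕ∞) (V t))
    (hc : ∀ w, ContinuousOn (fun p : ℝ × Ed d => wd w (V p.1) p.2) (I ×ˢ univ))
    (hb : ∀ w : List (Fin d), 2 ≤ w.length → ∃ C : ℝ, ∀ t ∈ I, ∀ x, |wd w (V t) x| ≤ C)
    (w : List (Fin d)) : ∃ C, 0 ≤ C ∧ ∀ t ∈ I, ∀ x, |wd w (V t) x| ≤ C * wt x := by
  have h0 : ∀ w : List (Fin d), ∃ C, 0 ≤ C ∧ ∀ t ∈ I, |wd w (V t) 0| ≤ C := fun w => by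
    have h1 : ContinuousOn (fun t => wd w (V t) 0) I :=
      (hc w).comp (f := fun t => (t, (0 : Ed d))) (by fun_prop) fun t ht => ⟨ht, mem_univ _⟩
    obtain ⟨C, hC⟩ := hI.exists_bound_of_continuousOn h1
    exact ⟨|C|, abs_nonneg _, fun t ht => (hC t ht).trans (le_abs_self C)⟩
  have step : ∀ r (w : List (Fin d)), (∀ j, ∃ C, 0 ≤ C ∧ ∀ t ∈ I, ∀ x,
      |wd (j :: w) (V t) x| ≤ C * (1 + ‖x‖) ^ r) → ∃ C, 0 ≤ C ∧ ∀ t ∈ I, ∀ x,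
      |wd w (V t) x| ≤ C * (1 + ‖x‖) ^ (r + 1) := fun r w h => by
    choose C hC h using h
    obtain ⟨D, hD, h0⟩ := h0 w
    have hS : 0 ≤ ∑ j, C j := Finset.sum_nonneg fun j _ => hC j
    refine ⟨D + d * ∑ j, C j, by positivity, fun t ht x => ?_⟩
    refine (abs_le_of_abs_pd_le ((hs t ht).smooth_wd w) hS (r := r)
      (fun j x => (h j t ht x).trans ?_) x).trans ?_
    · gcongr
      exact Finset.single_le_sum (f := C) (fun i _ => hC i) (Finset.mem_univ j)
    · gcongr
      exact h0 t ht
  have h2 : ∀ w : List (Fin d), 2 ≤ w.length → ∃ C, 0 ≤ C ∧ ∀ t ∈ I, ∀ x,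
      |wd w (V t) x| ≤ C * (1 + ‖x‖) ^ 0 := fun w hw => by
    obtain ⟨C, hC⟩ := hb w hw
    exact ⟨|C|, abs_nonneg C, fun t ht x => by simpa using (hC t ht x).trans (le_abs_self C)⟩
  have h1 : ∀ w : List (Fin d), 1 ≤ w.length → ∃ C, 0 ≤ C ∧ ∀ t ∈ I, ∀ x,
      |wd w (V t) x| ≤ C * (1 + ‖x‖) ^ 1 := fun w hw =>
    step 0 w fun j => h2 (j :: w) (by simpa using hw)
  obtain ⟨C, hC, h⟩ := step 1 w fun j => h1 (j :: w) (by simp)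
  refine ⟨2 * C, by positivity, fun t ht x => (h t ht x).trans ?_⟩
  have : (1 + ‖x‖) ^ 2 ≤ 2 * wt x := by unfold wt; nlinarith [sq_nonneg (‖x‖ - 1)]
  calc _ ≤ C * (2 * wt x) := by gcongr
    _ = _ := by ring

lemma eventually_wd_sub_le (hI : IsCompact I)
    (hc : ∀ w, ContinuousOn (fun p : ℝ × Ed d => wd w (V p.1) p.2) (I ×ˢ univ))
    (w : List (Fin d)) {C : ℝ} (hC : ∀ t ∈ I, ∀ x, |wd w (V t) x| ≤ C * wt x)
    {ε : ℝ} (hε : 0 < ε) :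
    ∀ᶠ δ in 𝓝[>] (0 : ℝ), ∀ s ∈ I, ∀ t ∈ I, |t - s| ≤ δ → ∀ x,
      |wd w (V t) x - wd w (V s) x| ≤ ε * wt x ^ 2 := by
  set R := 2 * C / ε
  have huc := (hI.prod (isCompact_closedBall (0 : Ed d) R)).uniformContinuousOn_of_continuous
    ((hc w).mono (prod_mono_right (subset_univ _)))
  obtain ⟨δ, hδ, h⟩ := Metric.uniformContinuousOn_iff.1 huc ε hε
  filter_upwards [Ioo_mem_nhdsGT hδ] with η hη s hs t ht hst x
  have hw := one_le_wt x
  by_cases hx : ‖x‖ ≤ R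
  · have h1 := h (t, x) ⟨ht, by simpa using hx⟩ (s, x) ⟨hs, by simpa using hx⟩ (by
      rw [Prod.dist_eq, dist_self, Real.dist_eq]
      exact max_lt (hst.trans_lt hη.2) hδ)
    rw [Real.dist_eq] at h1
    refine h1.le.trans (le_mul_of_one_le_right hε.le (one_le_pow₀ hw))
  · have h1 : 2 * C < wt x * ε := (div_lt_iff₀ hε).1 ((not_le.1 hx).trans_le (norm_le_wt x))
    have h2 := abs_sub (wd w (V t) x) (wd w (V s) x)
    have h3 := hC t ht x
    have h4 := hC s hs x
    nlinarith

lemma exists_iteratedFDeriv_bound (hI : IsCompact I) (hs : ∀ t ∈ I, ContDiff ℝ (⊤ : ℕ∞) (V t))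
    (hc : ∀ w, ContinuousOn (fun p : ℝ × Ed d => wd w (V p.1) p.2) (I ×ˢ univ))
    (hb : ∀ w : List (Fin d), 2 ≤ w.length → ∃ C : ℝ, ∀ t ∈ I, ∀ x, |wd w (V t) x| ≤ C) (n : ℕ) :
    (∃ C, 0 ≤ C ∧ ∀ t ∈ I, ∀ x, ‖iteratedFDeriv ℝ n (V t) x‖ ≤ C * wt x) ∧
    ∀ ε > 0, ∀ᶠ δ in 𝓝[>] (0 : ℝ), ∀ s ∈ I, ∀ t ∈ I, |t - s| ≤ δ → ∀ x,
      ‖iteratedFDeriv ℝ n (V t) x - iteratedFDeriv ℝ n (V s) x‖ ≤ ε * wt x ^ 2 := by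
  choose C hC h using exists_wd_bound hI hs hc hb
  refine ⟨⟨∑ m : Fin n → Fin d, C (List.ofFn m), Finset.sum_nonneg fun _ _ => hC _,
    fun t ht x => ?_⟩, fun ε hε => ?_⟩
  · refine (norm_iteratedFDeriv_le_sum_wd (hs t ht) n x).trans ?_
    rw [Finset.sum_mul]
    exact Finset.sum_le_sum fun m _ => h _ t ht x
  · set N := (Fintype.card (Fin n → Fin d) : ℝ)
    have hN : 0 ≤ N := Nat.cast_nonneg _
    have h1 : ∀ᶠ δ in 𝓝[>] (0 : ℝ), ∀ m : Fin n → Fin d, ∀ s ∈ I, ∀ t ∈ I, |t - s| ≤ δ → ∀ x,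
        |wd (List.ofFn m) (V t) x - wd (List.ofFn m) (V s) x| ≤ ε / (N + 1) * wt x ^ 2 :=
      eventually_all.2 fun m => eventually_wd_sub_le hI hc _ (h _) (by positivity)
    filter_upwards [h1] with δ hδ s hs' t ht hst x
    refine (norm_multilinear_le_sum_single _).trans ?_
    simp only [sub_apply, iteratedFDeriv_single (hs t ht),
      iteratedFDeriv_single (hs s hs'), Real.norm_eq_abs]
    refine (Finset.sum_le_sum fun m _ => hδ m s hs' t ht hst x).trans ?_
    rw [Finset.sum_const, nsmul_eq_mul, ← mul_assoc, Finset.card_univ]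
    gcongr
    change N * _ ≤ ε
    rw [← mul_div_assoc, div_le_iff₀ (by positivity)]
    nlinarith

lemma norm_iteratedFDeriv_add_I_mul_le {f g : Ed d → ℝ} (hf : ContDiff ℝ (⊤ : ℕ∞) f)
    (hg : ContDiff ℝ (⊤ : ℕ∞) g) (n : ℕ) (x : Ed d) :
    ‖iteratedFDeriv ℝ n (fun y => (f y : ℂ) + Complex.I * (g y : ℂ)) x‖ ≤
      ‖iteratedFDeriv ℝ n f x‖ + ‖iteratedFDeriv ℝ n g x‖ := by
  have hf' : ContDiffAt ℝ n f x := hf.contDiffAt.of_le (by exact_mod_cast le_top)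
  have hg' : ContDiffAt ℝ n g x := hg.contDiffAt.of_le (by exact_mod_cast le_top)
  have hf2 : ContDiffAt ℝ n (fun y => (f y : ℂ)) x := Complex.ofRealCLM.contDiff.contDiffAt.comp x hf'
  have hg2 : ContDiffAt ℝ n (fun y => (g y : ℂ)) x := Complex.ofRealCLM.contDiff.contDiffAt.comp x hg'
  have e1 : ‖iteratedFDeriv ℝ n (fun y => (f y : ℂ)) x‖ = ‖iteratedFDeriv ℝ n f x‖ :=
    Complex.ofRealLI.norm_iteratedFDeriv_comp_left hf' le_rfl
  have e2 : ‖iteratedFDeriv ℝ n (fun y => (g y : ℂ)) x‖ = ‖iteratedFDeriv ℝ n g x‖ :=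
    Complex.ofRealLI.norm_iteratedFDeriv_comp_left hg' le_rfl
  have e : (fun y => (f y : ℂ) + Complex.I * (g y : ℂ)) =
      (fun y => (f y : ℂ)) + Complex.I • fun y => (g y : ℂ) := rfl
  have hg3 : ContDiffAt ℝ n (Complex.I • fun y => (g y : ℂ)) x := hg2.const_smul Complex.I
  rw [e, iteratedFDeriv_add_apply hf2 hg3,
    iteratedFDeriv_const_smul_apply hg2, ← e1, ← e2]
  refine (norm_add_le _ _).trans ?_
  rw [norm_smul, Complex.norm_I, one_mul]

end Families

section Evolution

variable {S : Type*} [AddCommGroup S] [Module ℝ S] [TopologicalSpace S] {p : ℕ → Seminorm ℝ S}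
  {T : ℝ} {G : ℝ → S →ₗ[ℝ] S}

/-- A continuous curve which is differentiable within `[0, T]` and solves `u' = G u`. -/
structure IsEvolution (T : ℝ) (G : ℝ → S →ₗ[ℝ] S) (u : ℝ → S) : Prop where
  continuousOn : ContinuousOn u (Icc 0 T)
  deriv : ∀ t ∈ Icc 0 T, Tendsto (fun s => (s - t)⁻¹ • (u s - u t)) (𝓝[Icc 0 T \ {t}] t)
    (𝓝 (G t (u t)))

lemma TimeContinuous.continuousOn_apply (hp : WithSeminorms p) {I : Set ℝ}
    (hG : TimeContinuous I p G)
    (hbd : ∀ k, ∃ l C, 0 ≤ C ∧ ∀ s ∈ I, ∀ f, p k (G s f) ≤ C * p l f) {u : ℝ → S}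
    (hu : ∀ k, ∃ B, 0 ≤ B ∧ ∀ s ∈ I, ∀ t ∈ I, p k (u t - u s) ≤ B * |t - s|) :
    ContinuousOn (fun t => G t (u t)) I := by
  intro t ht
  refine (hp.tendsto_nhds _ _).2 fun k ε hε => ?_
  obtain ⟨l, hl⟩ := hG k
  obtain ⟨m, C, hC, hb⟩ := hbd k
  obtain ⟨B, hB, hm⟩ := hu m
  obtain ⟨δ, hδ, h⟩ := hl (ε / 2 / (1 + p l (u t))) (by positivity)
  have hlim : Tendsto (fun s => C * (B * |s - t|)) (𝓝[I] t) (𝓝 0) := by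
    have : ContinuousAt (fun s => C * (B * |s - t|)) t := by fun_prop
    simpa using this.tendsto.mono_left nhdsWithin_le_nhds
  have hlim' : Tendsto (fun s => |s - t|) (𝓝[I] t) (𝓝 0) := by
    have : ContinuousAt (fun s => |s - t|) t := by fun_prop
    simpa using this.tendsto.mono_left nhdsWithin_le_nhds
  filter_upwards [hlim.eventually_lt_const (half_pos hε), hlim'.eventually_lt_const hδ,
    self_mem_nhdsWithin] with s h1 h2 hs
  have e : G s (u s) - G t (u t) = G s (u s - u t) + (G s (u t) - G t (u t)) := by
    rw [map_sub]; abel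
  rw [e]
  have h3 := (hb s hs (u s - u t)).trans (mul_le_mul_of_nonneg_left (hm t ht s hs) hC)
  have h4 := h t ht s hs h2.le (u t)
  have h5 : ε / 2 / (1 + p l (u t)) * p l (u t) ≤ ε / 2 := by
    have h6 : 0 ≤ p l (u t) := apply_nonneg _ _
    rw [div_mul_eq_mul_div, div_le_iff₀ (by positivity)]
    nlinarith
  linarith [map_add_le_add (p k) (G s (u s - u t)) (G s (u t) - G t (u t))]

theorem HasStep.exists_isEvolution (hp : WithSeminorms p) (hstep : HasStep (Icc 0 T) p G)
    (hT : 0 < T) (hG : TimeContinuous (Icc 0 T) p G)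
    (hcomp : ∀ w : ℕ → S, (∀ k, ∀ ε > 0, ∃ n₀, ∀ m ≥ n₀, ∀ n ≥ n₀, p k (w m - w n) ≤ ε) →
      ∃ v, ∀ k, Tendsto (fun n => p k (w n - v)) atTop (𝓝 0))
    (hsep : ∀ v, (∀ k, p k v = 0) → v = 0) (u₀ : S) :
    ∃ u, u 0 = u₀ ∧ IsEvolution T G u ∧ ContinuousOn (fun t => G t (u t)) (Icc 0 T) := by
  obtain ⟨u, hu0, hlip, hder⟩ := hstep.exists_solution hT hG hcomp u₀ hsep
  obtain ⟨_, _, _, _, hst⟩ := hstep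
  refine ⟨u, hu0, ⟨fun t ht => ?_, fun t ht => ?_⟩, hG.continuousOn_apply hp hst.bounded hlip⟩
  · refine (hp.tendsto_nhds _ _).2 fun k ε hε => ?_
    obtain ⟨B, -, h⟩ := hlip k
    have hlim : Tendsto (fun s => B * |s - t|) (𝓝[Icc 0 T] t) (𝓝 0) := by
      have : ContinuousAt (fun s => B * |s - t|) t := by fun_prop
      simpa using this.tendsto.mono_left nhdsWithin_le_nhds
    filter_upwards [hlim.eventually_lt_const hε, self_mem_nhdsWithin] with s h1 hs
    exact (h t ht s hs).trans_lt h1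
  · refine (hp.tendsto_nhds _ _).2 fun k ε hε => ?_
    obtain ⟨δ, hδ, h⟩ := hder k (ε / 2) (by positivity)
    have hlim : Tendsto (fun s => |s - t|) (𝓝[Icc 0 T \ {t}] t) (𝓝 0) := by
      have : ContinuousAt (fun s => |s - t|) t := by fun_prop
      simpa using this.tendsto.mono_left nhdsWithin_le_nhds
    filter_upwards [hlim.eventually_lt_const hδ, self_mem_nhdsWithin] with s h1 hs
    have hne : s - t ≠ 0 := sub_ne_zero.2 hs.2
    have e : (s - t)⁻¹ • (u s - u t) - G t (u t) =
        (s - t)⁻¹ • (u s - u t - (s - t) • G t (u t)) := by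
      rw [smul_sub _ (u s - u t), inv_smul_smul₀ hne]
    have hpos : 0 < |s - t| := abs_pos.2 hne
    rw [e, map_smul_eq_mul, norm_inv, Real.norm_eq_abs, inv_mul_lt_iff₀ hpos]
    have h2 := h t ht s hs.1 h1.le
    nlinarith

theorem HasStep.eq_of_isEvolution [IsTopologicalAddGroup S] (hp : WithSeminorms p)
    (hstep : HasStep (Icc 0 T) p G) (hsep : ∀ v, (∀ k, p k v = 0) → v = 0) {u v : ℝ → S}
    (hu : IsEvolution T G u) (hv : IsEvolution T G v) (h0 : v 0 = u 0) :
    ∀ t ∈ Icc 0 T, v t = u t := by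
  have hpc : ∀ k, Continuous (p k) := hp.continuous_seminorm
  have key := hstep.eq_of_deriv hsep (w := fun t => v t - u t) (by simp [h0])
    (fun k => (hpc k).comp_continuousOn (hv.continuousOn.sub hu.continuousOn))
    fun k t ht ε hε => ?_
  · exact fun t ht => sub_eq_zero.1 (key t ht)
  · have ht' : t ∈ Icc 0 T := Ico_subset_Icc_self ht
    have hle : 𝓝[>] t ≤ 𝓝[Icc 0 T \ {t}] t := by
      rw [← nhdsWithin_Ioo_eq_nhdsGT ht.2]
      exact nhdsWithin_mono _ fun z hz => ⟨⟨ht.1.trans hz.1.le, hz.2.le⟩, hz.1.ne'⟩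
    have hlim := ((hv.deriv t ht').sub (hu.deriv t ht')).mono_left hle
    filter_upwards [(hp.tendsto_nhds _ _).1 hlim k ε hε, self_mem_nhdsWithin] with z hz hzt
    have hpos : 0 < z - t := sub_pos.2 hzt
    have e : v z - u z - (v t - u t) - (z - t) • G t (v t - u t) =
        (z - t) • ((z - t)⁻¹ • (v z - v t) - (z - t)⁻¹ • (u z - u t) -
          (G t (v t) - G t (u t))) := by
      rw [smul_sub, smul_sub, smul_inv_smul₀ hpos.ne', smul_inv_smul₀ hpos.ne', map_sub]
      abel
    rw [e, map_smul_eq_mul, Real.norm_eq_abs, abs_of_pos hpos, mul_comm]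
    gcongr

end Evolution

section LinearCauchyProblem

variable {d : ℕ} {T C₀ : ℝ} {a aa : Fin d → ℝ → ℝ} {V₁ V₂ : ℝ → Ed d → ℝ}

lemma exists_potentialBound {I : Set ℝ} (hI : IsCompact I)
    (hs₁ : ∀ t ∈ I, ContDiff ℝ (⊤ : ℕ∞) (V₁ t)) (hs₂ : ∀ t ∈ I, ContDiff ℝ (⊤ : ℕ∞) (V₂ t))
    (hc₁ : ∀ w, ContinuousOn (fun p : ℝ × Ed d => wd w (V₁ p.1) p.2) (I ×ˢ univ))
    (hc₂ : ∀ w, ContinuousOn (fun p : ℝ × Ed d => wd w (V₂ p.1) p.2) (I ×ˢ univ))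
    (hlower : ∀ t ∈ I, ∀ x, -C₀ ≤ V₁ t x)
    (hb₁ : ∀ w : List (Fin d), 2 ≤ w.length → ∃ C : ℝ, ∀ t ∈ I, ∀ x, |wd w (V₁ t) x| ≤ C)
    (hb₂ : ∀ w : List (Fin d), 2 ≤ w.length → ∃ C : ℝ, ∀ t ∈ I, ∀ x, |wd w (V₂ t) x| ≤ C) :
    (∃ K : ℕ → ℝ, (∀ n, 0 ≤ K n) ∧ ∀ t ∈ I, PotentialBound C₀ K
      fun y => (V₁ t y : ℂ) + Complex.I * (V₂ t y : ℂ)) ∧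
    ∀ n, ∀ ε > 0, ∃ δ > 0, ∀ s ∈ I, ∀ t ∈ I, |t - s| ≤ δ → ∀ x,
      ‖iteratedFDeriv ℝ n (fun y => (V₁ t y : ℂ) + Complex.I * (V₂ t y : ℂ)) x -
        iteratedFDeriv ℝ n (fun y => (V₁ s y : ℂ) + Complex.I * (V₂ s y : ℂ)) x‖ ≤
        ε * wt x ^ 2 := by
  have h₁ := exists_iteratedFDeriv_bound hI hs₁ hc₁ hb₁
  have h₂ := exists_iteratedFDeriv_bound hI hs₂ hc₂ hb₂
  have hs : ∀ t ∈ I, ContDiff ℝ (⊤ : ℕ∞) fun y => (V₁ t y : ℂ) + Complex.I * (V₂ t y : ℂ) :=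
    fun t ht => (Complex.ofRealCLM.contDiff.comp (hs₁ t ht)).add
      (contDiff_const.mul (Complex.ofRealCLM.contDiff.comp (hs₂ t ht)))
  refine ⟨?_, fun n ε hε => ?_⟩
  · choose K₁ hK₁ hle₁ using fun n => (h₁ n).1
    choose K₂ hK₂ hle₂ using fun n => (h₂ n).1
    refine ⟨fun n => K₁ n + K₂ n, fun n => add_nonneg (hK₁ n) (hK₂ n), fun t ht => ⟨hs t ht,
      fun n x => ?_, fun x => by simpa using hlower t ht x⟩⟩
    rw [add_mul]
    exact (norm_iteratedFDeriv_add_I_mul_le (hs₁ t ht) (hs₂ t ht) n x).trans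
      (add_le_add (hle₁ n t ht x) (hle₂ n t ht x))
  · obtain ⟨δ, ⟨hδ₁, hδ₂⟩, hδ⟩ := (((h₁ n).2 (ε / 2) (half_pos hε)).and
      ((h₂ n).2 (ε / 2) (half_pos hε)) |>.and self_mem_nhdsWithin).exists
    refine ⟨δ, hδ, fun s hs' t ht hst x => ?_⟩
    have hn : ((n : ℕ∞) : WithTop ℕ∞) ≤ ((⊤ : ℕ∞) : WithTop ℕ∞) := by exact_mod_cast le_top
    have hsub : ∀ {F : Type} [NormedAddCommGroup F] [NormedSpace ℝ F] {f g : Ed d → F},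
        ContDiff ℝ (⊤ : ℕ∞) f → ContDiff ℝ (⊤ : ℕ∞) g →
        iteratedFDeriv ℝ n (fun y => f y - g y) x =
          iteratedFDeriv ℝ n f x - iteratedFDeriv ℝ n g x := fun hf hg =>
      iteratedFDeriv_sub_apply (hf.contDiffAt.of_le hn) (hg.contDiffAt.of_le hn)
    have e : (fun y => ((V₁ t y : ℂ) + Complex.I * (V₂ t y : ℂ)) -
        ((V₁ s y : ℂ) + Complex.I * (V₂ s y : ℂ))) =
        fun y => ((V₁ t y - V₁ s y : ℝ) : ℂ) + Complex.I * ((V₂ t y - V₂ s y : ℝ) : ℂ) := by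
      ext y
      push_cast
      ring
    rw [← hsub (hs t ht) (hs s hs'), e]
    refine (norm_iteratedFDeriv_add_I_mul_le ((hs₁ t ht).sub (hs₁ s hs'))
      ((hs₂ t ht).sub (hs₂ s hs')) n x).trans ?_
    rw [hsub (hs₁ t ht) (hs₁ s hs'), hsub (hs₂ t ht) (hs₂ s hs')]
    linarith [hδ₁ s hs' t ht hst x, hδ₂ s hs' t ht hst x]

/-- The generator `-ℒ(t)` acting on Schwartz functions. -/
def generator (a aa : Fin d → ℝ → ℝ) (V₁ V₂ : ℝ → Ed d → ℝ) (t : ℝ) :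
    SchwartzMap (Ed d) ℂ →ₗ[ℝ] SchwartzMap (Ed d) ℂ :=
  (∑ j, a j t • (dirD (EuclideanSpace.single j 1) ∘ₗ dirD (EuclideanSpace.single j 1))) +
    (∑ j, (-aa j t) • dirD (EuclideanSpace.single j 1)) +
    -mulOp fun y => (V₁ t y : ℂ) + Complex.I * (V₂ t y : ℂ)

lemma generator_apply {t : ℝ}
    (hV : (fun y => (V₁ t y : ℂ) + Complex.I * (V₂ t y : ℂ)).HasTemperateGrowth)
    (f : SchwartzMap (Ed d) ℂ) (x : Ed d) :
    generator a aa V₁ V₂ t f x = -LopT a aa V₁ V₂ t f x := by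
  have e : ∀ j : Fin d, pd d j f = dirD (EuclideanSpace.single j 1) f := fun j =>
    funext fun y => (dirD_apply _ f y).symm
  have e2 : ∀ j : Fin d, pd d j (dirD (EuclideanSpace.single j 1) f) =
      dirD (EuclideanSpace.single j 1) (dirD (EuclideanSpace.single j 1) f) := fun j =>
    funext fun y => (dirD_apply _ _ y).symm
  simp only [LopT, e, e2, generator, LinearMap.add_apply, LinearMap.neg_apply, add_apply,
    neg_apply, mulOp_apply hV, LinearMap.sum_apply, LinearMap.smul_apply, LinearMap.comp_apply,
    sum_apply, smul_apply, Complex.real_smul]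
  push_cast
  simp only [neg_mul, Finset.sum_neg_distrib]
  ring

lemma isEvolution_of_isC1Solution
    (hV : ∀ t ∈ Icc 0 T, (fun y => (V₁ t y : ℂ) + Complex.I * (V₂ t y : ℂ)).HasTemperateGrowth)
    {u : ℝ → SchwartzMap (Ed d) ℂ} (hu : IsC1Solution T a aa V₁ V₂ u) :
    IsEvolution T (generator a aa V₁ V₂) u := by
  obtain ⟨u', hc, -, hd, he⟩ := hu
  refine ⟨hc, fun t ht => ?_⟩
  have e : generator a aa V₁ V₂ t (u t) = u' t := by
    ext x
    rw [generator_apply (hV t ht)]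
    exact (eq_neg_of_add_eq_zero_left (he t ht x)).symm
  rw [e]
  exact hd t ht

lemma isC1Solution_of_isEvolution
    (hV : ∀ t ∈ Icc 0 T, (fun y => (V₁ t y : ℂ) + Complex.I * (V₂ t y : ℂ)).HasTemperateGrowth)
    {u : ℝ → SchwartzMap (Ed d) ℂ} (hu : IsEvolution T (generator a aa V₁ V₂) u)
    (hc : ContinuousOn (fun t => generator a aa V₁ V₂ t (u t)) (Icc 0 T)) :
    IsC1Solution T a aa V₁ V₂ u :=
  ⟨fun t => generator a aa V₁ V₂ t (u t), hu.continuousOn, hc, hu.deriv, fun t ht x => by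
    rw [generator_apply (hV t ht), neg_add_cancel]⟩

lemma hasStep_generator (haCont : ∀ j, ContinuousOn (a j) (Icc 0 T))
    (haaCont : ∀ j, ContinuousOn (aa j) (Icc 0 T)) (haPos : ∀ j, ∀ t ∈ Icc 0 T, 0 ≤ a j t)
    {K : ℕ → ℝ} (hK : ∀ n, 0 ≤ K n) (hC₀ : 0 ≤ C₀) (hV : ∀ t ∈ Icc 0 T, PotentialBound C₀ K
      fun y => (V₁ t y : ℂ) + Complex.I * (V₂ t y : ℂ)) :
    HasStep (Icc 0 T) (wSeminorm (Ed d) ℂ) (generator a aa V₁ V₂) := by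
  have hmono := wSeminorm_monotone (E := Ed d) (F := ℂ)
  refine (HasStep.add hmono (HasStep.sum hmono _ fun j => ?_)
    (HasStep.sum hmono _ fun j => ?_)).add hmono (hasStep_potential hK hC₀ hV)
  · obtain ⟨B, hB⟩ := isCompact_Icc.exists_bound_of_continuousOn (haCont j)
    exact hasStep_diffusion (haPos j) (fun s hs => (le_abs_self _).trans (hB s hs)) (by simp)
  · obtain ⟨B, hB⟩ := isCompact_Icc.exists_bound_of_continuousOn (haaCont j).neg
    exact hasStep_drift hB (by simp)

lemma timeContinuous_generator (haCont : ∀ j, ContinuousOn (a j) (Icc 0 T))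
    (haaCont : ∀ j, ContinuousOn (aa j) (Icc 0 T))
    (hV : TimeContinuous (Icc 0 T) (wSeminorm (Ed d) ℂ)
      fun t => -mulOp fun y => (V₁ t y : ℂ) + Complex.I * (V₂ t y : ℂ)) :
    TimeContinuous (Icc 0 T) (wSeminorm (Ed d) ℂ) (generator a aa V₁ V₂) := by
  have hmono := wSeminorm_monotone (E := Ed d) (F := ℂ)
  have hD : ∀ (j : Fin d) k (f : SchwartzMap (Ed d) ℂ),
      wSeminorm (Ed d) ℂ k (dirD (EuclideanSpace.single j 1) f) ≤ wSeminorm (Ed d) ℂ (k + 1) f :=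
    fun j k f => by simpa using wSeminorm_dirD_le k (EuclideanSpace.single j 1) f
  refine (TimeContinuous.add hmono (TimeContinuous.sum hmono _ fun j => ?_)
    (TimeContinuous.sum hmono _ fun j => ?_)).add hmono hV
  · exact TimeContinuous.smul_const (haCont j) fun k => ⟨k + 2, 1, zero_le_one, fun f => by
      rw [one_mul]
      exact (hD j k _).trans (hD j (k + 1) f)⟩
  · exact TimeContinuous.smul_const (haaCont j).neg fun k => ⟨k + 1, 1, zero_le_one, fun f => by
      rw [one_mul]
      exact hD j k f⟩

end LinearCauchyProblem

end CauchyProblem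

/-- Existence and uniqueness of the Schwartz solution to the linear Cauchy problem
(Theorem 1.2, first part, for the model operator). -/
theorem statement4 (d : ℕ) (hd : 1 ≤ d) (T : ℝ) (hT : 0 < T)
    (a aa : Fin d → ℝ → ℝ)
    (haCont : ∀ j, ContinuousOn (a j) (Set.Icc 0 T))
    (haaCont : ∀ j, ContinuousOn (aa j) (Set.Icc 0 T))
    (haPos : ∀ j, ∀ t ∈ Set.Icc (0:ℝ) T, 0 ≤ a j t)
    (C₀ : ℝ) (hC₀ : 0 < C₀) (V₁ V₂ : ℝ → Ed d → ℝ)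
    (hV₁smooth : ∀ t ∈ Set.Icc (0:ℝ) T, ContDiff ℝ (⊤ : ℕ∞) (V₁ t))
    (hV₂smooth : ∀ t ∈ Set.Icc (0:ℝ) T, ContDiff ℝ (⊤ : ℕ∞) (V₂ t))
    (hV₁cont : ∀ α : Fin d → ℕ, ContinuousOn (fun p : ℝ × Ed d => md α (V₁ p.1) p.2)
      (Set.Icc 0 T ×ˢ Set.univ))
    (hV₂cont : ∀ α : Fin d → ℕ, ContinuousOn (fun p : ℝ × Ed d => md α (V₂ p.1) p.2)
      (Set.Icc 0 T ×ˢ Set.univ))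
    (hV₁lower : ∀ t ∈ Set.Icc (0:ℝ) T, ∀ x, -C₀ ≤ V₁ t x)
    (hV₁bd : ∀ α : Fin d → ℕ, 2 ≤ mlen α → ∃ Cα : ℝ, ∀ t ∈ Set.Icc (0:ℝ) T, ∀ x,
      |md α (V₁ t) x| ≤ Cα)
    (hV₂bd : ∀ α : Fin d → ℕ, 1 ≤ mlen α → ∃ Cα : ℝ, ∀ t ∈ Set.Icc (0:ℝ) T, ∀ x,
      |md α (V₂ t) x| ≤ Cα)
    (u₀ : SchwartzMap (Ed d) ℂ) :
    ∃ u : ℝ → SchwartzMap (Ed d) ℂ,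
      (IsC1Solution T a aa V₁ V₂ u ∧ u 0 = u₀) ∧
      ∀ v : ℝ → SchwartzMap (Ed d) ℂ, IsC1Solution T a aa V₁ V₂ v → v 0 = u₀ →
        ∀ t ∈ Set.Icc (0:ℝ) T, v t = u t := by
  have hc₁ : ∀ w, ContinuousOn (fun p : ℝ × Ed d => wd w (V₁ p.1) p.2) (Set.Icc 0 T ×ˢ Set.univ) :=
    fun w => (hV₁cont _).congr fun q hq => congrFun (wd_eq_md (hV₁smooth q.1 hq.1) w) q.2
  have hc₂ : ∀ w, ContinuousOn (fun p : ℝ × Ed d => wd w (V₂ p.1) p.2) (Set.Icc 0 T ×ˢ Set.univ) :=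
    fun w => (hV₂cont _).congr fun q hq => congrFun (wd_eq_md (hV₂smooth q.1 hq.1) w) q.2
  have hb₁ : ∀ w : List (Fin d), 2 ≤ w.length → ∃ C : ℝ, ∀ t ∈ Set.Icc (0:ℝ) T, ∀ x,
      |wd w (V₁ t) x| ≤ C := fun w hw => by
    obtain ⟨C, hC⟩ := hV₁bd (fun j => w.count j) (by rwa [mlen_count])
    exact ⟨C, fun t ht x => by rw [wd_eq_md (hV₁smooth t ht)]; exact hC t ht x⟩
  have hb₂ : ∀ w : List (Fin d), 2 ≤ w.length → ∃ C : ℝ, ∀ t ∈ Set.Icc (0:ℝ) T, ∀ x,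
      |wd w (V₂ t) x| ≤ C := fun w hw => by
    obtain ⟨C, hC⟩ := hV₂bd (fun j => w.count j) (by rw [mlen_count]; omega)
    exact ⟨C, fun t ht x => by rw [wd_eq_md (hV₂smooth t ht)]; exact hC t ht x⟩
  obtain ⟨⟨K, hK, hV⟩, hVc⟩ := exists_potentialBound isCompact_Icc hV₁smooth hV₂smooth hc₁ hc₂
    hV₁lower hb₁ hb₂
  have hstep := hasStep_generator haCont haaCont haPos hK hC₀.le hV
  have hcont := timeContinuous_generator haCont haaCont (timeContinuous_potential hV hVc)
  have htemp := fun t ht => (hV t ht).hasTemperateGrowth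
  obtain ⟨u, hu0, hu, huc⟩ := hstep.exists_isEvolution withSeminorms_wSeminorm hT hcont
    wSeminorm_complete wSeminorm_separating u₀
  refine ⟨u, ⟨isC1Solution_of_isEvolution htemp hu huc, hu0⟩, fun v hv hv0 => ?_⟩
  exact hstep.eq_of_isEvolution withSeminorms_wSeminorm wSeminorm_separating hu
    (isEvolution_of_isC1Solution htemp hv) (hv0.trans hu0.symm)
end
end

section
/- Let T > 0, C ≥ 0, let E : [0,T] → [0,∞) be differentiable and F : [0,T] → [0,∞) continuous, and suppose E'(t) ≤ C·E(t) + 2·√(E(t))·F(t) for all t ∈ [0,T]. Then √(E(t)) ≤ e^{Ct/2}(√(E(0)) + ∫₀^t F(s) ds) for all t ∈ [0,T]. -/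
open MeasureTheory

/-- The energy inequality with a globally continuous forcing term and slack `ε (1 + t)`, which
makes the comparison function positive and the differential inequality strict. -/
theorem energy_le_sq_of_deriv_le {T C ε : ℝ} (hC : 0 ≤ C) (hε : 0 < ε) {E E' G : ℝ → ℝ}
    (hE : ContinuousOn E (Set.Icc 0 T)) (hE0 : 0 ≤ E 0)
    (hE' : ∀ t ∈ Set.Ico (0:ℝ) T, HasDerivWithinAt E (E' t) (Set.Ici t) t)
    (hG : Continuous G) (hGnonneg : ∀ t ∈ Set.Icc (0:ℝ) T, 0 ≤ G t)
    (hineq : ∀ t ∈ Set.Ico (0:ℝ) T, E' t ≤ C * E t + 2 * Real.sqrt (E t) * G t) :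
    ∀ t ∈ Set.Icc (0:ℝ) T,
      E t ≤ (Real.exp (C * t / 2) *
        (Real.sqrt (E 0) + (∫ s in (0:ℝ)..t, G s) + ε * (1 + t))) ^ 2 := by
  have hexp (t : ℝ) : HasDerivAt (fun t => Real.exp (C * t / 2))
      (Real.exp (C * t / 2) * (C * 1 / 2)) t :=
    (((hasDerivAt_id t).const_mul C).div_const 2).exp
  have hsum (t : ℝ) : HasDerivAt
      (fun t => Real.sqrt (E 0) + (∫ s in (0:ℝ)..t, G s) + ε * (1 + t)) (G t + ε * 1) t :=
    ((hG.integral_hasStrictDerivAt 0 t).hasDerivAt.const_add _).add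
      (((hasDerivAt_id t).const_add 1).const_mul ε)
  refine image_le_of_deriv_right_lt_deriv_boundary hE hE' ?_
    (fun t => ((hexp t).mul (hsum t)).pow 2) ?_
  · have := Real.sq_sqrt hE0
    have := Real.sqrt_nonneg (E 0)
    simp only [mul_zero, zero_div, Real.exp_zero, intervalIntegral.integral_same]
    nlinarith
  · intro t ht heq
    have hint : 0 ≤ ∫ s in (0:ℝ)..t, G s :=
      intervalIntegral.integral_nonneg ht.1 fun s hs => hGnonneg s ⟨hs.1, hs.2.trans ht.2.le⟩
    have hg : 0 < Real.sqrt (E 0) + (∫ s in (0:ℝ)..t, G s) + ε * (1 + t) := by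
      have := Real.sqrt_nonneg (E 0)
      have := mul_pos hε (show 0 < 1 + t by linarith [ht.1])
      linarith
    have hone : 1 ≤ Real.exp (C * t / 2) :=
      Real.one_le_exp (div_nonneg (mul_nonneg hC ht.1) zero_le_two)
    have hGt := hGnonneg t ⟨ht.1, ht.2.le⟩
    have hlt := hineq t ht
    simp only [Pi.mul_apply] at heq ⊢
    generalize Real.sqrt (E 0) + (∫ s in (0:ℝ)..t, G s) + ε * (1 + t) = g at *
    generalize Real.exp (C * t / 2) = e at *
    have hpos : 0 < e * g := mul_pos (by linarith) hg
    rw [heq, Real.sqrt_sq hpos.le] at hlt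
    have hstrict : G t < e * (G t + ε) := by nlinarith
    have := mul_lt_mul_of_pos_left hstrict hpos
    norm_num
    nlinarith

/-- A Gronwall-type energy inequality: if `E ≥ 0` is differentiable with
`E' ≤ C·E + 2·√E·F` on `[0,T]`, then `√(E t) ≤ e^{Ct/2}(√(E 0) + ∫₀ᵗ F)`. -/
theorem statement10 (T : ℝ) (hT : 0 < T) (C : ℝ) (hC : 0 ≤ C)
    (E E' F : ℝ → ℝ)
    (hEnonneg : ∀ t ∈ Set.Icc (0:ℝ) T, 0 ≤ E t)
    (hFnonneg : ∀ t ∈ Set.Icc (0:ℝ) T, 0 ≤ F t)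
    (hEdiff : ∀ t ∈ Set.Icc (0:ℝ) T, HasDerivWithinAt E (E' t) (Set.Icc 0 T) t)
    (hFcont : ContinuousOn F (Set.Icc 0 T))
    (hineq : ∀ t ∈ Set.Icc (0:ℝ) T, E' t ≤ C * E t + 2 * Real.sqrt (E t) * F t) :
    ∀ t ∈ Set.Icc (0:ℝ) T,
      Real.sqrt (E t) ≤ Real.exp (C * t / 2) *
        (Real.sqrt (E 0) + ∫ s in (0:ℝ)..t, F s) := by
  intro t ht
  let G := Set.IccExtend hT.le ((Set.Icc 0 T).domRestrict F)
  have hGF : ∀ s ∈ Set.Icc (0:ℝ) T, G s = F s := fun s hs =>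
    Set.IccExtend_of_mem hT.le ((Set.Icc 0 T).domRestrict F) hs
  have hG : Continuous G := hFcont.domRestrict.Icc_extend'
  have hint : ∫ s in (0:ℝ)..t, F s = ∫ s in (0:ℝ)..t, G s := by
    refine intervalIntegral.integral_congr fun s hs => ?_
    rw [Set.uIcc_of_le ht.1] at hs
    exact (hGF s ⟨hs.1, hs.2.trans ht.2⟩).symm
  have hE' : ∀ s ∈ Set.Ico (0:ℝ) T, HasDerivWithinAt E (E' s) (Set.Ici s) s := fun s hs =>
    (hEdiff s ⟨hs.1, hs.2.le⟩).mono_of_mem_nhdsWithin (Icc_mem_nhdsGE_of_mem hs)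
  have hone : 0 < 1 + t := by linarith [ht.1]
  have hexp := Real.exp_pos (C * t / 2)
  rw [hint]
  refine le_of_forall_pos_le_add fun δ hδ => ?_
  have hε : 0 < δ / (Real.exp (C * t / 2) * (1 + t)) := by positivity
  have hle := energy_le_sq_of_deriv_le hC hε (fun s hs => (hEdiff s hs).continuousWithinAt)
    (hEnonneg 0 ⟨le_rfl, hT.le⟩) hE' hG (fun s hs => (hGF s hs).symm ▸ hFnonneg s hs)
    (fun s hs => (hGF s ⟨hs.1, hs.2.le⟩).symm ▸ hineq s ⟨hs.1, hs.2.le⟩) t ht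
  have hGint : 0 ≤ ∫ s in (0:ℝ)..t, G s :=
    intervalIntegral.integral_nonneg ht.1 fun s hs => by
      have hs' : s ∈ Set.Icc (0:ℝ) T := ⟨hs.1, hs.2.trans ht.2⟩
      exact (hGF s hs').symm ▸ hFnonneg s hs'
  refine (Real.sqrt_le_left (by positivity)).2 hle |>.trans_eq ?_
  field_simp
end

section
/- Let d ≥ 1, N ∈ ℕ, 0 ≤ r < 1, and let a : ℕ^d → [0,∞). Then Σ_{|α|≤N} Σ_{0≠β≤α} r^{|β|} a(α−β) a(α) ≤ ((1−r)^{−d} − 1) · Σ_{|α|≤N} a(α)², where the inner sum runs over multi-indices β ∈ ℕ^d with β ≤ α componentwise and β ≠ 0. -/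
open scoped BigOperators

/-- The finite set of multi-indices `α : Fin d → ℕ` with `|α| ≤ N`. -/
def MI (d N : ℕ) : Finset (Fin d → ℕ) :=
  (Finset.Iic fun _ : Fin d => N).filter fun α => ∑ j, α j ≤ N

/-- A finite box truncation of `Σ_β r^{|β|} = (1-r)^{-d}`. -/
theorem sum_Iic_pow_sum_le (d N : ℕ) {r : ℝ} (hr0 : 0 ≤ r) (hr1 : r < 1) :
    ∑ β ∈ Finset.Iic (fun _ : Fin d => N), r ^ (∑ j, β j) ≤ (1 - r)⁻¹ ^ d := by
  have hbox : Finset.Iic (fun _ : Fin d => N) = Fintype.piFinset fun _ => Finset.Iic N := by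
    ext β
    simp [Pi.le_def]
  simp_rw [hbox, ← Finset.prod_pow_eq_pow_sum]
  rw [Finset.sum_prod_piFinset (Finset.Iic N) fun (_ : Fin d) k => r ^ k, Finset.prod_const,
    Finset.card_univ, Fintype.card_fin]
  refine pow_le_pow_left₀ (Finset.sum_nonneg fun k _ => pow_nonneg hr0 k) ?_ d
  rw [← tsum_geometric_of_lt_one hr0 hr1]
  exact (summable_geometric_of_lt_one hr0 hr1).sum_le_tsum _ fun k _ => pow_nonneg hr0 k

theorem mem_MI {d N : ℕ} {α : Fin d → ℕ} : α ∈ MI d N ↔ ∑ j, α j ≤ N := by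
  simp only [MI, Finset.mem_filter, Finset.mem_Iic, and_iff_right_iff_imp]
  exact fun h j => (Finset.single_le_sum (fun i _ => Nat.zero_le (α i)) (Finset.mem_univ j)).trans h

theorem le_of_mem_MI {d N : ℕ} {α : Fin d → ℕ} (h : α ∈ MI d N) : α ≤ fun _ => N :=
  Finset.mem_Iic.1 (Finset.mem_filter.1 h).1

open Classical in
/-- The shift `α ↦ α - β` maps the multi-indices above `β` in `MI d N` injectively
into `MI d N`. -/
theorem sum_MI_shift_le {d N : ℕ} (β : Fin d → ℕ) {f : (Fin d → ℕ) → ℝ} (hf : ∀ α, 0 ≤ f α) :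
    ∑ α ∈ (MI d N).filter (fun α => β ≤ α), f (α - β) ≤ ∑ α ∈ MI d N, f α := by
  have hinj : Set.InjOn (fun α : Fin d → ℕ => α - β) ((MI d N).filter fun α => β ≤ α) := by
    intro α hα α' hα' h
    simp only [Finset.coe_filter, Set.mem_ofPred_eq] at hα hα'
    exact (tsub_left_inj hα.2 hα'.2).1 h
  rw [← Finset.sum_image (f := f) hinj]
  refine Finset.sum_le_sum_of_subset_of_nonneg ?_ fun α _ _ => hf α
  intro γ hγ
  obtain ⟨α, hα, rfl⟩ := Finset.mem_image.1 hγ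
  exact mem_MI.2 ((Finset.sum_le_sum fun j _ => Nat.sub_le (α j) (β j)).trans
    (mem_MI.1 (Finset.mem_filter.1 hα).1))

open Classical in
/-- Autocorrelations of `a` on `MI d N` are at most its square sum. -/
theorem sum_MI_mul_shift_le {d N : ℕ} (β : Fin d → ℕ) (a : (Fin d → ℕ) → ℝ) :
    ∑ α ∈ (MI d N).filter (fun α => β ≤ α), a (α - β) * a α ≤ ∑ α ∈ MI d N, a α ^ 2 := by
  have h₁ := sum_MI_shift_le (N := N) β (f := fun α => a α ^ 2) fun α => sq_nonneg _
  have h₂ : ∑ α ∈ (MI d N).filter (fun α => β ≤ α), a α ^ 2 ≤ ∑ α ∈ MI d N, a α ^ 2 :=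
    Finset.sum_le_sum_of_subset_of_nonneg (Finset.filter_subset _ _) fun α _ _ => sq_nonneg _
  have h₃ : 2 * ∑ α ∈ (MI d N).filter (fun α => β ≤ α), a (α - β) * a α ≤
      ∑ α ∈ (MI d N).filter (fun α => β ≤ α), a (α - β) ^ 2 +
        ∑ α ∈ (MI d N).filter (fun α => β ≤ α), a α ^ 2 := by
    rw [Finset.mul_sum, ← Finset.sum_add_distrib]
    refine Finset.sum_le_sum fun α _ => ?_
    linarith [two_mul_le_add_sq (a (α - β)) (a α)]
  linarith

/-- The summation estimate at the core of the commutator bounds in the analytic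
energy method: `Σ_{|α|≤N} Σ_{0≠β≤α} r^{|β|} a(α-β)a(α) ≤ ((1-r)^{-d} - 1) Σ_{|α|≤N} a(α)²`. -/
theorem statement11 (d : ℕ) (hd : 1 ≤ d) (N : ℕ) (r : ℝ) (hr0 : 0 ≤ r) (hr1 : r < 1)
    (a : (Fin d → ℕ) → ℝ) (ha : ∀ α, 0 ≤ a α) :
    ∑ α ∈ MI d N, ∑ β ∈ (Finset.Iic α).filter (fun β => β ≠ 0),
        r ^ (∑ j, β j) * a (α - β) * a α
      ≤ ((1 - r)⁻¹ ^ d - 1) * ∑ α ∈ MI d N, a α ^ 2 := by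
  classical
  rw [Finset.sum_comm' (t' := (Finset.Iic fun _ : Fin d => N).erase 0)
    (s' := fun β => (MI d N).filter fun α => β ≤ α)]
  · calc
      _ ≤ ∑ β ∈ (Finset.Iic fun _ : Fin d => N).erase 0,
            r ^ (∑ j, β j) * ∑ α ∈ MI d N, a α ^ 2 := by
          refine Finset.sum_le_sum fun β _ => ?_
          simp_rw [mul_assoc]
          rw [← Finset.mul_sum]
          exact mul_le_mul_of_nonneg_left (sum_MI_mul_shift_le β a) (pow_nonneg hr0 _)
      _ ≤ _ := by
          rw [← Finset.sum_mul]
          refine mul_le_mul_of_nonneg_right ?_ (Finset.sum_nonneg fun α _ => sq_nonneg _)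
          have h0 : (0 : Fin d → ℕ) ∈ Finset.Iic fun _ : Fin d => N :=
            Finset.mem_Iic.2 fun _ => Nat.zero_le N
          have h := Finset.add_sum_erase _ (fun β : Fin d → ℕ => r ^ (∑ j, β j)) h0
          simp only [Pi.zero_apply, Finset.sum_const_zero, pow_zero] at h
          linarith [sum_Iic_pow_sum_le d N hr0 hr1]
  · intro α β
    simp only [Finset.mem_filter, Finset.mem_Iic, Finset.mem_erase]
    exact ⟨fun ⟨hα, hβ, h0⟩ => ⟨⟨hα, hβ⟩, h0, hβ.trans (le_of_mem_MI hα)⟩,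
      fun ⟨⟨hα, hβ⟩, h0, _⟩ => ⟨hα, hβ, h0⟩⟩
end
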